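/- Let σ ≥ 1 be a real number and let u₀ ∈ H²(𝕋). Then there exist T > 0 and a unique u ∈ C([0,T];H²) that is a mild solution of the gDNLS equation with initial data u₀. -/

import Mathlib

open MeasureTheory Filter

noncomputable section

/-- `k`-th Fourier coefficient of a `2π`-periodic function `f : ℝ → ℂ`. -/
def fc (f : ℝ → ℂ) (k : ℤ) : ℂ :=
  (1 / (2 * Real.pi)) *
    ∫ x in (0:ℝ)..(2 * Real.pi), f x * Complex.exp (-(Complex.I) * (k : ℂ) * (x : ℂ))

/-- Square of the `Hˢ` norm, `‖f‖_{Hˢ}² = Σₖ (1+|k|^{2s}) |f̂(k)|²`. -/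
def HsNormSq (s : ℝ) (f : ℝ → ℂ) : ℝ :=
  ∑' k : ℤ, (1 + |(k : ℝ)| ^ (2 * s)) * ‖fc f k‖ ^ 2

/-- The `Hˢ` norm. -/
def HsNorm (s : ℝ) (f : ℝ → ℂ) : ℝ := Real.sqrt (HsNormSq s f)

/-- Membership in `Hˢ(𝕋)`: `2π`-periodic, locally integrable, with finite `Hˢ` norm. -/
def MemHs (s : ℝ) (f : ℝ → ℂ) : Prop :=
  Function.Periodic f (2 * Real.pi) ∧
  IntervalIntegrable f MeasureTheory.volume 0 (2 * Real.pi) ∧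
  Summable (fun k : ℤ => (1 + |(k : ℝ)| ^ (2 * s)) * ‖fc f k‖ ^ 2)

/-- The `Hˢ` inner product `⟨f,g⟩_{Hˢ} = Σₖ (1+|k|^{2s}) f̂(k) conj (ĝ(k))`. -/
def HsInner (s : ℝ) (f g : ℝ → ℂ) : ℂ :=
  ∑' k : ℤ, (Complex.ofReal (1 + |(k : ℝ)| ^ (2 * s))) * fc f k * (starRingEnd ℂ) (fc g k)

/-- Frequency cutoff `⌈1/ε⌉` of the mollifier. -/
def Nmoll (ε : ℝ) : ℤ := ⌈1 / ε⌉

/-- The mollifier `J_ε`: Fourier projection onto modes `|k| ≤ ⌈1/ε⌉`. -/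
def Jmol (ε : ℝ) (f : ℝ → ℂ) : ℝ → ℂ :=
  fun x => ∑ k ∈ Finset.Icc (-(Nmoll ε)) (Nmoll ε),
    fc f k * Complex.exp (Complex.I * (k : ℂ) * (x : ℂ))

/-- The Schrödinger semigroup `e^{it∂ₓ²}`, acting by `f̂(k) ↦ e^{-ik²t} f̂(k)`. -/
def Sg (t : ℝ) (f : ℝ → ℂ) : ℝ → ℂ :=
  fun x => ∑' k : ℤ,
    Complex.exp (-(Complex.I) * (k : ℂ) ^ 2 * (t : ℂ)) * fc f k *
      Complex.exp (Complex.I * (k : ℂ) * (x : ℂ))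

/-- The truncated semigroup `e^{i J_ε ∂ₓ² t}`: multiplier `e^{-ik²t}` for `|k| ≤ ⌈1/ε⌉`, `1` otherwise. -/
def Bmol (ε t : ℝ) (f : ℝ → ℂ) : ℝ → ℂ :=
  fun x => f x - Jmol ε f x
    + ∑ k ∈ Finset.Icc (-(Nmoll ε)) (Nmoll ε),
        Complex.exp (-(Complex.I) * (k : ℂ) ^ 2 * (t : ℂ)) * fc f k *
          Complex.exp (Complex.I * (k : ℂ) * (x : ℂ))

/-- The gDNLS nonlinearity `|f|^{2σ} f_x`. -/
def NL (σ : ℝ) (f : ℝ → ℂ) : ℝ → ℂ :=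
  fun x => (Complex.ofReal (‖f x‖ ^ (2 * σ))) * deriv f x

/-- `u` is a mild solution of gDNLS on `[0,T]` with initial data `u₀`. -/
def IsMildSolution (σ T : ℝ) (u₀ : ℝ → ℂ) (u : ℝ → ℝ → ℂ) : Prop :=
  ∀ t ∈ Set.Icc (0 : ℝ) T, ∀ x : ℝ,
    u t x = Sg t u₀ x - ∫ s in (0:ℝ)..t, Sg (t - s) (NL σ (u s)) x

/-- `u ∈ L^∞(0,T;Hˢ)`. -/
def BddHs (s T : ℝ) (u : ℝ → ℝ → ℂ) : Prop :=
  (∀ t ∈ Set.Icc (0 : ℝ) T, MemHs s (u t)) ∧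
  ∃ M : ℝ, ∀ t ∈ Set.Icc (0 : ℝ) T, HsNorm s (u t) ≤ M

/-- Continuity in time with values in `Hˢ`, on a time set `I`. -/
def ContHsOn (s : ℝ) (I : Set ℝ) (u : ℝ → ℝ → ℂ) : Prop :=
  (∀ t ∈ I, MemHs s (u t)) ∧
  ∀ t ∈ I, Filter.Tendsto (fun t' => HsNorm s (fun x => u t' x - u t x))
    (nhdsWithin t I) (nhds 0)

/-- `u ∈ C([0,T];Hˢ)`. -/
def ContHs (s T : ℝ) (u : ℝ → ℝ → ℂ) : Prop := ContHsOn s (Set.Icc 0 T) u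

/-- The mollified nonlinearity `|J_ε f|^{2σ} J_ε f_x`. -/
def MolNL (σ ε : ℝ) (f : ℝ → ℂ) : ℝ → ℂ :=
  fun x => (Complex.ofReal (‖Jmol ε f x‖ ^ (2 * σ))) * deriv (Jmol ε f) x

/-- `F_ε(f) = -|J_ε f|^{2σ} J_ε f_x + i ∂ₓ²(J_ε f)`. -/
def Fmol (σ ε : ℝ) (f : ℝ → ℂ) : ℝ → ℂ :=
  fun x => -(MolNL σ ε f x) + Complex.I * deriv (deriv (Jmol ε f)) x

/-- The right-hand side `J_ε F_ε(f)` of the mollified gDNLS equation. -/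
def MolRHS (σ ε : ℝ) (f : ℝ → ℂ) : ℝ → ℂ := Jmol ε (Fmol σ ε f)

/-- `u` solves the mollified gDNLS equation `∂ₜ u = J_ε F_ε(u)` on the time set `I`. -/
def SolvesMollified (σ ε : ℝ) (I : Set ℝ) (u : ℝ → ℝ → ℂ) : Prop :=
  ∀ t ∈ I, ∀ x : ℝ, HasDerivAt (fun τ => u τ x) (MolRHS σ ε (u t) x) t

/-- Square of the `L²(𝕋)` norm. -/
def L2NormSq (f : ℝ → ℂ) : ℝ := ∫ x in (0:ℝ)..(2 * Real.pi), ‖f x‖ ^ 2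

/-- The `L²(𝕋)` norm. -/
def L2Norm (f : ℝ → ℂ) : ℝ := Real.sqrt (L2NormSq f)

/-- Square of the `L²(0,T;Hˢ)` norm. -/
def L2HsNormSq (T s : ℝ) (u : ℝ → ℝ → ℂ) : ℝ := ∫ t in (0:ℝ)..T, HsNormSq s (u t)

/-- The `L²(0,T;Hˢ)` norm. -/
def L2HsNorm (T s : ℝ) (u : ℝ → ℝ → ℂ) : ℝ := Real.sqrt (L2HsNormSq T s u)

/-- Membership in `L²(0,T;Hˢ)`. -/
def MemL2Hs (T s : ℝ) (u : ℝ → ℝ → ℂ) : Prop :=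
  (∀ t ∈ Set.Ioc (0:ℝ) T, MemHs s (u t)) ∧
  IntervalIntegrable (fun t => HsNormSq s (u t)) MeasureTheory.volume 0 T

/-- The gDNLS Hamiltonian `H[f] = ∫ |f_x|² + (σ+1)⁻² conj f^{σ+1} D_x (f^{σ+1})`, `D_x = -i∂ₓ`. -/
def Ham (σ : ℝ) (f : ℝ → ℂ) : ℂ :=
  ∫ x in (0:ℝ)..(2 * Real.pi),
    Complex.ofReal (‖deriv f x‖ ^ 2)
      + Complex.ofReal (((σ + 1) ^ 2)⁻¹) * ((starRingEnd ℂ) (f x)) ^ ((σ : ℂ) + 1)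
        * (-(Complex.I) * deriv (fun y => (f y) ^ ((σ : ℂ) + 1)) x)

/-- The mollified Hamiltonian `H_ε[f]`. -/
def Hmol (σ ε : ℝ) (f : ℝ → ℂ) : ℂ :=
  ∫ x in (0:ℝ)..(2 * Real.pi),
    Complex.ofReal (‖deriv f x‖ ^ 2)
      + Complex.ofReal (((σ + 1) ^ 2)⁻¹) * ((starRingEnd ℂ) (Jmol ε f x)) ^ ((σ : ℂ) + 1)
        * (-(Complex.I) * deriv (fun y => (Jmol ε f y) ^ ((σ : ℂ) + 1)) x)

/-- The mass `M[f] = ∫ |f|²`. -/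
def Mass (f : ℝ → ℂ) : ℝ := ∫ x in (0:ℝ)..(2 * Real.pi), ‖f x‖ ^ 2

/-- The momentum `P[f] = -(1/2) ∫ conj f · D_x f`, `D_x = -i∂ₓ`. -/
def Mom (f : ℝ → ℂ) : ℂ :=
  -(1/2 : ℂ) * ∫ x in (0:ℝ)..(2 * Real.pi), (starRingEnd ℂ) (f x) * (-(Complex.I) * deriv f x)

/-- The character `x ↦ e^{ikx}`. -/
def ex (k : ℤ) (x : ℝ) : ℂ := Complex.exp (Complex.I * (k : ℂ) * (x : ℂ))

/-- The function with Fourier coefficients `a`. -/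
def ev (a : ℤ → ℂ) (x : ℝ) : ℂ := ∑' k : ℤ, a k * ex k x

lemma two_pi_pos' : (0:ℝ) < 2 * Real.pi := by positivity

lemma norm_ex (k : ℤ) (x : ℝ) : ‖ex k x‖ = 1 := by
  have : Complex.I * (k : ℂ) * (x : ℂ) = ((k * x : ℝ) : ℂ) * Complex.I := by push_cast; ring
  rw [ex, this, Complex.norm_exp_ofReal_mul_I]

lemma continuous_ex (k : ℤ) : Continuous (ex k) := by unfold ex; fun_prop

lemma ex_periodic (k : ℤ) : Function.Periodic (ex k) (2 * Real.pi) := by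
  intro x
  unfold ex
  have : Complex.I * (k : ℂ) * ((x + 2 * Real.pi : ℝ) : ℂ)
      = Complex.I * (k : ℂ) * (x : ℂ) + k * (2 * Real.pi * Complex.I) := by push_cast; ring
  rw [this, Complex.exp_add, Complex.exp_int_mul_two_pi_mul_I, mul_one]

lemma ex_add (k : ℤ) (x y : ℝ) : ex k (x + y) = ex k x * ex k y := by
  unfold ex; rw [← Complex.exp_add]; push_cast; ring_nf

lemma hasDerivAt_ex (k : ℤ) (x : ℝ) :
    HasDerivAt (ex k) (Complex.I * k * ex k x) x := by
  have h : HasDerivAt (fun y : ℝ => Complex.I * (k : ℂ) * (y : ℂ)) (Complex.I * k * 1) x :=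
    (Complex.ofRealCLM.hasDerivAt (x := x)).const_mul _
  refine h.cexp.congr_deriv ?_
  simp only [ex]; ring

lemma fc_eq (f : ℝ → ℂ) (k : ℤ) : fc f k = fourierCoeffOn two_pi_pos' f k := by
  rw [fourierCoeffOn_eq_integral, fc]
  rw [Complex.real_smul]
  congr 1
  · push_cast; ring
  · refine intervalIntegral.integral_congr fun x _ => ?_
    simp only [smul_eq_mul]
    rw [mul_comm, fourier_coe_apply]
    congr 2
    have : (Real.pi : ℂ) ≠ 0 := by exact_mod_cast Real.pi_ne_zero
    push_cast
    field_simp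
    ring

lemma parseval {f : ℝ → ℂ} (hf : MemLp f 2 (volume.restrict (Set.Ioc 0 (2 * Real.pi)))) :
    HasSum (fun k => ‖fc f k‖ ^ 2) ((2 * Real.pi)⁻¹ * ∫ x in (0:ℝ)..(2 * Real.pi), ‖f x‖ ^ 2) := by
  have := hasSum_sq_fourierCoeffOn two_pi_pos' hf
  simpa [fc_eq] using this

lemma Continuous.memLp_Ioc {f : ℝ → ℂ} (hf : Continuous f) :
    MemLp f 2 (volume.restrict (Set.Ioc 0 (2 * Real.pi))) := by
  obtain ⟨C, hC⟩ := isCompact_Icc.exists_bound_of_continuousOn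
    (hf.continuousOn (s := Set.Icc 0 (2 * Real.pi)))
  refine MemLp.of_bound hf.aestronglyMeasurable C ?_
  filter_upwards [ae_restrict_mem measurableSet_Ioc] with x hx
  exact hC x ⟨hx.1.le, hx.2⟩

lemma fc_add {f g : ℝ → ℂ} (hf : Continuous f) (hg : Continuous g) (k : ℤ) :
    fc (fun x => f x + g x) k = fc f k + fc g k := by
  unfold fc
  rw [← mul_add, ← intervalIntegral.integral_add]
  · simp only [add_mul]
  · apply Continuous.intervalIntegrable; fun_prop
  · apply Continuous.intervalIntegrable; fun_prop

lemma fc_smul (c : ℂ) (f : ℝ → ℂ) (k : ℤ) :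
    fc (fun x => c * f x) k = c * fc f k := by
  unfold fc
  simp only [mul_assoc, intervalIntegral.integral_const_mul]
  ring

lemma fc_sub {f g : ℝ → ℂ} (hf : Continuous f) (hg : Continuous g) (k : ℤ) :
    fc (fun x => f x - g x) k = fc f k - fc g k := by
  have h1 := fc_add hf (by fun_prop : Continuous fun x => -1 * g x) k
  rw [fc_smul (-1) g k] at h1
  simpa [sub_eq_add_neg] using h1

lemma re_conj_mul_polar (z w : ℂ) :
    (starRingEnd ℂ z * w).re = (‖z + w‖ ^ 2 - ‖z - w‖ ^ 2) / 4 := by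
  simp only [Complex.sq_norm, Complex.normSq_apply, Complex.mul_re, Complex.conj_re,
    Complex.conj_im, Complex.add_re, Complex.add_im, Complex.sub_re, Complex.sub_im]
  ring

lemma parseval_re {f g : ℝ → ℂ} (hf : Continuous f) (hg : Continuous g) :
    HasSum (fun k => (starRingEnd ℂ (fc f k) * fc g k).re)
      ((2 * Real.pi)⁻¹ * ∫ x in (0:ℝ)..(2 * Real.pi), (starRingEnd ℂ (f x) * g x).re) := by
  have h1 := parseval (by fun_prop : Continuous fun x => f x + g x).memLp_Ioc
  have h2 := parseval (by fun_prop : Continuous fun x => f x - g x).memLp_Ioc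
  have h3 := (h1.sub h2).div_const 4
  simp only [fc_add hf hg, fc_sub hf hg, ← re_conj_mul_polar] at h3
  rw [← mul_sub, ← intervalIntegral.integral_sub, mul_div_assoc,
    ← intervalIntegral.integral_div] at h3
  · simpa only [re_conj_mul_polar] using h3
  all_goals
    · apply Continuous.intervalIntegrable; fun_prop

section ev
variable {a b : ℤ → ℂ}

lemma summable_ev (ha : Summable fun k => ‖a k‖) (x : ℝ) : Summable fun k => a k * ex k x := by
  refine Summable.of_norm ?_
  simpa [norm_ex] using ha

lemma norm_ev_le (ha : Summable fun k => ‖a k‖) (x : ℝ) : ‖ev a x‖ ≤ ∑' k, ‖a k‖ := by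
  refine tsum_of_norm_bounded ha.hasSum fun k => ?_
  simp [norm_ex]

lemma continuous_ev (ha : Summable fun k => ‖a k‖) : Continuous (ev a) := by
  refine continuous_tsum (fun k => ?_) ha fun k x => ?_
  · exact continuous_const.mul (continuous_ex k)
  · simp [norm_ex]

lemma ev_periodic (a : ℤ → ℂ) : Function.Periodic (ev a) (2 * Real.pi) := by
  intro x
  simp only [ev, ex_periodic _ x]

lemma ev_sub (ha : Summable fun k => ‖a k‖) (hb : Summable fun k => ‖b k‖) (x : ℝ) :
    ev (fun k => a k - b k) x = ev a x - ev b x := by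
  simp only [ev, sub_mul]
  exact (summable_ev ha x).tsum_sub (summable_ev hb x)

lemma hasDerivAt_ev (ha : Summable fun k => ‖a k‖) (ha' : Summable fun k : ℤ => |(k:ℝ)| * ‖a k‖)
    (x : ℝ) : HasDerivAt (ev a) (ev (fun k => Complex.I * k * a k) x) x := by
  have := hasDerivAt_tsum (𝕜 := ℝ) (g := fun k y => a k * ex k y)
    (g' := fun k y => Complex.I * k * a k * ex k y)
    (u := fun k : ℤ => |(k:ℝ)| * ‖a k‖) ha' (fun k y => ?_) (fun k y => ?_) (summable_ev ha 0) x
  · exact this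
  · exact ((hasDerivAt_ex k y).const_mul (a k)).congr_deriv (by ring)
  · simp [norm_ex]

lemma fc_ex (j k : ℤ) : fc (ex j) k = if k = j then 1 else 0 := by
  have : Fact (0 < 2 * Real.pi) := ⟨two_pi_pos'⟩
  have h := congrFun (fourierCoeff_fourier (T := 2 * Real.pi) j) k
  rw [fourierCoeff_eq_intervalIntegral _ _ 0, Pi.single_apply] at h
  rw [← h, fc, Complex.real_smul, zero_add]
  congr 1
  · push_cast; ring
  · refine intervalIntegral.integral_congr fun x _ => ?_
    have hpi : (Real.pi : ℂ) ≠ 0 := by exact_mod_cast Real.pi_ne_zero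
    simp only [smul_eq_mul, fourier_coe_apply, ex]
    rw [mul_comm]
    congr 2
    · push_cast; field_simp
    · push_cast; field_simp

lemma fc_ev (ha : Summable fun k => ‖a k‖) (k : ℤ) : fc (ev a) k = a k := by
  have h := intervalIntegral.hasSum_intervalIntegral_of_summable_norm (a := 0) (b := 2 * Real.pi)
    (f := fun j => (⟨fun x => a j * ex j x * Complex.exp (-(Complex.I) * (k : ℂ) * (x : ℂ)),
      by have := continuous_ex j; fun_prop⟩ : C(ℝ, ℂ))) ?_
  · have h2 : ∀ j, a j * fc (ex j) k = (1 / (2 * Real.pi)) * ∫ x in (0:ℝ)..(2 * Real.pi),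
        a j * ex j x * Complex.exp (-(Complex.I) * (k : ℂ) * (x : ℂ)) := by
      intro j
      rw [← fc_smul]; rfl
    have h3 := h.mul_left (1 / (2 * Real.pi) : ℂ)
    simp only [ContinuousMap.coe_mk, ← h2] at h3
    have h4 := h3.tsum_eq
    simp only [tsum_mul_right] at h4
    rw [fc]
    simp only [ev]
    rw [← h4, tsum_eq_single k, fc_ex]
    · simp
    · intro j hj; simp [fc_ex, hj.symm]
  · refine Summable.of_nonneg_of_le (fun _ => norm_nonneg _) (fun j => ?_) ha
    refine ContinuousMap.norm_le _ (norm_nonneg _) |>.2 fun x => ?_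
    have : ‖Complex.exp (-(Complex.I) * (k : ℂ) * ((x:ℝ) : ℂ))‖ = 1 := by
      have := norm_ex (-k) x
      simpa [ex] using this
    simp only [ContinuousMap.restrict_apply, ContinuousMap.coe_mk, norm_mul, norm_ex, this]
    simp
end ev

/-- `Σ (1+k⁴)‖aₖ‖² ≤ M²`. -/
def Bd (M : ℝ) (a : ℤ → ℂ) : Prop := ∀ S : Finset ℤ, ∑ k ∈ S, (1 + (k:ℝ) ^ 4) * ‖a k‖ ^ 2 ≤ M ^ 2

/-- `Σ (1+k²)‖aₖ‖² ≤ B²`. -/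
def Bh (B : ℝ) (a : ℤ → ℂ) : Prop := ∀ S : Finset ℤ, ∑ k ∈ S, (1 + (k:ℝ) ^ 2) * ‖a k‖ ^ 2 ≤ B ^ 2

/-- The coefficients of the derivative. -/
def Dc (a : ℤ → ℂ) : ℤ → ℂ := fun k => Complex.I * k * a k

lemma norm_Dc (a : ℤ → ℂ) (k : ℤ) : ‖Dc a k‖ = |(k:ℝ)| * ‖a k‖ := by simp [Dc]

lemma Dc_sub (a b : ℤ → ℂ) : Dc (fun k => a k - b k) = fun k => Dc a k - Dc b k := by
  ext k; simp [Dc]; ring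

lemma summable_inv_one_add_sq : Summable fun k : ℤ => 1 / (1 + (k:ℝ) ^ 2) := by
  refine Summable.of_nonneg_of_le (fun k => by positivity) (fun k => ?_)
    ((Real.summable_one_div_int_pow (p := 2)).2 (by norm_num) |>.add
      (summable_of_hasFiniteSupport (f := fun k : ℤ => if k = 0 then (1:ℝ) else 0) ?_))
  · by_cases hk : k = 0
    · simp [hk]
    · have : (0:ℝ) < (k:ℝ) ^ 2 := by positivity
      simp only [hk, if_false, add_zero]
      exact one_div_le_one_div_of_le this (by linarith)
  · refine (Set.finite_singleton (0:ℤ)).subset fun k hk => ?_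
    by_contra h
    simp_all

/-- The Sobolev embedding constant. -/
def kap : ℝ := Real.sqrt (∑' k : ℤ, 1 / (1 + (k:ℝ) ^ 2))

lemma kap_nonneg : 0 ≤ kap := Real.sqrt_nonneg _

lemma Bh.sum_norm_le {B : ℝ} {a : ℤ → ℂ} (hB : 0 ≤ B) (h : Bh B a) (S : Finset ℤ) :
    ∑ k ∈ S, ‖a k‖ ≤ kap * B := by
  have h1 := Finset.sum_sq_le_sum_mul_sum_of_sq_le_mul S (r := fun k => ‖a k‖)
    (f := fun k : ℤ => 1 / (1 + (k:ℝ) ^ 2)) (g := fun k : ℤ => (1 + (k:ℝ) ^ 2) * ‖a k‖ ^ 2)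
    (fun k _ => by positivity) (fun k _ => by positivity) (fun k _ => by
      have : (1 + (k:ℝ) ^ 2) ≠ 0 := by positivity
      apply le_of_eq; field_simp)
  have h2 : ∑ k ∈ S, 1 / (1 + (k:ℝ) ^ 2) ≤ kap ^ 2 := by
    rw [kap, Real.sq_sqrt (tsum_nonneg fun k => by positivity)]
    exact summable_inv_one_add_sq.sum_le_tsum S (fun k _ => by positivity)
  refine abs_le_of_sq_le_sq' ?_ (mul_nonneg kap_nonneg hB) |>.2
  rw [mul_pow]
  exact h1.trans (mul_le_mul h2 (h S) (Finset.sum_nonneg fun k _ => by positivity) (sq_nonneg _))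

lemma Bh.summable {B : ℝ} {a : ℤ → ℂ} (hB : 0 ≤ B) (h : Bh B a) : Summable fun k => ‖a k‖ :=
  summable_of_sum_le (fun _ => norm_nonneg _) (h.sum_norm_le hB)

lemma Bh.tsum_le {B : ℝ} {a : ℤ → ℂ} (hB : 0 ≤ B) (h : Bh B a) : ∑' k, ‖a k‖ ≤ kap * B :=
  (h.summable hB).tsum_le_of_sum_le (h.sum_norm_le hB)

lemma Bh.norm_ev_le {B : ℝ} {a : ℤ → ℂ} (hB : 0 ≤ B) (h : Bh B a) (x : ℝ) :
    ‖ev a x‖ ≤ kap * B :=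
  (_root_.norm_ev_le (h.summable hB) x).trans (h.tsum_le hB)

lemma Bh.summable_weight {B : ℝ} {a : ℤ → ℂ} (h : Bh B a) :
    Summable fun k : ℤ => (1 + (k:ℝ) ^ 2) * ‖a k‖ ^ 2 :=
  summable_of_sum_le (fun _ => by positivity) h

lemma Bd.summable_weight {B : ℝ} {a : ℤ → ℂ} (h : Bd B a) :
    Summable fun k : ℤ => (1 + (k:ℝ) ^ 4) * ‖a k‖ ^ 2 :=
  summable_of_sum_le (fun _ => by positivity) h

lemma Bd.toBh {M : ℝ} {a : ℤ → ℂ} (h : Bd M a) : Bh (2 * M) a := by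
  intro S
  have := h S
  calc _ ≤ ∑ k ∈ S, 2 * ((1 + (k:ℝ) ^ 4) * ‖a k‖ ^ 2) := by
        refine Finset.sum_le_sum fun k _ => ?_
        rw [← mul_assoc]
        gcongr
        nlinarith [sq_nonneg ((k:ℝ) ^ 2 - 1), sq_nonneg (k:ℝ)]
    _ ≤ _ := by rw [← Finset.mul_sum]; nlinarith [sq_nonneg M]

lemma Bd.toBh_Dc {M : ℝ} {a : ℤ → ℂ} (h : Bd M a) : Bh (2 * M) (Dc a) := by
  intro S
  have := h S
  calc _ ≤ ∑ k ∈ S, 2 * ((1 + (k:ℝ) ^ 4) * ‖a k‖ ^ 2) := by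
        refine Finset.sum_le_sum fun k _ => ?_
        rw [← mul_assoc, norm_Dc, mul_pow, sq_abs, ← mul_assoc]
        refine mul_le_mul_of_nonneg_right ?_ (sq_nonneg _)
        nlinarith [sq_nonneg ((k:ℝ) ^ 2 - 1), sq_nonneg (k:ℝ)]
    _ ≤ _ := by rw [← Finset.mul_sum]; nlinarith [sq_nonneg M]

lemma Bd.mono {M M' : ℝ} {a : ℤ → ℂ} (hM : 0 ≤ M) (hMM : M ≤ M') (h : Bd M a) : Bd M' a :=
  fun S => (h S).trans (by gcongr)

lemma Bh.mono {M M' : ℝ} {a : ℤ → ℂ} (hM : 0 ≤ M) (hMM : M ≤ M') (h : Bh M a) : Bh M' a :=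
  fun S => (h S).trans (by gcongr)

lemma Bd.sub {M M' : ℝ} {a b : ℤ → ℂ} (hM : 0 ≤ M) (hM' : 0 ≤ M') (h : Bd M a) (h' : Bd M' b) :
    Bd (2 * (M + M')) (fun k => a k - b k) := by
  intro S
  have h1 := h S
  have h2 := h' S
  calc _ ≤ ∑ k ∈ S, (2 * ((1 + (k:ℝ) ^ 4) * ‖a k‖ ^ 2) + 2 * ((1 + (k:ℝ) ^ 4) * ‖b k‖ ^ 2)) := by
        refine Finset.sum_le_sum fun k _ => ?_
        have h3 : ‖a k - b k‖ ^ 2 ≤ 2 * ‖a k‖ ^ 2 + 2 * ‖b k‖ ^ 2 := by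
          have := norm_sub_le (a k) (b k)
          nlinarith [sq_nonneg (‖a k‖ - ‖b k‖), norm_nonneg (a k - b k), norm_nonneg (a k),
            norm_nonneg (b k)]
        have h4 : 0 ≤ 1 + (k:ℝ) ^ 4 := by positivity
        nlinarith
    _ ≤ _ := by
        rw [Finset.sum_add_distrib, ← Finset.mul_sum, ← Finset.mul_sum]
        nlinarith [mul_nonneg hM hM']

lemma Bd.summable {M : ℝ} {a : ℤ → ℂ} (hM : 0 ≤ M) (h : Bd M a) : Summable fun k => ‖a k‖ :=
  h.toBh.summable (by positivity)

lemma Bd.summable_Dc {M : ℝ} {a : ℤ → ℂ} (hM : 0 ≤ M) (h : Bd M a) :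
    Summable fun k => ‖Dc a k‖ :=
  h.toBh_Dc.summable (by positivity)

lemma Bd.hasDerivAt_ev {M : ℝ} {a : ℤ → ℂ} (hM : 0 ≤ M) (h : Bd M a) (x : ℝ) :
    HasDerivAt (ev a) (ev (Dc a) x) x :=
  _root_.hasDerivAt_ev (h.summable hM) (by simpa only [norm_Dc] using h.summable_Dc hM) x

/-- The nonlinearity in terms of Fourier coefficients, as a function. -/
def Nf (σ : ℝ) (a : ℤ → ℂ) : ℝ → ℂ :=
  fun x => ((‖ev a x‖ ^ (2 * σ) : ℝ) : ℂ) * ev (Dc a) x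

/-- The Fourier coefficients of the nonlinearity. -/
def Nc (σ : ℝ) (a : ℤ → ℂ) (k : ℤ) : ℂ := fc (Nf σ a) k

lemma rpow_lip {p R r s : ℝ} (hp : 1 ≤ p) (hr : r ∈ Set.Icc 0 R) (hs : s ∈ Set.Icc 0 R) :
    |r ^ p - s ^ p| ≤ p * R ^ (p - 1) * |r - s| := by
  refine (convex_Icc 0 R).norm_image_sub_le_of_norm_hasDerivWithin_le (𝕜 := ℝ)
    (f := fun r : ℝ => r ^ p) (f' := fun r => p * r ^ (p - 1))
    (fun x _ => (Real.hasDerivAt_rpow_const (Or.inr hp)).hasDerivWithinAt)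
    (fun x hx => ?_) hs hr
  rw [Real.norm_eq_abs, abs_of_nonneg (mul_nonneg (by linarith) (Real.rpow_nonneg hx.1 _))]
  have := Real.rpow_le_rpow hx.1 hx.2 (by linarith : 0 ≤ p - 1)
  gcongr

lemma continuous_Nf {σ M : ℝ} {a : ℤ → ℂ} (hσ : 1 ≤ σ) (hM : 0 ≤ M) (h : Bd M a) :
    Continuous (Nf σ a) := by
  have h1 := continuous_ev (h.summable hM)
  have h2 := continuous_ev (h.summable_Dc hM)
  have h3 : Continuous fun x => ‖ev a x‖ ^ (2 * σ) :=
    h1.norm.rpow_const fun x => Or.inr (by linarith)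
  exact (Complex.continuous_ofReal.comp h3).mul h2

lemma parseval_ev {a : ℤ → ℂ} (ha : Summable fun k => ‖a k‖) :
    HasSum (fun k => ‖a k‖ ^ 2) ((2 * Real.pi)⁻¹ * ∫ x in (0:ℝ)..(2 * Real.pi), ‖ev a x‖ ^ 2) := by
  have := parseval (continuous_ev ha).memLp_Ioc
  simpa only [fc_ev ha] using this

lemma inv_two_pi_nonneg : 0 ≤ (2 * Real.pi)⁻¹ := by positivity

/-- `L²` bound of the nonlinearity by the `H¹` norm. -/
lemma exists_Nc_bound {σ : ℝ} (hσ : 1 ≤ σ) (B : ℝ) (hB : 0 ≤ B) : ∃ L : ℝ, 0 ≤ L ∧ ∀ M a, 0 ≤ M →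
    Bd M a → Bh B a → ∀ S : Finset ℤ, ∑ k ∈ S, ‖Nc σ a k‖ ^ 2 ≤ L ^ 2 := by
  refine ⟨(kap * B) ^ (2 * σ) * B, ?_, fun M a hM h h' S => ?_⟩
  · have := kap_nonneg; positivity
  have hA : 0 ≤ (kap * B) ^ (2 * σ) := Real.rpow_nonneg (mul_nonneg kap_nonneg hB) _
  have h1 := parseval (continuous_Nf hσ hM h).memLp_Ioc
  have h2 := parseval_ev (h.summable_Dc hM)
  refine (sum_le_hasSum S (fun _ _ => by positivity) h1).trans ?_
  calc _ ≤ (2 * Real.pi)⁻¹ * ∫ x in (0:ℝ)..(2 * Real.pi),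
        ((kap * B) ^ (2 * σ)) ^ 2 * ‖ev (Dc a) x‖ ^ 2 := by
        refine mul_le_mul_of_nonneg_left ?_ inv_two_pi_nonneg
        refine intervalIntegral.integral_mono_on two_pi_pos'.le ?_ ?_ fun x _ => ?_
        · have := continuous_Nf hσ hM h
          apply Continuous.intervalIntegrable; fun_prop
        · have := continuous_ev (h.summable_Dc hM)
          apply Continuous.intervalIntegrable; fun_prop
        · rw [Nf, norm_mul, mul_pow, Complex.norm_real, Real.norm_eq_abs,
            abs_of_nonneg (Real.rpow_nonneg (norm_nonneg _) _)]
          have := Real.rpow_le_rpow (norm_nonneg _) (h'.norm_ev_le hB x)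
            (by linarith : 0 ≤ 2 * σ)
          gcongr
    _ = ((kap * B) ^ (2 * σ)) ^ 2 * ∑' k, ‖Dc a k‖ ^ 2 := by
        rw [h2.tsum_eq, intervalIntegral.integral_const_mul]; ring
    _ ≤ ((kap * B) ^ (2 * σ)) ^ 2 * B ^ 2 := by
        gcongr
        refine h2.summable.tsum_le_of_sum_le fun S => ?_
        refine (Finset.sum_le_sum fun k _ => ?_).trans (h' S)
        rw [norm_Dc, mul_pow, sq_abs]; nlinarith [sq_nonneg ‖a k‖]
    _ = _ := by ring

lemma norm_rpow_le {σ R : ℝ} (hσ : 1 ≤ σ) {z : ℂ} (hz : ‖z‖ ≤ R) :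
    ‖((‖z‖ ^ (2 * σ) : ℝ) : ℂ)‖ ≤ R ^ (2 * σ) := by
  rw [Complex.norm_real, Real.norm_eq_abs, abs_of_nonneg (Real.rpow_nonneg (norm_nonneg _) _)]
  exact Real.rpow_le_rpow (norm_nonneg _) hz (by linarith)

lemma norm_rpow_sub_le {σ R : ℝ} (hσ : 1 ≤ σ) {z w : ℂ} (hz : ‖z‖ ≤ R) (hw : ‖w‖ ≤ R) :
    ‖((‖z‖ ^ (2 * σ) : ℝ) : ℂ) - ((‖w‖ ^ (2 * σ) : ℝ) : ℂ)‖ ≤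
      2 * σ * R ^ (2 * σ - 1) * ‖z - w‖ := by
  rw [← Complex.ofReal_sub, Complex.norm_real, Real.norm_eq_abs]
  have hR : 0 ≤ R := (norm_nonneg _).trans hz
  refine (rpow_lip (by linarith) ⟨norm_nonneg _, hz⟩ ⟨norm_nonneg _, hw⟩).trans ?_
  have := abs_norm_sub_norm_le z w
  have := Real.rpow_nonneg hR (2 * σ - 1)
  gcongr

/-- `L²` Lipschitz bound of the nonlinearity by the `H¹` norm of the difference. -/
lemma exists_Nc_sub_bound {σ : ℝ} (hσ : 1 ≤ σ) (M : ℝ) (hM : 0 ≤ M) : ∃ C : ℝ, 0 ≤ C ∧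
    ∀ a b η, Bd M a → Bd M b → Bh η (fun k => a k - b k) →
    ∀ S : Finset ℤ, ∑ k ∈ S, ‖Nc σ a k - Nc σ b k‖ ^ 2 ≤ (C * η) ^ 2 := by
  set R := kap * (2 * M) with hR
  have hR0 : 0 ≤ R := mul_nonneg kap_nonneg (by positivity)
  set A := R ^ (2 * σ)
  set A' := 2 * σ * R ^ (2 * σ - 1) * R
  have hA : 0 ≤ A := Real.rpow_nonneg hR0 _
  have hA' : 0 ≤ A' := by have := Real.rpow_nonneg hR0 (2 * σ - 1); positivity
  refine ⟨2 * (A + A'), by positivity, fun a b η ha hb hd S => ?_⟩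
  have hM2 : 0 ≤ 2 * M := by positivity
  have hs : Summable fun k => ‖a k - b k‖ :=
    (Bd.sub hM hM ha hb).summable (by positivity)
  have hs' : Summable fun k => ‖Dc a k - Dc b k‖ := by
    have := (Bd.sub hM hM ha hb).summable_Dc (by positivity)
    rwa [Dc_sub] at this
  have ca := continuous_Nf hσ hM ha
  have cb := continuous_Nf hσ hM hb
  have cd := continuous_ev hs
  have cd' := continuous_ev hs'
  have h1 := parseval (ca.sub cb).memLp_Ioc
  have h2 := parseval_ev hs
  have h3 := parseval_ev hs'
  have key : ∀ k, fc (Nf σ a - Nf σ b) k = Nc σ a k - Nc σ b k := fun k => fc_sub ca cb k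
  simp only [key] at h1
  refine (sum_le_hasSum S (fun _ _ => by positivity) h1).trans ?_
  calc _ ≤ (2 * Real.pi)⁻¹ * ∫ x in (0:ℝ)..(2 * Real.pi),
        ((2 * A ^ 2) * ‖ev (fun k => Dc a k - Dc b k) x‖ ^ 2 +
          (2 * A' ^ 2) * ‖ev (fun k => a k - b k) x‖ ^ 2) := by
        refine mul_le_mul_of_nonneg_left ?_ inv_two_pi_nonneg
        refine intervalIntegral.integral_mono_on two_pi_pos'.le ?_ ?_ fun x _ => ?_
        · apply Continuous.intervalIntegrable; simp only [Pi.sub_apply]; fun_prop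
        · apply Continuous.intervalIntegrable; fun_prop
        · have e1 : (Nf σ a - Nf σ b) x = ((‖ev a x‖ ^ (2 * σ) : ℝ) : ℂ) *
              ev (fun k => Dc a k - Dc b k) x + (((‖ev a x‖ ^ (2 * σ) : ℝ) : ℂ) -
                ((‖ev b x‖ ^ (2 * σ) : ℝ) : ℂ)) * ev (Dc b) x := by
            rw [ev_sub (ha.summable_Dc hM) (hb.summable_Dc hM)]
            simp only [Pi.sub_apply, Nf]; ring
          have e2 : ‖(Nf σ a - Nf σ b) x‖ ≤ A * ‖ev (fun k => Dc a k - Dc b k) x‖ +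
              A' * ‖ev (fun k => a k - b k) x‖ := by
            rw [e1]
            refine (norm_add_le _ _).trans ?_
            rw [norm_mul, norm_mul]
            have f1 := norm_rpow_le hσ (ha.toBh.norm_ev_le hM2 x)
            have f2 := norm_rpow_sub_le hσ (ha.toBh.norm_ev_le hM2 x) (hb.toBh.norm_ev_le hM2 x)
            have f3 := hb.toBh_Dc.norm_ev_le hM2 x
            have f4 : 0 ≤ 2 * σ * R ^ (2 * σ - 1) := by
              have := Real.rpow_nonneg hR0 (2 * σ - 1); positivity
            rw [← ev_sub (ha.summable hM) (hb.summable hM)] at f2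
            refine add_le_add (by gcongr) ?_
            calc _ ≤ (2 * σ * R ^ (2 * σ - 1) * ‖ev (fun k => a k - b k) x‖) * R := by
                  gcongr
              _ = _ := by ring
          calc _ ≤ (A * ‖ev (fun k => Dc a k - Dc b k) x‖ +
              A' * ‖ev (fun k => a k - b k) x‖) ^ 2 := by gcongr
            _ ≤ _ := by
              nlinarith [sq_nonneg (A * ‖ev (fun k => Dc a k - Dc b k) x‖ -
                A' * ‖ev (fun k => a k - b k) x‖)]
    _ = (2 * A ^ 2) * ∑' k, ‖Dc a k - Dc b k‖ ^ 2 + (2 * A' ^ 2) * ∑' k, ‖a k - b k‖ ^ 2 := by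
        rw [h2.tsum_eq, h3.tsum_eq, intervalIntegral.integral_add,
          intervalIntegral.integral_const_mul, intervalIntegral.integral_const_mul]
        · ring
        · apply Continuous.intervalIntegrable; fun_prop
        · apply Continuous.intervalIntegrable; fun_prop
    _ ≤ (2 * A ^ 2) * η ^ 2 + (2 * A' ^ 2) * η ^ 2 := by
        gcongr
        · refine h3.summable.tsum_le_of_sum_le fun S => ?_
          refine (Finset.sum_le_sum fun k _ => ?_).trans (hd S)
          have := congrFun (Dc_sub a b) k
          rw [← this, norm_Dc, mul_pow, sq_abs]; nlinarith [sq_nonneg ‖a k - b k‖]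
        · refine h2.summable.tsum_le_of_sum_le fun S => ?_
          refine (Finset.sum_le_sum fun k _ => ?_).trans (hd S)
          nlinarith [sq_nonneg ‖a k - b k‖, sq_nonneg (k:ℝ), mul_nonneg (sq_nonneg (k:ℝ)) (sq_nonneg ‖a k - b k‖)]
    _ ≤ _ := by nlinarith [mul_nonneg hA hA', sq_nonneg η, mul_nonneg (mul_nonneg hA hA') (sq_nonneg η), mul_nonneg (sq_nonneg A) (sq_nonneg η), mul_nonneg (sq_nonneg A') (sq_nonneg η)]

lemma Bh_tendsto {ι : Type*} {l : Filter ι} {M : ℝ} {a : ι → ℤ → ℂ} {b : ℤ → ℂ}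
    (ha : ∀ᶠ i in l, Bd M (a i)) (hb : Bd M b) (h : ∀ k, Tendsto (fun i => a i k) l (nhds (b k))) :
    ∃ η : ι → ℝ, Tendsto η l (nhds 0) ∧ ∀ᶠ i in l, Bh (η i) (fun k => a i k - b k) := by
  have hpt : ∀ c : ℤ → ℂ, Bd M c → ∀ k : ℤ, ‖c k‖ ^ 2 ≤ M ^ 2 / (1 + (k:ℝ) ^ 4) := by
    intro c hc k
    rw [le_div_iff₀ (by positivity)]
    have := hc {k}
    simp only [Finset.sum_singleton] at this
    linarith
  have hdom : ∀ c : ℤ → ℂ, Bd M c → ∀ k : ℤ,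
      (1 + (k:ℝ) ^ 2) * ‖c k - b k‖ ^ 2 ≤ 8 * M ^ 2 * (1 / (1 + (k:ℝ) ^ 2)) := by
    intro c hc k
    have h1 := hpt c hc k
    have h2 := hpt b hb k
    have h3 : ‖c k - b k‖ ^ 2 ≤ 4 * (M ^ 2 / (1 + (k:ℝ) ^ 4)) := by
      have := norm_sub_le (c k) (b k)
      nlinarith [sq_nonneg (‖c k‖ - ‖b k‖), norm_nonneg (c k - b k), norm_nonneg (c k),
            norm_nonneg (b k)]
    calc _ ≤ (1 + (k:ℝ) ^ 2) * (4 * (M ^ 2 / (1 + (k:ℝ) ^ 4))) := by gcongr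
      _ ≤ _ := by
        rw [← mul_div_assoc, ← mul_div_assoc, mul_one_div, div_le_div_iff₀ (by positivity) (by positivity)]
        have : (1 + (k:ℝ) ^ 2) * (1 + (k:ℝ) ^ 2) ≤ 2 * (1 + (k:ℝ) ^ 4) := by
          nlinarith [sq_nonneg ((k:ℝ) ^ 2 - 1)]
        nlinarith [sq_nonneg M, mul_le_mul_of_nonneg_left this (sq_nonneg M)]
  have hsum : Summable fun k : ℤ => 8 * M ^ 2 * (1 / (1 + (k:ℝ) ^ 2)) :=
    summable_inv_one_add_sq.mul_left _
  have ht : Tendsto (fun i => ∑' k : ℤ, (1 + (k:ℝ) ^ 2) * ‖a i k - b k‖ ^ 2) l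
      (nhds (∑' _ : ℤ, (0:ℝ))) := by
    refine tendsto_tsum_of_dominated_convergence hsum (fun k => ?_) ?_
    · have := (((h k).sub_const (b k)).norm.pow 2).const_mul (1 + (k:ℝ) ^ 2)
      simpa using this
    · filter_upwards [ha] with i hi k
      rw [Real.norm_eq_abs, abs_of_nonneg (by positivity)]
      exact hdom _ hi k
  rw [tsum_zero] at ht
  refine ⟨fun i => Real.sqrt (∑' k : ℤ, (1 + (k:ℝ) ^ 2) * ‖a i k - b k‖ ^ 2), ?_, ?_⟩
  · simpa using ht.sqrt
  · filter_upwards [ha] with i hi S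
    rw [Real.sq_sqrt (tsum_nonneg fun k => by positivity)]
    refine Summable.sum_le_tsum S (fun k _ => by positivity) ?_
    exact Summable.of_nonneg_of_le (fun k => by positivity) (hdom _ hi) hsum

/-- The derivative of the weight `|ev a|^{2σ}`. -/
def wd (σ : ℝ) (a : ℤ → ℂ) (x : ℝ) : ℝ :=
  2 * inner ℝ (ev a x) (ev (Dc a) x) * σ * (‖ev a x‖ ^ 2) ^ (σ - 1)

lemma hasDerivAt_weight {σ M : ℝ} {a : ℤ → ℂ} (hσ : 1 ≤ σ) (hM : 0 ≤ M) (h : Bd M a) (x : ℝ) :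
    HasDerivAt (fun x => ‖ev a x‖ ^ (2 * σ)) (wd σ a x) x := by
  have h1 := ((h.hasDerivAt_ev hM x).norm_sq).rpow_const (p := σ) (Or.inr hσ)
  refine h1.congr_of_eventuallyEq (Eventually.of_forall fun y => ?_)
  simp only
  rw [Real.rpow_mul (norm_nonneg _), Real.rpow_two]

lemma continuous_wd {σ M : ℝ} {a : ℤ → ℂ} (hσ : 1 ≤ σ) (hM : 0 ≤ M) (h : Bd M a) :
    Continuous (wd σ a) := by
  have h1 := continuous_ev (h.summable hM)
  have h2 := continuous_ev (h.summable_Dc hM)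
  have h3 : Continuous fun x => (‖ev a x‖ ^ 2) ^ (σ - 1) :=
    (h1.norm.pow 2).rpow_const fun x => Or.inr (by linarith)
  unfold wd
  fun_prop

/-- A bound for `wd` on the ball of radius `M`. -/
def wdB (σ M : ℝ) : ℝ :=
  2 * ((kap * (2 * M)) * (kap * (2 * M))) * σ * ((kap * (2 * M)) ^ 2) ^ (σ - 1)

lemma wdB_nonneg {σ M : ℝ} (hσ : 1 ≤ σ) : 0 ≤ wdB σ M := by
  have := Real.rpow_nonneg (sq_nonneg (kap * (2 * M))) (σ - 1)
  have := mul_self_nonneg (kap * (2 * M))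
  unfold wdB; positivity

lemma abs_wd_le {σ M : ℝ} {a : ℤ → ℂ} (hσ : 1 ≤ σ) (hM : 0 ≤ M) (h : Bd M a) (x : ℝ) :
    |wd σ a x| ≤ wdB σ M := by
  have hM2 : 0 ≤ 2 * M := by positivity
  have f1 := h.toBh.norm_ev_le hM2 x
  have f2 := h.toBh_Dc.norm_ev_le hM2 x
  have f3 := abs_real_inner_le_norm (ev a x) (ev (Dc a) x)
  have hk : 0 ≤ kap * (2 * M) := mul_nonneg kap_nonneg hM2
  have f4 : |inner ℝ (ev a x) (ev (Dc a) x)| ≤ (kap * (2 * M)) * (kap * (2 * M)) :=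
    f3.trans (by gcongr)
  have f5 : (‖ev a x‖ ^ 2) ^ (σ - 1) ≤ ((kap * (2 * M)) ^ 2) ^ (σ - 1) :=
    Real.rpow_le_rpow (sq_nonneg _) (by gcongr) (by linarith)
  have f6 := Real.rpow_nonneg (sq_nonneg ‖ev a x‖) (σ - 1)
  rw [wd, wdB, abs_mul, abs_mul, abs_mul, abs_of_nonneg f6, abs_two, abs_of_nonneg (by linarith : 0 ≤ σ)]
  gcongr

lemma integral_weight_by_parts {σ M M' : ℝ} {a d : ℤ → ℂ} (hσ : 1 ≤ σ) (hM : 0 ≤ M) (hM' : 0 ≤ M')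
    (ha : Bd M a) (hd : Bd M' d) :
    ∫ x in (0:ℝ)..(2 * Real.pi), ‖ev a x‖ ^ (2 * σ) * (2 * inner ℝ (ev d x) (ev (Dc d) x)) =
      - ∫ x in (0:ℝ)..(2 * Real.pi), wd σ a x * ‖ev d x‖ ^ 2 := by
  have c1 := continuous_ev (hd.summable hM')
  have c2 := continuous_ev (hd.summable_Dc hM')
  have := intervalIntegral.integral_mul_deriv_eq_deriv_mul (a := 0) (b := 2 * Real.pi)
    (u := fun x => ‖ev a x‖ ^ (2 * σ)) (v := fun x => ‖ev d x‖ ^ 2) (u' := wd σ a)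
    (v' := fun x => 2 * inner ℝ (ev d x) (ev (Dc d) x))
    (fun x _ => hasDerivAt_weight hσ hM ha x) (fun x _ => (hd.hasDerivAt_ev hM' x).norm_sq)
    ((continuous_wd hσ hM ha).intervalIntegrable _ _)
    (by apply Continuous.intervalIntegrable; fun_prop)
  rw [this]
  have e1 : ev a (2 * Real.pi) = ev a 0 := by simpa using ev_periodic a 0
  have e2 : ev d (2 * Real.pi) = ev d 0 := by simpa using ev_periodic d 0
  simp only [e1, e2]
  ring

/-- The `L²` energy estimate for the difference of nonlinearities. -/
lemma exists_energy_bound {σ : ℝ} (hσ : 1 ≤ σ) (M : ℝ) (hM : 0 ≤ M) : ∃ C : ℝ, 0 ≤ C ∧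
    ∀ a b, Bd M a → Bd M b → ∃ s : ℝ,
      HasSum (fun k => (starRingEnd ℂ (a k - b k) * (Nc σ a k - Nc σ b k)).re) s ∧
      |s| ≤ C * ∑' k, ‖a k - b k‖ ^ 2 := by
  have hM2 : 0 ≤ 2 * M := by positivity
  set R := kap * (2 * M) with hR
  have hR0 : 0 ≤ R := mul_nonneg kap_nonneg (by positivity)
  set A' := 2 * σ * R ^ (2 * σ - 1) * R
  have hA' : 0 ≤ A' := by have := Real.rpow_nonneg hR0 (2 * σ - 1); positivity
  refine ⟨wdB σ M / 2 + A', by have := wdB_nonneg (M := M) hσ; positivity, fun a b ha hb => ?_⟩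
  have hD := Bd.sub hM hM ha hb
  have hM4 : 0 ≤ 2 * (M + M) := by positivity
  have hs := hD.summable hM4
  have ca := continuous_Nf hσ hM ha
  have cb := continuous_Nf hσ hM hb
  have cd := continuous_ev hs
  have cd' := continuous_ev (hD.summable_Dc hM4)
  have h1 := parseval_re cd (ca.sub cb)
  have h2 := parseval_ev hs
  have key : ∀ k, fc (Nf σ a - Nf σ b) k = Nc σ a k - Nc σ b k := fun k => fc_sub ca cb k
  simp only [key, fc_ev hs] at h1
  refine ⟨_, h1, ?_⟩
  have cw : Continuous fun x => ‖ev a x‖ ^ (2 * σ) :=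
    (continuous_ev (ha.summable hM)).norm.rpow_const fun x => Or.inr (by linarith)
  have cw' : Continuous fun x => ‖ev b x‖ ^ (2 * σ) :=
    (continuous_ev (hb.summable hM)).norm.rpow_const fun x => Or.inr (by linarith)
  have cb' := continuous_ev (hb.summable_Dc hM)
  have cwd := continuous_wd hσ hM ha
  set d : ℤ → ℂ := fun k => a k - b k
  have split : ∀ x, (starRingEnd ℂ (ev d x) * (Nf σ a - Nf σ b) x).re =
      (1/2) * (‖ev a x‖ ^ (2 * σ) * (2 * inner ℝ (ev d x) (ev (Dc d) x))) +
      (‖ev a x‖ ^ (2 * σ) - ‖ev b x‖ ^ (2 * σ)) * (starRingEnd ℂ (ev d x) * ev (Dc b) x).re := by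
    intro x
    have e1 : ev (Dc d) x = ev (Dc a) x - ev (Dc b) x := by
      rw [Dc_sub, ev_sub (ha.summable_Dc hM) (hb.summable_Dc hM)]
    have e2 : inner ℝ (ev d x) (ev (Dc d) x) = (starRingEnd ℂ (ev d x) * ev (Dc d) x).re := by
      rw [Complex.inner, mul_comm]
    rw [e2, e1]
    simp only [Nf, Pi.sub_apply, Complex.mul_re, Complex.sub_re, Complex.sub_im, Complex.mul_im,
      Complex.ofReal_re, Complex.ofReal_im, Complex.conj_re, Complex.conj_im]
    ring
  have i1 : Continuous fun x => (1/2) * (‖ev a x‖ ^ (2 * σ) * (2 * inner ℝ (ev d x) (ev (Dc d) x))) := by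
    fun_prop
  have i2 : Continuous fun x => (‖ev a x‖ ^ (2 * σ) - ‖ev b x‖ ^ (2 * σ)) *
      (starRingEnd ℂ (ev d x) * ev (Dc b) x).re := by fun_prop
  simp only [split]
  rw [intervalIntegral.integral_add (i1.intervalIntegrable _ _) (i2.intervalIntegrable _ _),
    intervalIntegral.integral_const_mul, integral_weight_by_parts hσ hM hM4 ha hD, h2.tsum_eq,
    abs_mul, abs_of_nonneg inv_two_pi_nonneg, mul_left_comm]
  refine mul_le_mul_of_nonneg_left ?_ inv_two_pi_nonneg
  have b1 : |∫ x in (0:ℝ)..(2 * Real.pi), wd σ a x * ‖ev d x‖ ^ 2| ≤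
      wdB σ M * ∫ x in (0:ℝ)..(2 * Real.pi), ‖ev d x‖ ^ 2 := by
    rw [← intervalIntegral.integral_const_mul]
    refine (intervalIntegral.abs_integral_le_integral_abs two_pi_pos'.le).trans ?_
    refine intervalIntegral.integral_mono_on two_pi_pos'.le ?_ ?_ fun x _ => ?_
    · apply Continuous.intervalIntegrable; fun_prop
    · apply Continuous.intervalIntegrable; fun_prop
    · rw [abs_mul, abs_of_nonneg (sq_nonneg ‖ev d x‖)]
      have := abs_wd_le hσ hM ha x
      gcongr
  have b2 : |∫ x in (0:ℝ)..(2 * Real.pi), (‖ev a x‖ ^ (2 * σ) - ‖ev b x‖ ^ (2 * σ)) *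
      (starRingEnd ℂ (ev d x) * ev (Dc b) x).re| ≤
      A' * ∫ x in (0:ℝ)..(2 * Real.pi), ‖ev d x‖ ^ 2 := by
    rw [← intervalIntegral.integral_const_mul]
    refine (intervalIntegral.abs_integral_le_integral_abs two_pi_pos'.le).trans ?_
    refine intervalIntegral.integral_mono_on two_pi_pos'.le ?_ ?_ fun x _ => ?_
    · exact i2.abs.intervalIntegrable _ _
    · apply Continuous.intervalIntegrable; fun_prop
    · have f2 := norm_rpow_sub_le hσ (ha.toBh.norm_ev_le hM2 x) (hb.toBh.norm_ev_le hM2 x)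
      have f3 := hb.toBh_Dc.norm_ev_le hM2 x
      have f4 : 0 ≤ 2 * σ * R ^ (2 * σ - 1) := by
        have := Real.rpow_nonneg hR0 (2 * σ - 1); positivity
      rw [← ev_sub (ha.summable hM) (hb.summable hM), ← Complex.ofReal_sub, Complex.norm_real,
        Real.norm_eq_abs] at f2
      rw [abs_mul]
      have f5 := Complex.abs_re_le_norm (starRingEnd ℂ (ev d x) * ev (Dc b) x)
      rw [norm_mul, RCLike.norm_conj] at f5
      calc _ ≤ (2 * σ * R ^ (2 * σ - 1) * ‖ev d x‖) * (‖ev d x‖ * R) := by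
            refine mul_le_mul f2 (f5.trans (by gcongr)) (abs_nonneg _) ?_
            positivity
        _ = _ := by ring
  rw [abs_le] at b1 b2 ⊢
  constructor <;> linarith [b1.1, b1.2, b2.1, b2.2]

lemma fc_translate {f : ℝ → ℂ} (hp : Function.Periodic f (2 * Real.pi)) (δ : ℝ) (k : ℤ) :
    fc (fun x => f (x + δ)) k = ex k δ * fc f k := by
  have hg : Function.Periodic (fun x => f x * ex (-k) x) (2 * Real.pi) :=
    hp.mul (ex_periodic (-k))
  have h1 : ∀ x : ℝ, Complex.exp (-(Complex.I) * (k : ℂ) * (x : ℂ)) = ex (-k) x := fun x => by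
    rw [ex]; push_cast; ring_nf
  have h3 : ex k δ * ex (-k) δ = 1 := by
    rw [ex, ex, ← Complex.exp_add]; push_cast; ring_nf; simp
  have h2 : ∀ x, f (x + δ) * ex (-k) x = ex k δ * (f (x + δ) * ex (-k) (x + δ)) := by
    intro x; rw [ex_add]; linear_combination (-(f (x + δ) * ex (-k) x)) * h3
  simp only [fc, h1, h2, intervalIntegral.integral_const_mul]
  rw [intervalIntegral.integral_comp_add_right (fun x => f x * ex (-k) x), zero_add, add_comm,
    hg.intervalIntegral_add_eq δ 0, zero_add]
  ring

/-- An `L²` Lipschitz bound on translates bounds the `H¹` seminorm. -/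
lemma sum_sq_le_of_translate {f : ℝ → ℂ} (hf : Continuous f)
    (hp : Function.Periodic f (2 * Real.pi)) {C : ℝ}
    (h : ∀ δ > 0, (2 * Real.pi)⁻¹ * ∫ x in (0:ℝ)..(2 * Real.pi), ‖f (x + δ) - f x‖ ^ 2 ≤ C * δ ^ 2)
    (S : Finset ℤ) : ∑ k ∈ S, (k:ℝ) ^ 2 * ‖fc f k‖ ^ 2 ≤ C := by
  have hlim : Tendsto (fun δ : ℝ => ∑ k ∈ S, ‖δ⁻¹ • (ex k (0 + δ) - ex k 0)‖ ^ 2 * ‖fc f k‖ ^ 2)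
      (nhdsWithin 0 (Set.Ioi 0)) (nhds (∑ k ∈ S, (k:ℝ) ^ 2 * ‖fc f k‖ ^ 2)) := by
    refine tendsto_finsetSum _ fun k _ => ?_
    have h1 := (hasDerivAt_ex k 0).tendsto_slope_zero_right
    have h2 : ‖Complex.I * k * ex k 0‖ ^ 2 = (k:ℝ) ^ 2 := by
      simp [norm_ex]
    have := (h1.norm.pow 2).mul_const (‖fc f k‖ ^ 2)
    rwa [h2] at this
  refine le_of_tendsto hlim ?_
  filter_upwards [self_mem_nhdsWithin] with δ hδ
  have hδ' : (0:ℝ) < δ := hδ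
  have h1 := parseval (by fun_prop : Continuous fun x => f (x + δ) - f x).memLp_Ioc
  have h2 : ∀ k, fc (fun x => f (x + δ) - f x) k = (ex k (0 + δ) - ex k 0) * fc f k := fun k => by
    rw [fc_sub (by fun_prop) hf, fc_translate hp, sub_mul]
    simp [ex]
  simp only [h2] at h1
  have h3 := (sum_le_hasSum S (fun _ _ => by positivity) h1).trans (h δ hδ)
  have h4 : ∑ k ∈ S, ‖δ⁻¹ • (ex k (0 + δ) - ex k 0)‖ ^ 2 * ‖fc f k‖ ^ 2 =
      (δ ^ 2)⁻¹ * ∑ k ∈ S, ‖(ex k (0 + δ) - ex k 0) * fc f k‖ ^ 2 := by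
    rw [Finset.mul_sum]
    refine Finset.sum_congr rfl fun k _ => ?_
    rw [norm_smul, norm_mul, Real.norm_eq_abs, mul_pow, mul_pow, sq_abs]
    field_simp
  rw [h4, inv_mul_le_iff₀ (by positivity)]
  linarith

/-- A continuous function equal everywhere to `0` or to `h` oscillates no more than `h`. -/
lemma norm_sub_le_of_zero_or_eq {w h : ℝ → ℂ} (hw : Continuous w) (hh : Continuous h)
    (hwh : ∀ x, w x = 0 ∨ w x = h x) {p q K : ℝ} (hpq : p ≤ q)
    (hK : ∀ y ∈ Set.Icc p q, ∀ z ∈ Set.Icc p q, ‖h y - h z‖ ≤ K) : ‖w p - w q‖ ≤ K := by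
  have hp : p ∈ Set.Icc p q := ⟨le_rfl, hpq⟩
  have hq : q ∈ Set.Icc p q := ⟨hpq, le_rfl⟩
  have hK0 : 0 ≤ K := (norm_nonneg _).trans (hK p hp p hp)
  have key : (∃ y ∈ Set.Icc p q, w y = 0) → (∃ y ∈ Set.Icc p q, w y = h y) →
      ∃ z ∈ Set.Icc p q, h z = 0 := by
    rintro ⟨y, hy, hy'⟩ ⟨z, hz, hz'⟩
    obtain ⟨r, hr, hr1, hr2⟩ := isPreconnected_closed_iff.1 (isPreconnected_Icc (a := p) (b := q))
      {x | w x = 0} {x | w x = h x} (isClosed_eq hw continuous_const) (isClosed_eq hw hh)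
      (fun x _ => hwh x) ⟨y, hy, hy'⟩ ⟨z, hz, hz'⟩
    exact ⟨r, hr, hr2.symm.trans hr1⟩
  rcases hwh p with h1 | h1 <;> rcases hwh q with h2 | h2
  · simpa [h1, h2] using hK0
  · obtain ⟨z, hz, hz'⟩ := key ⟨p, hp, h1⟩ ⟨q, hq, h2⟩
    have := hK z hz q hq
    rwa [hz', ← h1, ← h2] at this
  · obtain ⟨z, hz, hz'⟩ := key ⟨q, hq, h2⟩ ⟨p, hp, h1⟩
    have := hK p hp z hz
    rwa [hz', ← h1, ← h2] at this
  · rw [h1, h2]; exact hK p hp q hq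

/-- Truncation of coefficients to a finite set of frequencies. -/
def tr (S : Finset ℤ) (a : ℤ → ℂ) (k : ℤ) : ℂ := if k ∈ S then a k else 0

lemma norm_tr_le (S : Finset ℤ) (a : ℤ → ℂ) (k : ℤ) : ‖tr S a k‖ ≤ ‖a k‖ := by
  unfold tr; split_ifs <;> simp

lemma summable_tr {E : Type*} [NormedAddCommGroup E] {S : Finset ℤ} {f : ℤ → E}
    (h : ∀ k ∉ S, f k = 0) : Summable f :=
  (hasSum_sum_of_ne_finset_zero h).summable

lemma Bd.tr {M : ℝ} {a : ℤ → ℂ} (h : Bd M a) (S : Finset ℤ) : Bd M (tr S a) := by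
  intro F
  refine (Finset.sum_le_sum fun k _ => ?_).trans (h F)
  have := norm_tr_le S a k
  gcongr

lemma exists_trunc {M τ : ℝ} {a : ℤ → ℂ} (hM : 0 ≤ M) (h : Bd M a) (hτ : 0 < τ) :
    ∃ S : Finset ℤ, ∀ x, ‖ev (Dc a) x - ev (Dc (tr S a)) x‖ ≤ τ := by
  have hs := h.summable_Dc hM
  obtain ⟨S, hS⟩ := (hs.hasSum.eventually (lt_mem_nhds (sub_lt_self _ hτ))).exists
  refine ⟨S, fun x => ?_⟩
  have h0 : ∀ k ∉ S, ‖Dc (tr S a) k‖ = 0 := fun k hk => by simp [Dc, tr, hk]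
  have hs' : Summable fun k => ‖Dc (tr S a) k‖ := summable_tr h0
  have hdiff : ∀ k, ‖Dc a k - Dc (tr S a) k‖ = ‖Dc a k‖ - ‖Dc (tr S a) k‖ := fun k => by
    by_cases hk : k ∈ S <;> simp [Dc, tr, hk]
  have hs2 : Summable fun k => ‖Dc a k - Dc (tr S a) k‖ := by
    simpa only [hdiff] using hs.sub hs'
  rw [← ev_sub hs hs']
  refine (norm_ev_le hs2 x).trans ?_
  simp only [hdiff]
  rw [hs.tsum_sub hs', tsum_eq_sum h0]
  have : ∑ k ∈ S, ‖Dc (tr S a) k‖ = ∑ k ∈ S, ‖Dc a k‖ :=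
    Finset.sum_congr rfl fun k hk => by simp [Dc, tr, hk]
  rw [this]; linarith

lemma sq_integral_le {φ : ℝ → ℝ} (hφ : Continuous φ) (x : ℝ) {δ : ℝ} (hδ : 0 < δ) :
    (∫ y in x..(x + δ), φ y) ^ 2 ≤ δ * ∫ y in x..(x + δ), φ y ^ 2 := by
  set m := δ⁻¹ * ∫ y in x..(x + δ), φ y with hm
  have h1 : 0 ≤ ∫ y in x..(x + δ), (φ y - m) ^ 2 :=
    intervalIntegral.integral_nonneg (by linarith) fun _ _ => sq_nonneg _
  have h2 : ∫ y in x..(x + δ), (φ y - m) ^ 2 =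
      (∫ y in x..(x + δ), φ y ^ 2) - 2 * m * (∫ y in x..(x + δ), φ y) + m ^ 2 * δ := by
    have : ∀ y, (φ y - m) ^ 2 = φ y ^ 2 - 2 * m * φ y + m ^ 2 := fun y => by ring
    simp only [this]
    rw [intervalIntegral.integral_add, intervalIntegral.integral_sub,
      intervalIntegral.integral_const_mul, intervalIntegral.integral_const]
    · simp; ring
    all_goals apply Continuous.intervalIntegrable; fun_prop
  have h3 : (∫ y in x..(x + δ), φ y) = δ * m := by rw [hm]; field_simp
  rw [h2, h3] at h1
  rw [h3]
  nlinarith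

lemma integral_integral_window {φ : ℝ → ℝ} (hφ : Continuous φ)
    (hp : Function.Periodic φ (2 * Real.pi)) {δ : ℝ} :
    ∫ x in (0:ℝ)..(2 * Real.pi), ∫ y in x..(x + δ), φ y =
      δ * ∫ x in (0:ℝ)..(2 * Real.pi), φ x := by
  have h1 : ∀ x, ∫ y in x..(x + δ), φ y = ∫ r in (0:ℝ)..δ, φ (x + r) := fun x => by
    rw [intervalIntegral.integral_comp_add_left, add_zero]
  simp only [h1]
  rw [MeasureTheory.intervalIntegral_intervalIntegral_swap]
  · have h2 : ∀ r, ∫ x in (0:ℝ)..(2 * Real.pi), φ (x + r) =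
        ∫ x in (0:ℝ)..(2 * Real.pi), φ x := fun r => by
      rw [intervalIntegral.integral_comp_add_right, zero_add, add_comm,
        hp.intervalIntegral_add_eq r 0, zero_add]
    simp [h2]
  · refine IntegrableOn.mono_set (t := Set.uIcc 0 (2 * Real.pi) ×ˢ Set.uIcc 0 δ) ?_
      (Set.prod_mono Set.uIoc_subset_uIcc Set.uIoc_subset_uIcc)
    refine ContinuousOn.integrableOn_compact (isCompact_uIcc.prod isCompact_uIcc) ?_
    fun_prop

lemma norm_ev_Dc_sub_le {τ : ℝ} {a : ℤ → ℂ} {S : Finset ℤ}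
    (hS : ∀ x, ‖ev (Dc a) x - ev (Dc (tr S a)) x‖ ≤ τ) {x y z δ : ℝ}
    (hy : y ∈ Set.Icc x (x + δ)) (hz : z ∈ Set.Icc x (x + δ)) :
    ‖ev (Dc a) y - ev (Dc a) z‖ ≤
      2 * τ + ∫ r in x..(x + δ), ‖ev (Dc (Dc (tr S a))) r‖ := by
  have hs1 : Summable fun k => ‖Dc (tr S a) k‖ :=
    summable_tr (S := S) fun k hk => by simp [Dc, tr, hk]
  have hs2 : Summable fun k => ‖Dc (Dc (tr S a)) k‖ :=
    summable_tr (S := S) fun k hk => by simp [Dc, tr, hk]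
  have hd : ∀ r, HasDerivAt (ev (Dc (tr S a))) (ev (Dc (Dc (tr S a))) r) r := fun r =>
    _root_.hasDerivAt_ev hs1 (by simpa only [← norm_Dc] using hs2) r
  have hc := continuous_ev hs2
  have h1 : ‖ev (Dc (tr S a)) y - ev (Dc (tr S a)) z‖ ≤
      ∫ r in x..(x + δ), ‖ev (Dc (Dc (tr S a))) r‖ := by
    rw [← intervalIntegral.integral_eq_sub_of_hasDerivAt (fun r _ => hd r)
      (hc.intervalIntegrable _ _)]
    refine intervalIntegral.norm_integral_le_integral_norm_uIoc.trans ?_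
    rw [intervalIntegral.integral_of_le (hy.1.trans hy.2)]
    refine setIntegral_mono_set (hc.norm.integrableOn_Ioc) (ae_of_all _ fun _ => norm_nonneg _) ?_
    refine (Set.Ioc_subset_Ioc ?_ ?_).eventuallyLE
    · exact le_min hz.1 hy.1
    · exact max_le hz.2 hy.2
  have h2 := hS y
  have h3 := hS z
  rw [norm_sub_rev] at h3
  calc _ = ‖(ev (Dc a) y - ev (Dc (tr S a)) y) + (ev (Dc (tr S a)) y - ev (Dc (tr S a)) z) +
        (ev (Dc (tr S a)) z - ev (Dc a) z)‖ := by congr 1; ring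
    _ ≤ _ := (norm_add₃_le).trans (by linarith)

lemma sum_norm_Dc_Dc_tr_le {M : ℝ} {a : ℤ → ℂ} (h : Bd M a) (S : Finset ℤ) :
    (2 * Real.pi)⁻¹ * ∫ x in (0:ℝ)..(2 * Real.pi), ‖ev (Dc (Dc (tr S a))) x‖ ^ 2 ≤ M ^ 2 := by
  have hs2 : Summable fun k => ‖Dc (Dc (tr S a)) k‖ :=
    summable_tr (S := S) fun k hk => by simp [Dc, tr, hk]
  rw [← (parseval_ev hs2).tsum_eq]
  refine (parseval_ev hs2).summable.tsum_le_of_sum_le fun F => ?_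
  refine (Finset.sum_le_sum fun k _ => ?_).trans (h.tr S F)
  rw [norm_Dc, norm_Dc, mul_pow, mul_pow, sq_abs]
  nlinarith [sq_nonneg ‖tr S a k‖]

/-- `H¹` bound for continuous functions equal everywhere to `0` or to the nonlinearity. -/
lemma exists_Bh_of_zero_or_eq {σ : ℝ} (hσ : 1 ≤ σ) (M : ℝ) (hM : 0 ≤ M) : ∃ C : ℝ, 0 ≤ C ∧
    ∀ a, Bd M a → ∀ w : ℝ → ℂ, Continuous w → Function.Periodic w (2 * Real.pi) →
      (∀ x, w x = 0 ∨ w x = Nf σ a x) → Bh C (fc w) := by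
  have hM2 : 0 ≤ 2 * M := by positivity
  set R := kap * (2 * M) with hR
  have hR0 : 0 ≤ R := mul_nonneg kap_nonneg (by positivity)
  set A := R ^ (2 * σ)
  have hA : 0 ≤ A := Real.rpow_nonneg hR0 _
  have hW := wdB_nonneg (M := M) hσ
  set W := wdB σ M
  set C1 := 2 * (W * R) ^ 2 + 16 * A ^ 2 + 4 * A ^ 2 * M ^ 2 with hC1
  refine ⟨Real.sqrt (C1 + (A * R) ^ 2), Real.sqrt_nonneg _, fun a ha w hw hwp hwh F => ?_⟩
  rw [Real.sq_sqrt (by positivity)]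
  have ch := continuous_Nf hσ hM ha
  simp only [add_mul, one_mul, Finset.sum_add_distrib]
  rw [add_comm]
  refine add_le_add (sum_sq_le_of_translate hw hwp (fun δ hδ => ?_) F) ?_
  · obtain ⟨S, hS⟩ := exists_trunc hM ha hδ
    have hs2 : Summable fun k => ‖Dc (Dc (tr S a)) k‖ :=
      summable_tr (S := S) fun k hk => by simp [Dc, tr, hk]
    have cφ := continuous_ev hs2
    set φ : ℝ → ℝ := fun r => ‖ev (Dc (Dc (tr S a))) r‖ with hφ
    have cφ' : Continuous φ := cφ.norm
    have osc : ∀ x, ‖w (x + δ) - w x‖ ^ 2 ≤ (2 * (W * R) ^ 2 + 16 * A ^ 2) * δ ^ 2 +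
        4 * A ^ 2 * δ * ∫ r in x..(x + δ), φ r ^ 2 := by
      intro x
      set I := ∫ r in x..(x + δ), φ r
      have hI0 : 0 ≤ I := intervalIntegral.integral_nonneg (by linarith) fun _ _ => norm_nonneg _
      have hI := sq_integral_le cφ' x hδ
      have h1 : ‖w x - w (x + δ)‖ ≤ W * δ * R + A * (2 * δ + I) := by
        refine norm_sub_le_of_zero_or_eq hw ch hwh (by linarith) fun y hy z hz => ?_
        have e1 : Nf σ a y - Nf σ a z =
            ((‖ev a y‖ ^ (2 * σ) - ‖ev a z‖ ^ (2 * σ) : ℝ) : ℂ) * ev (Dc a) y +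
            ((‖ev a z‖ ^ (2 * σ) : ℝ) : ℂ) * (ev (Dc a) y - ev (Dc a) z) := by
          simp only [Nf]; push_cast; ring
        have e2 : ‖((‖ev a y‖ ^ (2 * σ) - ‖ev a z‖ ^ (2 * σ) : ℝ) : ℂ)‖ ≤ W * δ := by
          rw [Complex.norm_real]
          refine (convex_univ.norm_image_sub_le_of_norm_hasDerivWithin_le (𝕜 := ℝ)
            (f := fun x => ‖ev a x‖ ^ (2 * σ)) (f' := wd σ a)
            (fun x _ => (hasDerivAt_weight hσ hM ha x).hasDerivWithinAt)
            (fun x _ => abs_wd_le hσ hM ha x) (Set.mem_univ z) (Set.mem_univ y)).trans ?_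
          gcongr
          rw [Real.norm_eq_abs, abs_le]
          constructor <;> linarith [hy.1, hy.2, hz.1, hz.2]
        rw [e1]
        refine (norm_add_le _ _).trans ?_
        rw [norm_mul, norm_mul]
        have e3 := ha.toBh_Dc.norm_ev_le hM2 y
        have e4 := norm_rpow_le hσ (ha.toBh.norm_ev_le hM2 z)
        have e5 := norm_ev_Dc_sub_le hS hy hz
        gcongr
      rw [norm_sub_rev] at h1
      calc _ ≤ (W * δ * R + A * (2 * δ + I)) ^ 2 := by gcongr
        _ ≤ 2 * (W * δ * R) ^ 2 + 2 * (A * (2 * δ + I)) ^ 2 := by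
          nlinarith [sq_nonneg (W * δ * R - A * (2 * δ + I))]
        _ ≤ 2 * (W * δ * R) ^ 2 + 2 * (A ^ 2 * (8 * δ ^ 2 + 2 * I ^ 2)) := by
          rw [mul_pow A]
          gcongr
          nlinarith [sq_nonneg (2 * δ - I)]
        _ ≤ 2 * (W * δ * R) ^ 2 + 2 * (A ^ 2 * (8 * δ ^ 2 +
            2 * (δ * ∫ r in x..(x + δ), φ r ^ 2))) := by gcongr
        _ = _ := by ring
    have cI : Continuous fun x => ∫ r in x..(x + δ), φ r ^ 2 := by
      have h1 : ∀ x, ∫ y in x..(x + δ), φ y ^ 2 = ∫ r in (0:ℝ)..δ, φ (x + r) ^ 2 := fun x => by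
        rw [intervalIntegral.integral_comp_add_left (fun r => φ r ^ 2), add_zero]
      simp only [h1]
      exact intervalIntegral.continuous_parametric_intervalIntegral_of_continuous' (by fun_prop) _ _
    have hpφ : Function.Periodic (fun r => φ r ^ 2) (2 * Real.pi) := fun r => by
      simp only [hφ, ev_periodic _ r]
    calc _ ≤ (2 * Real.pi)⁻¹ * ∫ x in (0:ℝ)..(2 * Real.pi),
          ((2 * (W * R) ^ 2 + 16 * A ^ 2) * δ ^ 2 + 4 * A ^ 2 * δ * ∫ r in x..(x + δ), φ r ^ 2) := by
          refine mul_le_mul_of_nonneg_left ?_ inv_two_pi_nonneg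
          refine intervalIntegral.integral_mono_on two_pi_pos'.le ?_ ?_ fun x _ => osc x
          · apply Continuous.intervalIntegrable; fun_prop
          · apply Continuous.intervalIntegrable; fun_prop
      _ = (2 * (W * R) ^ 2 + 16 * A ^ 2) * δ ^ 2 + 4 * A ^ 2 * δ ^ 2 *
          ((2 * Real.pi)⁻¹ * ∫ x in (0:ℝ)..(2 * Real.pi), φ x ^ 2) := by
          rw [intervalIntegral.integral_add,
            intervalIntegral.integral_const_mul (4 * A ^ 2 * δ), integral_integral_window (by fun_prop) hpφ]
          · simp only [intervalIntegral.integral_const, smul_eq_mul]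
            have : Real.pi ≠ 0 := Real.pi_ne_zero
            field_simp; ring
          all_goals apply Continuous.intervalIntegrable; fun_prop
      _ ≤ (2 * (W * R) ^ 2 + 16 * A ^ 2) * δ ^ 2 + 4 * A ^ 2 * δ ^ 2 * M ^ 2 := by
          gcongr
          exact sum_norm_Dc_Dc_tr_le ha S
      _ = _ := by rw [hC1]; ring
  · refine (sum_le_hasSum F (fun _ _ => by positivity) (parseval hw.memLp_Ioc)).trans ?_
    calc _ ≤ (2 * Real.pi)⁻¹ * ∫ x in (0:ℝ)..(2 * Real.pi), (A * R) ^ 2 := by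
          refine mul_le_mul_of_nonneg_left ?_ inv_two_pi_nonneg
          refine intervalIntegral.integral_mono_on two_pi_pos'.le ?_ ?_ fun x _ => ?_
          · apply Continuous.intervalIntegrable; fun_prop
          · apply Continuous.intervalIntegrable; fun_prop
          · have : ‖w x‖ ≤ A * R := by
              rcases hwh x with h | h
              · rw [h, norm_zero]; positivity
              · rw [h, Nf, norm_mul]
                have e3 := ha.toBh_Dc.norm_ev_le hM2 x
                have e4 := norm_rpow_le hσ (ha.toBh.norm_ev_le hM2 x)
                gcongr
            gcongr
      _ = _ := by
          simp only [intervalIntegral.integral_const, smul_eq_mul]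
          have : Real.pi ≠ 0 := Real.pi_ne_zero
          field_simp; ring

lemma Nf_periodic (σ : ℝ) (a : ℤ → ℂ) : Function.Periodic (Nf σ a) (2 * Real.pi) := fun x => by
  simp only [Nf, ev_periodic _ x]

lemma exists_Bh_Nc {σ : ℝ} (hσ : 1 ≤ σ) (M : ℝ) (hM : 0 ≤ M) : ∃ C : ℝ, 0 ≤ C ∧
    ∀ a, Bd M a → Bh C (Nc σ a) := by
  obtain ⟨C, hC, h⟩ := exists_Bh_of_zero_or_eq hσ M hM
  exact ⟨C, hC, fun a ha => h a ha _ (continuous_Nf hσ hM ha) (Nf_periodic σ a) fun _ => Or.inr rfl⟩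

/-- `a` solves the equation, run at speed `ε`, at the frequencies in `S` on `[0,T]`. -/
def SolOn (σ ε T : ℝ) (a : ℝ → ℤ → ℂ) (S : Set ℤ) : Prop :=
  ∀ k ∈ S, ∀ t ∈ Set.Icc 0 T, HasDerivWithinAt (fun s => a s k)
    (ε * (-(Complex.I) * (k:ℂ) ^ 2 * a t k - Nc σ (a t) k)) (Set.Icc 0 T) t

lemma le_exp_mul_of_deriv_le {f f' : ℝ → ℝ} {T K e : ℝ} (hK : 0 ≤ K) (he : 0 ≤ e)
    (hf : ∀ t ∈ Set.Icc 0 T, HasDerivWithinAt f (f' t) (Set.Icc 0 T) t)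
    (hle : ∀ t ∈ Set.Icc 0 T, f' t ≤ K * f t + e) :
    ∀ t ∈ Set.Icc 0 T, f t ≤ Real.exp (K * t) * (f 0 + e * t) := by
  have hd : ∀ t ∈ Set.Icc 0 T, HasDerivWithinAt (fun t => Real.exp (-K * t) * f t - e * t)
      (Real.exp (-K * t) * (-K * 1) * f t + Real.exp (-K * t) * f' t - e * 1) (Set.Icc 0 T) t :=
    fun t ht => ((((hasDerivAt_id t).const_mul (-K)).exp.hasDerivWithinAt).mul (hf t ht)).sub
      (((hasDerivAt_id t).const_mul e).hasDerivWithinAt)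
  have hanti : AntitoneOn (fun t => Real.exp (-K * t) * f t - e * t) (Set.Icc 0 T) := by
    refine antitoneOn_of_hasDerivWithinAt_nonpos (convex_Icc 0 T)
      (fun t ht => (hd t ht).continuousWithinAt)
      (fun t ht => (hd t (interior_subset ht)).mono interior_subset) fun t ht => ?_
    have h1 := hle t (interior_subset ht)
    have h0 : 0 ≤ t := (interior_subset ht).1
    have h2 : Real.exp (-K * t) ≤ 1 := Real.exp_le_one_iff.2 (by nlinarith)
    have h3 := Real.exp_pos (-K * t)
    nlinarith [mul_le_mul_of_nonneg_left h1 h3.le]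
  intro t ht
  have := hanti ⟨le_rfl, ht.1.trans ht.2⟩ ht ht.1
  simp only [mul_zero, Real.exp_zero, one_mul, sub_zero] at this
  have h3 := Real.exp_pos (K * t)
  have h4 : Real.exp (K * t) * Real.exp (-K * t) = 1 := by rw [← Real.exp_add]; simp
  calc f t = Real.exp (K * t) * (Real.exp (-K * t) * f t) := by rw [← mul_assoc, h4, one_mul]
    _ ≤ _ := by gcongr; linarith

lemma abs_sum_re_le {F : Finset ℤ} {d n : ℤ → ℂ} {θ L : ℝ} (hθ : 0 ≤ θ) (hL : 0 ≤ L)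
    (hd : ∑ k ∈ F, ‖d k‖ ^ 2 ≤ θ ^ 2) (hn : ∑ k ∈ F, ‖n k‖ ^ 2 ≤ L ^ 2) :
    |∑ k ∈ F, (starRingEnd ℂ (d k) * n k).re| ≤ θ * L := by
  calc _ ≤ ∑ k ∈ F, |(starRingEnd ℂ (d k) * n k).re| := Finset.abs_sum_le_sum_abs _ _
    _ ≤ ∑ k ∈ F, ‖d k‖ * ‖n k‖ := by
        refine Finset.sum_le_sum fun k _ => (Complex.abs_re_le_norm _).trans ?_
        rw [norm_mul, RCLike.norm_conj]
    _ ≤ Real.sqrt (∑ k ∈ F, ‖d k‖ ^ 2) * Real.sqrt (∑ k ∈ F, ‖n k‖ ^ 2) :=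
        Real.sum_mul_le_sqrt_mul_sqrt _ _ _
    _ ≤ θ * L := by
        gcongr
        · exact Real.sqrt_le_iff.2 ⟨hθ, hd⟩
        · exact Real.sqrt_le_iff.2 ⟨hL, hn⟩

lemma sum_norm_sub_sq_le {F : Finset ℤ} {m n : ℤ → ℂ} {L : ℝ}
    (hm : ∑ k ∈ F, ‖m k‖ ^ 2 ≤ L ^ 2) (hn : ∑ k ∈ F, ‖n k‖ ^ 2 ≤ L ^ 2) :
    ∑ k ∈ F, ‖m k - n k‖ ^ 2 ≤ (2 * L) ^ 2 := by
  calc _ ≤ ∑ k ∈ F, (2 * ‖m k‖ ^ 2 + 2 * ‖n k‖ ^ 2) := by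
        refine Finset.sum_le_sum fun k _ => ?_
        have := norm_sub_le (m k) (n k)
        nlinarith [sq_nonneg (‖m k‖ - ‖n k‖), norm_nonneg (m k - n k), norm_nonneg (m k),
            norm_nonneg (n k)]
    _ ≤ _ := by
        rw [Finset.sum_add_distrib, ← Finset.mul_sum, ← Finset.mul_sum]
        nlinarith

/-- `L²` stability of solutions, up to high-frequency tails. -/
lemma exists_stability {σ : ℝ} (hσ : 1 ≤ σ) (M : ℝ) (hM : 0 ≤ M) : ∃ C L : ℝ, 0 ≤ C ∧ 0 ≤ L ∧
    ∀ (ε T θ : ℝ) (S : Finset ℤ) (a b : ℝ → ℤ → ℂ), |ε| ≤ 1 → 0 ≤ θ →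
      (∀ t ∈ Set.Icc 0 T, Bd M (a t)) → (∀ t ∈ Set.Icc 0 T, Bd M (b t)) →
      SolOn σ ε T a S → SolOn σ ε T b S →
      (∀ t ∈ Set.Icc 0 T, ∀ F : Finset ℤ, Disjoint F S → ∑ k ∈ F, ‖a t k - b t k‖ ^ 2 ≤ θ ^ 2) →
      ∀ t ∈ Set.Icc 0 T, ∑ k ∈ S, ‖a t k - b t k‖ ^ 2 ≤
        Real.exp (2 * C * t) * (∑ k ∈ S, ‖a 0 k - b 0 k‖ ^ 2 +
          (2 * C * θ ^ 2 + 4 * L * θ) * t) := by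
  obtain ⟨C, hC, hE⟩ := exists_energy_bound hσ M hM
  obtain ⟨L, hL, hN⟩ := exists_Nc_bound hσ (2 * M) (by positivity)
  refine ⟨C, L, hC, hL, fun ε T θ S a b hε hθ ha hb sa sb htail => ?_⟩
  refine le_exp_mul_of_deriv_le
    (f := fun t => ∑ k ∈ S, ‖a t k - b t k‖ ^ 2)
    (f' := fun t => ∑ k ∈ S, 2 * inner ℝ (a t k - b t k)
      (ε * (-(Complex.I) * (k:ℂ) ^ 2 * a t k - Nc σ (a t) k) -
        ε * (-(Complex.I) * (k:ℂ) ^ 2 * b t k - Nc σ (b t) k)))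
    (by positivity) (by positivity) (fun t ht => ?_) fun t ht => ?_
  · exact HasDerivWithinAt.fun_sum fun k hk => ((sa k hk t ht).sub (sb k hk t ht)).norm_sq
  · obtain ⟨s, hs, hsC⟩ := hE (a t) (b t) (ha t ht) (hb t ht)
    set d : ℤ → ℂ := fun k => a t k - b t k with hd
    set n : ℤ → ℂ := fun k => Nc σ (a t) k - Nc σ (b t) k with hn
    have e1 : ∀ k, inner ℝ (a t k - b t k)
      (ε * (-(Complex.I) * (k:ℂ) ^ 2 * a t k - Nc σ (a t) k) -
        ε * (-(Complex.I) * (k:ℂ) ^ 2 * b t k - Nc σ (b t) k)) =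
        - ε * (starRingEnd ℂ (d k) * n k).re := by
      intro k
      have e0 : ((k:ℂ) ^ 2) = (((k:ℝ) ^ 2 : ℝ) : ℂ) := by push_cast; rfl
      rw [Complex.inner, mul_comm, e0]
      simp only [hd, hn, Complex.mul_re, Complex.sub_re, Complex.sub_im, Complex.mul_im,
        Complex.ofReal_re, Complex.ofReal_im, Complex.conj_re, Complex.conj_im, Complex.neg_re,
        Complex.neg_im, Complex.I_re, Complex.I_im]
      ring
    have htsum : ∑' k, ‖d k‖ ^ 2 ≤ ∑ k ∈ S, ‖d k‖ ^ 2 + θ ^ 2 := by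
      refine (parseval_ev ((Bd.sub hM hM (ha t ht) (hb t ht)).summable (by positivity))).summable
        |>.tsum_le_of_sum_le fun F => ?_
      rw [← Finset.sum_inter_add_sum_sdiff F S]
      refine add_le_add (Finset.sum_le_sum_of_subset_of_nonneg Finset.inter_subset_right
        fun _ _ _ => sq_nonneg _) (htail t ht _ Finset.sdiff_disjoint)
    have hS : |∑ k ∈ S, (starRingEnd ℂ (d k) * n k).re| ≤ |s| + θ * (2 * L) := by
      refine ge_of_tendsto (hs.abs.add_const (θ * (2 * L))) ?_
      filter_upwards [eventually_ge_atTop S] with G hG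
      have h1 := Finset.sum_sdiff (f := fun k => (starRingEnd ℂ (d k) * n k).re) hG
      have h2 := abs_sum_re_le (F := G \ S) (d := d) (n := n) hθ (by positivity : 0 ≤ 2 * L)
        (htail t ht _ Finset.sdiff_disjoint)
        (sum_norm_sub_sq_le (hN M _ hM (ha t ht) (ha t ht).toBh _)
          (hN M _ hM (hb t ht) (hb t ht).toBh _))
      rw [← h1]
      have := abs_add_le (∑ k ∈ G \ S, (starRingEnd ℂ (d k) * n k).re +
        ∑ k ∈ S, (starRingEnd ℂ (d k) * n k).re) (-∑ k ∈ G \ S, (starRingEnd ℂ (d k) * n k).re)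
      rw [abs_neg] at this
      have e : ∑ k ∈ G \ S, (starRingEnd ℂ (d k) * n k).re +
        ∑ k ∈ S, (starRingEnd ℂ (d k) * n k).re + (-∑ k ∈ G \ S, (starRingEnd ℂ (d k) * n k).re) =
        ∑ k ∈ S, (starRingEnd ℂ (d k) * n k).re := by ring
      rw [e] at this
      linarith
    have e2 : ∑ k ∈ S, 2 * inner ℝ (a t k - b t k)
      (ε * (-(Complex.I) * (k:ℂ) ^ 2 * a t k - Nc σ (a t) k) -
        ε * (-(Complex.I) * (k:ℂ) ^ 2 * b t k - Nc σ (b t) k)) =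
        2 * (-ε * ∑ k ∈ S, (starRingEnd ℂ (d k) * n k).re) := by
      simp only [e1, ← Finset.mul_sum]
    have e3 : -ε * ∑ k ∈ S, (starRingEnd ℂ (d k) * n k).re ≤
        |∑ k ∈ S, (starRingEnd ℂ (d k) * n k).re| := by
      refine (le_abs_self _).trans ?_
      rw [abs_mul, abs_neg]
      exact mul_le_of_le_one_left (abs_nonneg _) hε
    rw [e2]
    have := hsC.trans (mul_le_mul_of_nonneg_left htsum hC)
    linarith

/-- The symmetric window of frequencies `|k| ≤ N`. -/
def win (N : ℕ) : Finset ℤ := Finset.Icc (-(N:ℤ)) N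

lemma mem_win {N : ℕ} {k : ℤ} : k ∈ win N ↔ |k| ≤ N := by simp [win, abs_le]

lemma win_mono {N N' : ℕ} (h : N ≤ N') : win N ⊆ win N' := fun k hk => by
  rw [mem_win] at *; omega

lemma exists_subset_win (F : Finset ℤ) : ∃ N, F ⊆ win N := by
  refine ⟨∑ k ∈ F, k.natAbs, fun k hk => ?_⟩
  have : k.natAbs ≤ ∑ k ∈ F, k.natAbs :=
    Finset.single_le_sum (f := fun k : ℤ => k.natAbs) (fun _ _ => Nat.zero_le _) hk
  rw [mem_win, Int.abs_eq_natAbs]; exact_mod_cast this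

lemma Bd.tail_le {M : ℝ} {a : ℤ → ℂ} (h : Bd M a) {K : ℕ} {F : Finset ℤ}
    (hF : Disjoint F (win K)) : ∑ k ∈ F, ‖a k‖ ^ 2 ≤ (2 * M / (1 + K)) ^ 2 := by
  have h1 := h F
  have h2 : ∀ k ∈ F, (1 + (K:ℝ)) ^ 2 / 4 * ‖a k‖ ^ 2 ≤ (1 + (k:ℝ) ^ 4) * ‖a k‖ ^ 2 := by
    intro k hk
    have hk' : k ∉ win K := Finset.disjoint_left.1 hF hk
    rw [mem_win, not_le] at hk'
    have h3 : (K:ℝ) ≤ |(k:ℝ)| := by exact_mod_cast hk'.le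
    have h4 : (K:ℝ) ^ 2 ≤ (k:ℝ) ^ 2 := by
      rw [← sq_abs (k:ℝ)]; gcongr
    refine mul_le_mul_of_nonneg_right ?_ (sq_nonneg _)
    nlinarith [sq_nonneg ((K:ℝ) - 1), sq_nonneg ((k:ℝ) ^ 2 - 1)]
  have h5 := (Finset.sum_le_sum h2).trans h1
  rw [← Finset.mul_sum] at h5
  rw [div_pow, le_div_iff₀ (by positivity)]
  nlinarith

lemma tendsto_tail (c : ℝ) : Tendsto (fun K : ℕ => c / (1 + (K:ℝ))) atTop (nhds 0) := by
  exact (tendsto_atTop_add_const_left _ 1 tendsto_natCast_atTop_atTop).const_div_atTop c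

/-- `L²` stability of full solutions. -/
lemma exists_stability_full {σ : ℝ} (hσ : 1 ≤ σ) (M : ℝ) (hM : 0 ≤ M) : ∃ C : ℝ, 0 ≤ C ∧
    ∀ (ε T D : ℝ) (a b : ℝ → ℤ → ℂ), |ε| ≤ 1 →
      (∀ t ∈ Set.Icc 0 T, Bd M (a t)) → (∀ t ∈ Set.Icc 0 T, Bd M (b t)) →
      SolOn σ ε T a Set.univ → SolOn σ ε T b Set.univ →
      (∀ F : Finset ℤ, ∑ k ∈ F, ‖a 0 k - b 0 k‖ ^ 2 ≤ D) →
      ∀ t ∈ Set.Icc 0 T, ∀ F : Finset ℤ, ∑ k ∈ F, ‖a t k - b t k‖ ^ 2 ≤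
        Real.exp (2 * C * t) * D := by
  obtain ⟨C, L, hC, hL, h⟩ := exists_stability hσ M hM
  refine ⟨C, hC, fun ε T D a b hε ha hb sa sb hD t ht F => ?_⟩
  obtain ⟨N, hN⟩ := exists_subset_win F
  set θ : ℕ → ℝ := fun K => 2 * (2 * (M + M)) / (1 + K)
  have hθ : Tendsto θ atTop (nhds 0) := tendsto_tail _
  have hlim : Tendsto (fun K => Real.exp (2 * C * t) * (D +
      (2 * C * θ K ^ 2 + 4 * L * θ K) * t)) atTop (nhds (Real.exp (2 * C * t) * (D +
      (2 * C * 0 ^ 2 + 4 * L * 0) * t))) :=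
    (((((hθ.pow 2).const_mul _).add (hθ.const_mul _)).mul_const t).const_add D).const_mul _
  have e : Real.exp (2 * C * t) * (D + (2 * C * 0 ^ 2 + 4 * L * 0) * t) =
    Real.exp (2 * C * t) * D := by ring
  rw [e] at hlim
  refine ge_of_tendsto hlim ?_
  filter_upwards [eventually_ge_atTop N] with K hK
  have h1 := h ε T (θ K) (win K) a b hε (by positivity) ha hb (fun k _ => sa k trivial)
    (fun k _ => sb k trivial) (fun t ht G hG => (Bd.sub hM hM (ha t ht) (hb t ht)).tail_le hG) t ht
  refine (Finset.sum_le_sum_of_subset_of_nonneg (hN.trans (win_mono hK))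
    fun _ _ _ => sq_nonneg _).trans (h1.trans ?_)
  gcongr
  exact hD _

lemma solution_unique {σ : ℝ} (hσ : 1 ≤ σ) {M ε T : ℝ} (hM : 0 ≤ M) (hε : |ε| ≤ 1)
    {a b : ℝ → ℤ → ℂ} (ha : ∀ t ∈ Set.Icc 0 T, Bd M (a t)) (hb : ∀ t ∈ Set.Icc 0 T, Bd M (b t))
    (sa : SolOn σ ε T a Set.univ) (sb : SolOn σ ε T b Set.univ) (h0 : a 0 = b 0) :
    ∀ t ∈ Set.Icc 0 T, a t = b t := by
  obtain ⟨C, -, h⟩ := exists_stability_full hσ M hM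
  intro t ht
  ext k
  have := h ε T 0 a b hε ha hb sa sb (fun F => by simp [h0]) t ht {k}
  simp only [Finset.sum_singleton, mul_zero] at this
  have h2 : ‖a t k - b t k‖ = 0 := by nlinarith [norm_nonneg (a t k - b t k), sq_nonneg ‖a t k - b t k‖]
  exact sub_eq_zero.1 (norm_eq_zero.1 h2)

/-- Componentwise clamping of a complex number. -/
def cl (M : ℝ) (z : ℂ) : ℂ := ⟨max (-M) (min M z.re), max (-M) (min M z.im)⟩

lemma cl_eq {M : ℝ} {z : ℂ} (h : ‖z‖ ≤ M) : cl M z = z := by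
  have h1 := abs_le.1 ((Complex.abs_re_le_norm z).trans h)
  have h2 := abs_le.1 ((Complex.abs_im_le_norm z).trans h)
  apply Complex.ext <;> simp [cl, h1, h2]

lemma norm_cl_le {M : ℝ} (hM : 0 ≤ M) (z : ℂ) : ‖cl M z‖ ≤ 2 * M := by
  refine (Complex.norm_le_abs_re_add_abs_im _).trans ?_
  have : ∀ x : ℝ, |max (-M) (min M x)| ≤ M := fun x => abs_le.2
    ⟨le_max_left _ _, max_le (by linarith) (min_le_left _ _)⟩
  simp only [cl]
  linarith [this z.re, this z.im]

lemma norm_cl_sub_le (M : ℝ) (z w : ℂ) : ‖cl M z - cl M w‖ ≤ 2 * ‖z - w‖ := by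
  have : ∀ x y : ℝ, |max (-M) (min M x) - max (-M) (min M y)| ≤ |x - y| := fun x y => by
    refine (abs_max_sub_max_le_max _ _ _ _).trans ?_
    rw [sub_self, abs_zero, max_eq_right (abs_nonneg _)]
    refine (abs_min_sub_min_le_max _ _ _ _).trans ?_
    rw [sub_self, abs_zero, max_eq_right (abs_nonneg _)]
  refine (Complex.norm_le_abs_re_add_abs_im _).trans ?_
  have h1 := this z.re w.re
  have h2 := this z.im w.im
  have h3 := Complex.abs_re_le_norm (z - w)
  have h4 := Complex.abs_im_le_norm (z - w)
  simp only [cl, Complex.sub_re, Complex.sub_im] at *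
  linarith

/-- Extension by zero of finitely many coefficients. -/
def ext0 {S : Finset ℤ} (z : S → ℂ) (k : ℤ) : ℂ := if h : k ∈ S then z ⟨k, h⟩ else 0

lemma ext0_apply {S : Finset ℤ} (z : S → ℂ) (k : S) : ext0 z k = z k := by simp [ext0]

lemma norm_ext0_le {S : Finset ℤ} {z : S → ℂ} {r : ℝ} (h : ∀ k, ‖z k‖ ≤ r) (k : ℤ) :
    ‖ext0 z k‖ ≤ if k ∈ S then r else 0 := by
  unfold ext0; split_ifs with hk
  · exact h _
  · simp

lemma sum_weight_ext0_le {S : Finset ℤ} {z : S → ℂ} {r : ℝ} (h : ∀ k, ‖z k‖ ≤ r)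
    {g : ℤ → ℝ} (hg : ∀ k, 0 ≤ g k) (F : Finset ℤ) :
    ∑ k ∈ F, g k * ‖ext0 z k‖ ^ 2 ≤ (Real.sqrt (∑ k ∈ S, g k) * r) ^ 2 := by
  rw [mul_pow, Real.sq_sqrt (Finset.sum_nonneg fun k _ => hg k), Finset.sum_mul,
    ← Finset.sum_inter_add_sum_sdiff F S]
  have h1 : ∑ k ∈ F \ S, g k * ‖ext0 z k‖ ^ 2 = 0 := by
    refine Finset.sum_eq_zero fun k hk => ?_
    simp [ext0, (Finset.mem_sdiff.1 hk).2]
  rw [h1, add_zero]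
  refine (Finset.sum_le_sum_of_subset_of_nonneg Finset.inter_subset_right
    fun k _ _ => mul_nonneg (hg k) (sq_nonneg _)).trans (Finset.sum_le_sum fun k hk => ?_)
  have := norm_ext0_le h k
  rw [if_pos hk] at this
  have := hg k
  gcongr

/-- The clamped Galerkin vector field. -/
def gal (σ ε M : ℝ) (S : Finset ℤ) (z : S → ℂ) : S → ℂ := fun k =>
  ε * (-(Complex.I) * ((k:ℤ):ℂ) ^ 2 * cl M (z k) - Nc σ (ext0 fun j => cl M (z j)) k)

lemma exists_gal_bound {σ : ℝ} (hσ : 1 ≤ σ) {ε M : ℝ} (hε : |ε| ≤ 1) (hM : 0 ≤ M) (S : Finset ℤ) :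
    ∃ L K : NNReal, (∀ z, ‖gal σ ε M S z‖ ≤ L) ∧ LipschitzWith K (gal σ ε M S) := by
  set M' := Real.sqrt (∑ k ∈ S, (1 + (k:ℝ) ^ 4)) * (2 * M) with hM'
  have hM'0 : 0 ≤ M' := by positivity
  set Q := Real.sqrt (∑ k ∈ S, (1 + (k:ℝ) ^ 2)) with hQ
  have hQ0 : 0 ≤ Q := Real.sqrt_nonneg _
  obtain ⟨L, hL, hN⟩ := exists_Nc_bound hσ (2 * M') (by positivity)
  obtain ⟨C, hC, hNs⟩ := exists_Nc_sub_bound hσ M' hM'0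
  have hbd : ∀ z : S → ℂ, Bd M' (ext0 fun j => cl M (z j)) := fun z F =>
    sum_weight_ext0_le (g := fun k => 1 + (k:ℝ) ^ 4) (fun k => norm_cl_le hM _)
      (fun k => by positivity) F
  set P := ∑ k ∈ S, (k:ℝ) ^ 2 with hP
  have hP0 : 0 ≤ P := Finset.sum_nonneg fun _ _ => sq_nonneg _
  have hPk : ∀ k : S, ((k:ℤ):ℝ) ^ 2 ≤ P := fun k =>
    Finset.single_le_sum (f := fun k : ℤ => (k:ℝ) ^ 2) (fun _ _ => sq_nonneg _) k.2
  have hmul : ∀ w : ℂ, ‖(ε:ℂ) * w‖ ≤ ‖w‖ := fun w => by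
    rw [norm_mul, Complex.norm_real]
    exact mul_le_of_le_one_left (norm_nonneg _) hε
  have hIk : ∀ (k : S) (w : ℂ), ‖-(Complex.I) * ((k:ℤ):ℂ) ^ 2 * w‖ ≤ P * ‖w‖ := fun k w => by
    have : ‖-(Complex.I) * ((k:ℤ):ℂ) ^ 2 * w‖ = ((k:ℤ):ℝ) ^ 2 * ‖w‖ := by simp
    rw [this]
    have := hPk k
    gcongr
  have hLn : 0 ≤ P * (2 * M) + L := add_nonneg (mul_nonneg hP0 (by positivity)) hL
  have hKn : 0 ≤ P * 2 + C * (Q * 2) :=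
    add_nonneg (mul_nonneg hP0 (by norm_num)) (mul_nonneg hC (mul_nonneg hQ0 (by norm_num)))
  refine ⟨⟨_, hLn⟩, ⟨_, hKn⟩, fun z => ?_, ?_⟩
  · refine (pi_norm_le_iff_of_nonneg hLn).2 fun k => ?_
    refine (hmul _).trans ((norm_sub_le _ _).trans (add_le_add ((hIk k _).trans ?_) ?_))
    · have := norm_cl_le hM (z k); gcongr
    · have := hN M' _ hM'0 (hbd z) (hbd z).toBh {(k:ℤ)}
      rw [Finset.sum_singleton] at this
      exact abs_le_of_sq_le_sq' this hL |>.2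
  · refine LipschitzWith.of_dist_le_mul fun z y => ?_
    rw [dist_eq_norm, dist_eq_norm]
    refine (pi_norm_le_iff_of_nonneg (mul_nonneg hKn (norm_nonneg _))).2 fun k => ?_
    have e1 : (gal σ ε M S z - gal σ ε M S y) k = ε * (-(Complex.I) * ((k:ℤ):ℂ) ^ 2 *
        (cl M (z k) - cl M (y k)) - (Nc σ (ext0 fun j => cl M (z j)) k -
          Nc σ (ext0 fun j => cl M (y j)) k)) := by
      simp only [gal, Pi.sub_apply]; ring
    have hk : ∀ k, ‖z k - y k‖ ≤ ‖z - y‖ := fun k => norm_le_pi_norm (z - y) k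
    rw [e1]
    refine (hmul _).trans ((norm_sub_le _ _).trans ?_)
    have h1 : Bh (Q * (2 * ‖z - y‖)) (fun k => (ext0 fun j => cl M (z j)) k -
        (ext0 fun j => cl M (y j)) k) := by
      have e2 : (fun k => (ext0 fun j => cl M (z j)) k - (ext0 fun j => cl M (y j)) k) =
          ext0 fun j => cl M (z j) - cl M (y j) := by
        ext k; simp only [ext0]; split_ifs <;> simp
      rw [e2]
      exact fun F => sum_weight_ext0_le (r := 2 * ‖z - y‖) (g := fun k => 1 + (k:ℝ) ^ 2)
        (fun k => (norm_cl_sub_le M (z k) (y k)).trans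
          (mul_le_mul_of_nonneg_left (hk k) (by norm_num))) (fun k => by positivity) F
    have h2 := hNs _ _ _ (hbd z) (hbd y) h1 {(k:ℤ)}
    rw [Finset.sum_singleton] at h2
    have h3 := abs_le_of_sq_le_sq' h2 (by positivity) |>.2
    have h4 : P * ‖cl M (z k) - cl M (y k)‖ ≤ P * (2 * ‖z - y‖) := by
      have := (norm_cl_sub_le M (z k) (y k)).trans
        (mul_le_mul_of_nonneg_left (hk k) (by norm_num))
      gcongr
    have h5 := hIk k (cl M (z k) - cl M (y k))
    calc _ ≤ P * (2 * ‖z - y‖) + C * (Q * (2 * ‖z - y‖)) := add_le_add (h5.trans h4) h3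
      _ = (P * 2 + C * (Q * 2)) * ‖z - y‖ := by ring

/-- Solutions of the clamped Galerkin system. -/
lemma exists_galerkin {σ : ℝ} (hσ : 1 ≤ σ) {ε M T : ℝ} (hε : |ε| ≤ 1) (hM : 0 ≤ M) (hT : 0 ≤ T)
    (S : Finset ℤ) (a₀ : ℤ → ℂ) : ∃ a : ℝ → ℤ → ℂ, a 0 = tr S a₀ ∧
      (∀ t, ∀ k ∉ S, a t k = 0) ∧ (∀ k, ContinuousOn (fun t => a t k) (Set.Icc 0 T)) ∧
      ∀ t ∈ Set.Icc 0 T, (∀ k, ‖a t k‖ ≤ M) → ∀ k ∈ S, HasDerivWithinAt (fun s => a s k)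
        (ε * (-(Complex.I) * (k:ℂ) ^ 2 * a t k - Nc σ (a t) k)) (Set.Icc 0 T) t := by
  obtain ⟨L, K, hL, hK⟩ := exists_gal_bound hσ hε hM S
  have hpl : IsPicardLindelof (fun _ : ℝ => gal σ ε M S) (tmin := 0) (tmax := T)
      ⟨0, le_rfl, hT⟩ (fun k : S => a₀ k) (L * ⟨T, hT⟩) 0 L K :=
    IsPicardLindelof.of_time_independent (fun x _ => hL x) (hK.lipschitzOnWith)
      (by simp [hT]; exact le_rfl)
  obtain ⟨z, hz0, hz⟩ := hpl.exists_eq_forall_mem_Icc_hasDerivWithinAt₀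
  have hzk : ∀ t ∈ Set.Icc 0 T, ∀ k, HasDerivWithinAt (fun s => z s k)
      (gal σ ε M S (z t) k) (Set.Icc 0 T) t := fun t ht k => hasDerivWithinAt_pi.1 (hz t ht) k
  refine ⟨fun t => ext0 (z t), ?_, fun t k hk => by simp [ext0, hk], fun k => ?_,
    fun t ht hb k hk => ?_⟩
  · ext k
    simp only [hz0, ext0, tr]; split_ifs <;> rfl
  · by_cases hk : k ∈ S
    · simp only [ext0, hk, dif_pos]
      exact fun t ht => (hzk t ht ⟨k, hk⟩).continuousWithinAt
    · simp only [ext0, hk, dif_neg, not_false_eq_true]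
      exact continuousOn_const
  · have h1 := hzk t ht ⟨k, hk⟩
    have h2 : ∀ j : S, cl M (z t j) = z t j := fun j => cl_eq (by
      have : ‖ext0 (z t) j‖ ≤ M := hb j
      rwa [ext0_apply] at this)
    simp only [gal, h2] at h1
    have h3 : ext0 (z t) k = z t ⟨k, hk⟩ := by simp [ext0, hk]
    change HasDerivWithinAt (fun s => ext0 (z s) k)
      (ε * (-(Complex.I) * (k:ℂ) ^ 2 * ext0 (z t) k - Nc σ (ext0 (z t)) k)) (Set.Icc 0 T) t
    rw [h3]
    refine h1.congr (fun s _ => ?_) ?_ <;> simp [ext0, hk]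

/-- Right-hand side of the equation on the Fourier side. -/
def Wc (σ : ℝ) (a : ℤ → ℂ) (k : ℤ) : ℂ := -(Complex.I) * (k:ℂ) ^ 2 * a k - Nc σ a k

lemma SolOn.mono {σ ε T T' : ℝ} {a : ℝ → ℤ → ℂ} {S : Set ℤ} (h : SolOn σ ε T a S) (hT : T' ≤ T) :
    SolOn σ ε T' a S := fun k hk t ht =>
  (h k hk t ⟨ht.1, ht.2.trans hT⟩).mono (Set.Icc_subset_Icc_right hT)

lemma SolOn.shift {σ ε T T' h : ℝ} {a : ℝ → ℤ → ℂ} {S : Set ℤ} (hs : SolOn σ ε T a S)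
    (h0 : 0 ≤ h) (hT : T' + h ≤ T) : SolOn σ ε T' (fun s => a (s + h)) S := fun k hk t ht => by
  have h1 := hs k hk (t + h) ⟨add_nonneg ht.1 h0, (add_le_add_left ht.2 h).trans hT⟩
  have hm : Set.MapsTo (fun s => s + h) (Set.Icc 0 T') (Set.Icc 0 T) := fun s hs =>
    ⟨add_nonneg hs.1 h0, (add_le_add_left hs.2 h).trans hT⟩
  have := HasDerivWithinAt.scomp t h1 ((hasDerivAt_id t).add_const h).hasDerivWithinAt hm
  rw [one_smul] at this
  exact this

lemma slope_eq_norm (f : ℝ → ℂ) (t s : ℝ) :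
    ‖slope f t s‖ ^ 2 = ((s - t) ^ 2)⁻¹ * ‖f t - f s‖ ^ 2 := by
  rw [slope_def_module, norm_smul, mul_pow, norm_inv, Real.norm_eq_abs, inv_pow, sq_abs,
    norm_sub_rev]

/-- The time derivative of a finite-dimensional approximation grows at most exponentially in `L²`. -/
lemma exists_deriv_bound {σ : ℝ} (hσ : 1 ≤ σ) (M : ℝ) (hM : 0 ≤ M) : ∃ C : ℝ, 0 ≤ C ∧
    ∀ (ε T : ℝ) (S : Finset ℤ) (a : ℝ → ℤ → ℂ), |ε| = 1 →
      (∀ t ∈ Set.Icc 0 T, Bd M (a t)) → SolOn σ ε T a S → (∀ t, ∀ k ∉ S, a t k = 0) →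
      ∀ t ∈ Set.Icc 0 T, ∑ k ∈ S, ‖Wc σ (a t) k‖ ^ 2 ≤
        Real.exp (2 * C * t) * ∑ k ∈ S, ‖Wc σ (a 0) k‖ ^ 2 := by
  obtain ⟨C, L, hC, hL, hst⟩ := exists_stability hσ M hM
  refine ⟨C, hC, fun ε T S a hε hb hs h0 t ht => ?_⟩
  rcases ht.1.eq_or_lt with rfl | htpos
  · simp
  have hεn : ∀ w : ℂ, ‖(ε:ℂ) * w‖ = ‖w‖ := fun w => by
    rw [norm_mul, Complex.norm_real, Real.norm_eq_abs, hε, one_mul]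
  have key : ∀ h ∈ Set.Ioo 0 t, ∑ k ∈ S, ‖slope (fun s => a s k) t (t - h)‖ ^ 2 ≤
      Real.exp (2 * C * (t - h)) * ∑ k ∈ S, ‖slope (fun s => a s k) 0 h‖ ^ 2 := by
    intro h hh
    have h1 := hst ε (t - h) 0 S (fun s => a (s + h)) a hε.le le_rfl
      (fun s hs => hb _ ⟨add_nonneg hs.1 hh.1.le, by linarith [hs.2, ht.2]⟩)
      (fun s hs => hb _ ⟨hs.1, by linarith [hs.2, ht.2, hh.1]⟩)
      (hs.shift hh.1.le (by linarith [ht.2])) (hs.mono (by linarith [ht.2, hh.1]))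
      (fun s _ F hF => by
        rw [Finset.sum_eq_zero]
        · norm_num
        intro k hk
        have hk' := Finset.disjoint_left.1 hF hk
        simp [h0 _ k hk'])
      (t - h) ⟨by linarith [hh.2], le_rfl⟩
    simp only [slope_eq_norm, ← Finset.mul_sum]
    simp only [sub_add_cancel, zero_add] at h1
    have e1 : (t - h - t) ^ 2 = h ^ 2 := by ring
    rw [e1, sub_zero]
    have e2 : ∑ k ∈ S, ‖a 0 k - a h k‖ ^ 2 = ∑ k ∈ S, ‖a h k - a 0 k‖ ^ 2 :=
      Finset.sum_congr rfl fun k _ => by rw [norm_sub_rev]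
    rw [e2]
    have h2 := mul_le_mul_of_nonneg_left h1 (show 0 ≤ (h ^ 2)⁻¹ by positivity)
    refine h2.trans (le_of_eq (by ring))
  have l1 : Tendsto (fun h : ℝ => t - h) (nhdsWithin 0 (Set.Ioo 0 t))
      (nhdsWithin t (Set.Icc 0 T \ {t})) := by
    refine tendsto_nhdsWithin_iff.2 ⟨?_, ?_⟩
    · have : Tendsto (fun h : ℝ => t - h) (nhds 0) (nhds (t - 0)) :=
        (continuous_const.sub continuous_id).tendsto 0
      rw [sub_zero] at this
      exact this.mono_left nhdsWithin_le_nhds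
    · filter_upwards [self_mem_nhdsWithin] with h hh
      exact ⟨⟨by linarith [hh.2], by linarith [hh.1, ht.2]⟩, by
        simp only [Set.mem_singleton_iff]; linarith [hh.1]⟩
  have l2 : Tendsto (fun h : ℝ => h) (nhdsWithin 0 (Set.Ioo 0 t))
      (nhdsWithin 0 (Set.Icc 0 T \ {0})) :=
    tendsto_id.mono_right (nhdsWithin_mono _ fun h hh =>
      ⟨⟨hh.1.le, hh.2.le.trans ht.2⟩, hh.1.ne'⟩)
  have : (nhdsWithin (0:ℝ) (Set.Ioo 0 t)).NeBot := by
    rw [nhdsWithin_Ioo_eq_nhdsGT htpos]; infer_instance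
  have lim1 : Tendsto (fun h => ∑ k ∈ S, ‖slope (fun s => a s k) t (t - h)‖ ^ 2)
      (nhdsWithin 0 (Set.Ioo 0 t)) (nhds (∑ k ∈ S, ‖Wc σ (a t) k‖ ^ 2)) := by
    refine tendsto_finsetSum _ fun k hk => ?_
    rw [← hεn]
    exact (((hasDerivWithinAt_iff_tendsto_slope.1 (hs k hk t ht)).comp l1).norm).pow 2
  have lim2 : Tendsto (fun h => ∑ k ∈ S, ‖slope (fun s => a s k) 0 h‖ ^ 2)
      (nhdsWithin 0 (Set.Ioo 0 t)) (nhds (∑ k ∈ S, ‖Wc σ (a 0) k‖ ^ 2)) := by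
    refine tendsto_finsetSum _ fun k hk => ?_
    rw [← hεn]
    exact (((hasDerivWithinAt_iff_tendsto_slope.1
      (hs k hk 0 ⟨le_rfl, ht.1.trans ht.2⟩)).comp l2).norm).pow 2
  have lim3 : Tendsto (fun h => Real.exp (2 * C * (t - h))) (nhdsWithin 0 (Set.Ioo 0 t))
      (nhds (Real.exp (2 * C * t))) := by
    have : Continuous fun h => Real.exp (2 * C * (t - h)) := by fun_prop
    have := this.tendsto 0
    rw [sub_zero] at this
    exact this.mono_left nhdsWithin_le_nhds
  exact le_of_tendsto_of_tendsto lim1 (lim3.mul lim2)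
    (by filter_upwards [self_mem_nhdsWithin] with h hh using key h hh)

/-- Continuity argument. -/
lemma forall_le_of_bootstrap {y : ℝ → ℝ} {T c : ℝ} (hy : ContinuousOn y (Set.Icc 0 T))
    (h0 : y 0 ≤ c) (h : ∀ t ∈ Set.Icc 0 T, (∀ s ∈ Set.Icc 0 t, y s ≤ c) → y t < c) :
    ∀ t ∈ Set.Icc 0 T, y t ≤ c := by
  by_contra! hc
  obtain ⟨t, ht, hlt⟩ := hc
  have hsub : Set.Icc 0 t ⊆ Set.Icc 0 T := Set.Icc_subset_Icc_right ht.2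
  have hcomp : IsCompact (Set.Icc 0 t ∩ y ⁻¹' {c}) :=
    isCompact_Icc.of_isClosed_subset
      ((hy.mono hsub).preimage_isClosed_of_isClosed isClosed_Icc isClosed_singleton)
      Set.inter_subset_left
  have hne : (Set.Icc 0 t ∩ y ⁻¹' {c}).Nonempty := by
    obtain ⟨s, hs, hs'⟩ := intermediate_value_Icc ht.1 (hy.mono hsub) ⟨h0, hlt.le⟩
    exact ⟨s, hs, hs'⟩
  obtain ⟨s, ⟨hs, hsc⟩, hmin⟩ := hcomp.exists_isLeast hne
  refine (h s (hsub hs) fun r hr => ?_).ne hsc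
  by_contra! hr'
  obtain ⟨q, hq, hq'⟩ := intermediate_value_Icc hr.1
    (hy.mono fun x hx => hsub ⟨hx.1, hx.2.trans (hr.2.trans hs.2)⟩) ⟨h0, hr'.le⟩
  have h1 : s ≤ q := hmin ⟨⟨hq.1, hq.2.trans (hr.2.trans hs.2)⟩, hq'⟩
  have h2 : s = r := le_antisymm (h1.trans hq.2) hr.2
  rw [← h2] at hr'
  exact hr'.ne' hsc

lemma sum_norm_add_sq_le {F : Finset ℤ} {m n : ℤ → ℂ} {X Y : ℝ} (hX : 0 ≤ X) (hY : 0 ≤ Y)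
    (hm : ∑ k ∈ F, ‖m k‖ ^ 2 ≤ X ^ 2) (hn : ∑ k ∈ F, ‖n k‖ ^ 2 ≤ Y ^ 2) :
    ∑ k ∈ F, ‖m k + n k‖ ^ 2 ≤ (X + Y) ^ 2 := by
  have h := (abs_le.1 (abs_sum_re_le hX hY hm hn)).2
  have e : ∀ k, ‖m k + n k‖ ^ 2 = ‖m k‖ ^ 2 + 2 * (starRingEnd ℂ (m k) * n k).re + ‖n k‖ ^ 2 := by
    intro k
    rw [← Complex.normSq_eq_norm_sq, ← Complex.normSq_eq_norm_sq, ← Complex.normSq_eq_norm_sq,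
      Complex.normSq_add, ← Complex.conj_re (m k * _)]
    simp only [map_mul, Complex.conj_conj]; ring
  simp only [e, Finset.sum_add_distrib, ← Finset.mul_sum]
  nlinarith

lemma norm_Wc_add_sq_le (σ : ℝ) (a : ℤ → ℂ) (k : ℤ) :
    (k:ℝ) ^ 4 * ‖a k‖ ^ 2 ≤ 2 * ‖Wc σ a k‖ ^ 2 + 2 * ‖Nc σ a k‖ ^ 2 := by
  have e : Wc σ a k + Nc σ a k = -(Complex.I) * (k:ℂ) ^ 2 * a k := by simp [Wc]
  have h1 : ‖Wc σ a k + Nc σ a k‖ = (k:ℝ) ^ 2 * ‖a k‖ := by rw [e]; simp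
  have h2 := norm_add_le (Wc σ a k) (Nc σ a k)
  rw [h1] at h2
  have h3 : 0 ≤ (k:ℝ) ^ 2 * ‖a k‖ := by positivity
  have h4 := mul_self_le_mul_self h3 h2
  nlinarith [sq_nonneg (‖Wc σ a k‖ - ‖Nc σ a k‖)]

lemma norm_Wc_sq_le (σ : ℝ) (a : ℤ → ℂ) (k : ℤ) :
    ‖Wc σ a k‖ ^ 2 ≤ 2 * ((k:ℝ) ^ 4 * ‖a k‖ ^ 2) + 2 * ‖Nc σ a k‖ ^ 2 := by
  have h2 := norm_sub_le (-(Complex.I) * (k:ℂ) ^ 2 * a k) (Nc σ a k)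
  have h1 : ‖-(Complex.I) * (k:ℂ) ^ 2 * a k‖ = (k:ℝ) ^ 2 * ‖a k‖ := by simp
  rw [h1] at h2
  have h3 := mul_self_le_mul_self (norm_nonneg _) h2
  change ‖Wc σ a k‖ * ‖Wc σ a k‖ ≤ _ at h3
  nlinarith [sq_nonneg ((k:ℝ) ^ 2 * ‖a k‖ - ‖Nc σ a k‖)]

lemma Bd.sum_norm_sq_le {M : ℝ} {a : ℤ → ℂ} (h : Bd M a) (F : Finset ℤ) :
    ∑ k ∈ F, ‖a k‖ ^ 2 ≤ M ^ 2 :=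
  (Finset.sum_le_sum fun k _ => le_mul_of_one_le_left (sq_nonneg _)
    (by have : (0:ℝ) ≤ (k:ℝ) ^ 4 := by positivity
        linarith)).trans (h F)

lemma Bd.sum_pow_four_le {M : ℝ} {a : ℤ → ℂ} (h : Bd M a) (F : Finset ℤ) :
    ∑ k ∈ F, (k:ℝ) ^ 4 * ‖a k‖ ^ 2 ≤ M ^ 2 :=
  (Finset.sum_le_sum fun k _ => mul_le_mul_of_nonneg_right (by linarith) (sq_nonneg _)).trans (h F)

lemma Bd.norm_le {M : ℝ} {a : ℤ → ℂ} (hM : 0 ≤ M) (h : Bd M a) (k : ℤ) : ‖a k‖ ≤ M := by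
  have := h.sum_norm_sq_le {k}
  rw [Finset.sum_singleton] at this
  exact (abs_le_of_sq_le_sq' this hM).2

/-- `L²` distance to the initial datum in terms of the time derivative. -/
lemma SolOn.sum_sub_le {σ ε T A : ℝ} {S : Finset ℤ} {a : ℝ → ℤ → ℂ} (hε : |ε| ≤ 1)
    (h : SolOn σ ε T a S) (hA : ∀ t ∈ Set.Icc 0 T, ∑ k ∈ S, ‖Wc σ (a t) k‖ ^ 2 ≤ A) :
    ∀ t ∈ Set.Icc 0 T, ∑ k ∈ S, ‖a t k - a 0 k‖ ^ 2 ≤ Real.exp t * (A * t) := by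
  intro t ht
  have hA0 : 0 ≤ A := (Finset.sum_nonneg fun _ _ => sq_nonneg _).trans (hA t ht)
  have hd : ∀ t ∈ Set.Icc 0 T, HasDerivWithinAt (fun s => ∑ k ∈ S, ‖a s k - a 0 k‖ ^ 2)
      (∑ k ∈ S, 2 * inner ℝ (a t k - a 0 k) (ε * Wc σ (a t) k)) (Set.Icc 0 T) t := fun t ht =>
    HasDerivWithinAt.fun_sum fun k hk => ((h k hk t ht).sub_const (a 0 k)).norm_sq
  have := le_exp_mul_of_deriv_le (K := 1) zero_le_one hA0 hd (fun t ht => ?_) t ht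
  · simpa using this
  · rw [one_mul]
    refine le_trans ?_ (add_le_add_right (hA t ht) _)
    rw [← Finset.sum_add_distrib]
    refine Finset.sum_le_sum fun k _ => ?_
    have h1 := real_inner_le_norm (a t k - a 0 k) (ε * Wc σ (a t) k)
    have h2 : ‖(ε:ℂ) * Wc σ (a t) k‖ ≤ ‖Wc σ (a t) k‖ := by
      rw [norm_mul, Complex.norm_real]
      exact mul_le_of_le_one_left (norm_nonneg _) hε
    have h3 := mul_le_mul_of_nonneg_left h2 (norm_nonneg (a t k - a 0 k))
    nlinarith [sq_nonneg (‖a t k - a 0 k‖ - ‖Wc σ (a t) k‖)]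

lemma sum_le_of_support {S : Finset ℤ} {f : ℤ → ℝ} (hf : ∀ k, 0 ≤ f k) (h0 : ∀ k ∉ S, f k = 0)
    (F : Finset ℤ) : ∑ k ∈ F, f k ≤ ∑ k ∈ S, f k :=
  calc _ ≤ ∑ k ∈ F ∪ S, f k :=
        Finset.sum_le_sum_of_subset_of_nonneg Finset.subset_union_left fun k _ _ => hf k
    _ = _ := (Finset.sum_subset Finset.subset_union_right fun k _ hk => h0 k hk).symm

lemma one_add_sq_le_interp {η : ℝ} (hη : 0 < η) (k : ℝ) :
    1 + k ^ 2 ≤ η * (1 + k ^ 4) + (1 + 1 / (4 * η)) := by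
  have h1 : η * (1 + k ^ 4) + (1 + 1 / (4 * η)) - (1 + k ^ 2) =
      η + η * (k ^ 2 - 1 / (2 * η)) ^ 2 := by
    field_simp; ring
  nlinarith [mul_nonneg hη.le (sq_nonneg (k ^ 2 - 1 / (2 * η)))]

set_option maxHeartbeats 1000000 in
/-- `H²` a priori bound for Galerkin solutions, uniform in the dimension. -/
lemma exists_apriori {σ : ℝ} (hσ : 1 ≤ σ) (R : ℝ) (hR : 0 ≤ R) : ∃ T M : ℝ, 0 < T ∧ 0 ≤ M ∧
    ∀ (ε : ℝ) (S : Finset ℤ) (a : ℝ → ℤ → ℂ), |ε| = 1 → Bd R (a 0) → (∀ t, ∀ k ∉ S, a t k = 0) →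
      (∀ k, ContinuousOn (fun t => a t k) (Set.Icc 0 T)) →
      (∀ t ∈ Set.Icc 0 T, (∀ k, ‖a t k‖ ≤ M) → ∀ k ∈ S, HasDerivWithinAt (fun s => a s k)
        (ε * (-(Complex.I) * (k:ℂ) ^ 2 * a t k - Nc σ (a t) k)) (Set.Icc 0 T) t) →
      ∀ t ∈ Set.Icc 0 T, Bd M (a t) := by
  set B := 2 * R + 2 with hB
  obtain ⟨L, hL, hN⟩ := exists_Nc_bound hσ B (by positivity)
  set M := 3 * R + 4 * L + B + 1 with hM
  have hM0 : 0 ≤ M := by positivity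
  have hRM : R ≤ M := by linarith
  obtain ⟨C, hC, hW⟩ := exists_deriv_bound hσ M hM0
  set A := 2 * (2 * R ^ 2 + 2 * L ^ 2) with hA
  set η := 1 / (4 * (M ^ 2 + R ^ 2) + 1) with hη
  have hη0 : 0 < η := by positivity
  have hηM : η * (2 * M ^ 2 + 2 * R ^ 2) ≤ 1 / 2 := by
    rw [hη, div_mul_eq_mul_div, div_le_iff₀ (by positivity)]; linarith
  set q := 1 + 1 / (4 * η) with hq
  have hq0 : 0 ≤ q := by positivity
  have hA0 : 0 ≤ A := by positivity
  set T := 1 / (1 + 4 * C + 6 * A * q) with hT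
  have hAq : 0 ≤ A * q := mul_nonneg hA0 hq0
  have hden : 0 < 1 + 4 * C + 6 * A * q := by linarith
  have hT0 : 0 < T := by positivity
  have hTd : T * (1 + 4 * C + 6 * A * q) = 1 := by rw [hT]; field_simp
  have hT1 : T ≤ 1 := by nlinarith [mul_nonneg hT0.le hC, mul_nonneg hT0.le hAq]
  have hTC : 2 * C * T ≤ 1 / 2 := by nlinarith [mul_nonneg hT0.le hC, mul_nonneg hT0.le hAq]
  have hTA : q * (3 * (A * T)) ≤ 1 / 2 := by
    nlinarith [mul_nonneg hT0.le hC, mul_nonneg hT0.le hAq]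
  clear_value T q η
  refine ⟨T, M, hT0, hM0, fun ε S a hε ha0 h0 hcont hder => ?_⟩
  set y : ℝ → ℝ := fun t => ∑ k ∈ S, (1 + (k:ℝ) ^ 4) * ‖a t k‖ ^ 2 with hy
  have hyBd : ∀ t, y t ≤ M ^ 2 → Bd M (a t) := fun t ht F =>
    (sum_le_of_support (fun k => by positivity) (fun k hk => by simp [h0 t k hk]) F).trans ht
  suffices hmain : ∀ t ∈ Set.Icc 0 T, y t ≤ M ^ 2 from fun t ht => hyBd t (hmain t ht)
  have hycont : ContinuousOn y (Set.Icc 0 T) :=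
    continuousOn_finsetSum _ fun k _ => ((hcont k).norm.pow 2).const_mul _
  refine forall_le_of_bootstrap hycont ((ha0 S).trans (by gcongr)) fun t ht hle => ?_
  have hBd : ∀ s ∈ Set.Icc 0 t, Bd M (a s) := fun s hs => hyBd s (hle s hs)
  have hsol : SolOn σ ε t a S := fun k hk s hs =>
    (hder s ⟨hs.1, hs.2.trans ht.2⟩ ((hBd s hs).norm_le hM0) k hk).mono
      (Set.Icc_subset_Icc_right ht.2)
  have hBh0 : Bh B (a 0) := ha0.toBh.mono (by positivity) (by linarith)
  have hW0 : ∑ k ∈ S, ‖Wc σ (a 0) k‖ ^ 2 ≤ 2 * R ^ 2 + 2 * L ^ 2 := by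
    calc _ ≤ ∑ k ∈ S, (2 * ((k:ℝ) ^ 4 * ‖a 0 k‖ ^ 2) + 2 * ‖Nc σ (a 0) k‖ ^ 2) :=
          Finset.sum_le_sum fun k _ => norm_Wc_sq_le σ _ k
      _ ≤ _ := by
          rw [Finset.sum_add_distrib, ← Finset.mul_sum, ← Finset.mul_sum]
          linarith [ha0.sum_pow_four_le S, hN R _ hR ha0 hBh0 S]
  have hWs : ∀ s ∈ Set.Icc 0 t, ∑ k ∈ S, ‖Wc σ (a s) k‖ ^ 2 ≤ A := by
    intro s hs
    refine (hW ε t S a hε hBd hsol h0 s hs).trans ?_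
    have h1 : Real.exp (2 * C * s) ≤ 2 := by
      have h2 : 2 * C * s ≤ 1 / 2 := by nlinarith [hs.2.trans ht.2, hs.1]
      have h3 := Real.exp_le_exp.2 h2
      have h4 : Real.exp (1 / 2) * Real.exp (1 / 2) = Real.exp 1 := by
        rw [← Real.exp_add]; norm_num
      nlinarith [Real.exp_one_lt_d9, Real.exp_pos (1 / 2)]
    exact mul_le_mul h1 hW0 (Finset.sum_nonneg fun _ _ => sq_nonneg _) (by norm_num)
  have htt : t ∈ Set.Icc 0 t := ⟨ht.1, le_rfl⟩
  have hd : ∑ k ∈ S, ‖a t k - a 0 k‖ ^ 2 ≤ 3 * (A * T) := by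
    refine (hsol.sum_sub_le hε.le hWs t htt).trans ?_
    have h1 : Real.exp t ≤ 3 := by
      have := Real.exp_le_exp.2 (ht.2.trans hT1)
      linarith [Real.exp_one_lt_d9]
    exact mul_le_mul h1 (by gcongr; exact ht.2) (mul_nonneg hA0 ht.1) (by norm_num)
  have hsq : ∀ z w : ℂ, ‖z‖ ^ 2 ≤ 2 * ‖w‖ ^ 2 + 2 * ‖z - w‖ ^ 2 := fun z w => by
    have h1 : ‖z‖ ≤ ‖w‖ + ‖z - w‖ := by
      have := norm_add_le w (z - w); rwa [add_sub_cancel] at this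
    nlinarith [sq_nonneg (‖w‖ - ‖z - w‖), norm_nonneg z, norm_nonneg w]
  have hsq' : ∀ z w : ℂ, ‖z - w‖ ^ 2 ≤ 2 * ‖z‖ ^ 2 + 2 * ‖w‖ ^ 2 := fun z w => by
    have h1 := norm_sub_le z w
    nlinarith [sq_nonneg (‖w‖ - ‖z‖), norm_nonneg (z - w)]
  have hdh : ∑ k ∈ S, (1 + (k:ℝ) ^ 2) * ‖a t k - a 0 k‖ ^ 2 ≤ 1 := by
    calc _ ≤ ∑ k ∈ S, (η * (2 * ((1 + (k:ℝ) ^ 4) * ‖a t k‖ ^ 2) +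
            2 * ((1 + (k:ℝ) ^ 4) * ‖a 0 k‖ ^ 2)) + q * ‖a t k - a 0 k‖ ^ 2) := by
          refine Finset.sum_le_sum fun k _ => ?_
          have h1 := mul_le_mul_of_nonneg_right (one_add_sq_le_interp hη0 k)
            (sq_nonneg ‖a t k - a 0 k‖)
          have h2 := mul_le_mul_of_nonneg_left (hsq' (a t k) (a 0 k))
            (show 0 ≤ η * (1 + (k:ℝ) ^ 4) by positivity)
          rw [← hq] at h1
          linarith
      _ = η * (2 * y t + 2 * ∑ k ∈ S, (1 + (k:ℝ) ^ 4) * ‖a 0 k‖ ^ 2) +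
            q * ∑ k ∈ S, ‖a t k - a 0 k‖ ^ 2 := by
          simp only [hy, Finset.sum_add_distrib, Finset.mul_sum, mul_add]
      _ ≤ η * (2 * M ^ 2 + 2 * R ^ 2) + q * (3 * (A * T)) := by
          have := hle t htt
          have := ha0 S
          gcongr
      _ ≤ 1 := by linarith
  have hBht : Bh B (a t) := fun F => by
    refine (sum_le_of_support (S := S) (fun k => by positivity) (fun k hk => by simp [h0 t k hk]) F).trans ?_
    calc _ ≤ ∑ k ∈ S, (2 * ((1 + (k:ℝ) ^ 2) * ‖a 0 k‖ ^ 2) +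
            2 * ((1 + (k:ℝ) ^ 2) * ‖a t k - a 0 k‖ ^ 2)) := by
          refine Finset.sum_le_sum fun k _ => ?_
          have := mul_le_mul_of_nonneg_left (hsq (a t k) (a 0 k))
            (show 0 ≤ 1 + (k:ℝ) ^ 2 by positivity)
          linarith
      _ ≤ 2 * (2 * R ^ 2) + 2 * 1 := by
          rw [Finset.sum_add_distrib, ← Finset.mul_sum, ← Finset.mul_sum]
          have h1 : ∑ k ∈ S, (1 + (k:ℝ) ^ 2) * ‖a 0 k‖ ^ 2 ≤ 2 * R ^ 2 := by
            refine le_trans ?_ (mul_le_mul_of_nonneg_left (ha0 S) zero_le_two)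
            rw [Finset.mul_sum]
            refine Finset.sum_le_sum fun k _ => ?_
            rw [← mul_assoc]
            refine mul_le_mul_of_nonneg_right ?_ (sq_nonneg _)
            nlinarith [sq_nonneg ((k:ℝ) ^ 2 - 1), sq_nonneg (k:ℝ)]
          linarith
      _ ≤ _ := by nlinarith
  have hNt := hN M _ hM0 (hBd t htt) hBht S
  have h4 : ∑ k ∈ S, (k:ℝ) ^ 4 * ‖a t k‖ ^ 2 ≤ 2 * A + 2 * L ^ 2 := by
    refine (Finset.sum_le_sum fun k _ => norm_Wc_add_sq_le σ (a t) k).trans ?_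
    rw [Finset.sum_add_distrib, ← Finset.mul_sum, ← Finset.mul_sum]
    linarith [hWs t htt]
  have h5 : ∑ k ∈ S, ‖a t k‖ ^ 2 ≤ B ^ 2 :=
    (Finset.sum_le_sum fun k _ => le_mul_of_one_le_left (sq_nonneg _)
      (by nlinarith [sq_nonneg (k:ℝ)])).trans (hBht S)
  have h6 : y t = ∑ k ∈ S, ‖a t k‖ ^ 2 + ∑ k ∈ S, (k:ℝ) ^ 4 * ‖a t k‖ ^ 2 := by
    rw [← Finset.sum_add_distrib]
    exact Finset.sum_congr rfl fun k _ => by ring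
  have hB0 : 0 ≤ B := by positivity
  have h7 : 9 * R ^ 2 + 16 * L ^ 2 + B ^ 2 + 1 ≤ M ^ 2 := by
    rw [hM]
    nlinarith [mul_nonneg hR hL, mul_nonneg hR hB0, mul_nonneg hL hB0]
  rw [h6]
  nlinarith [sq_nonneg R, sq_nonneg L]

lemma tendsto_Nc {σ : ℝ} (hσ : 1 ≤ σ) {ι : Type*} {l : Filter ι} {M : ℝ} (hM : 0 ≤ M)
    {a : ι → ℤ → ℂ} {b : ℤ → ℂ} (ha : ∀ᶠ i in l, Bd M (a i)) (hb : Bd M b)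
    (h : ∀ k, Tendsto (fun i => a i k) l (nhds (b k))) :
    ∃ η : ι → ℝ, Tendsto η l (nhds 0) ∧ ∀ᶠ i in l, 0 ≤ η i ∧ ∀ S : Finset ℤ,
      ∑ k ∈ S, ‖Nc σ (a i) k - Nc σ b k‖ ^ 2 ≤ η i ^ 2 := by
  obtain ⟨C, hC, hN⟩ := exists_Nc_sub_bound hσ M hM
  obtain ⟨η, hη, hB⟩ := Bh_tendsto ha hb h
  refine ⟨fun i => C * |η i|, by simpa using hη.abs.const_mul C, ?_⟩
  filter_upwards [hB, ha] with i hi hai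
  refine ⟨by positivity, fun S => ?_⟩
  rw [mul_pow, sq_abs, ← mul_pow]
  exact hN _ _ _ hai hb hi S

lemma tendsto_Nc_apply {σ : ℝ} (hσ : 1 ≤ σ) {ι : Type*} {l : Filter ι} {M : ℝ} (hM : 0 ≤ M)
    {a : ι → ℤ → ℂ} {b : ℤ → ℂ} (ha : ∀ᶠ i in l, Bd M (a i)) (hb : Bd M b)
    (h : ∀ k, Tendsto (fun i => a i k) l (nhds (b k))) (k : ℤ) :
    Tendsto (fun i => Nc σ (a i) k) l (nhds (Nc σ b k)) := by
  obtain ⟨η, hη, hN⟩ := tendsto_Nc hσ hM ha hb h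
  refine tendsto_iff_norm_sub_tendsto_zero.2 (squeeze_zero' (.of_forall fun _ => norm_nonneg _) ?_ hη)
  filter_upwards [hN] with i hi
  have := hi.2 {k}
  rw [Finset.sum_singleton] at this
  exact (abs_le_of_sq_le_sq' this hi.1).2

lemma continuousOn_Nc {σ : ℝ} (hσ : 1 ≤ σ) {M : ℝ} (hM : 0 ≤ M) {s : Set ℝ} {a : ℝ → ℤ → ℂ}
    (ha : ∀ t ∈ s, Bd M (a t)) (h : ∀ k, ContinuousOn (fun t => a t k) s) (k : ℤ) :
    ContinuousOn (fun t => Nc σ (a t) k) s := fun t ht =>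
  tendsto_Nc_apply hσ hM (by filter_upwards [self_mem_nhdsWithin] with i hi using ha i hi)
    (ha t ht) (fun k => h k t ht) k

lemma continuousOn_Wc {σ : ℝ} (hσ : 1 ≤ σ) {M : ℝ} (hM : 0 ≤ M) {s : Set ℝ} {a : ℝ → ℤ → ℂ}
    (ha : ∀ t ∈ s, Bd M (a t)) (h : ∀ k, ContinuousOn (fun t => a t k) s) (k : ℤ) :
    ContinuousOn (fun t => Wc σ (a t) k) s :=
  (continuousOn_const.mul (h k)).sub (continuousOn_Nc hσ hM ha h k)

lemma hasDerivWithinAt_of_integral {f g : ℝ → ℂ} {T : ℝ} (hT : 0 ≤ T)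
    (hg : ContinuousOn g (Set.Icc 0 T))
    (h : ∀ t ∈ Set.Icc 0 T, f t = f 0 + ∫ s in (0:ℝ)..t, g s) :
    ∀ t ∈ Set.Icc 0 T, HasDerivWithinAt f (g t) (Set.Icc 0 T) t := by
  intro t ht
  set G : ℝ → ℂ := Set.IccExtend hT (Set.domRestrict _ g)
  have hG : Continuous G := (continuousOn_iff_continuous_domRestrict.1 hg).Icc_extend'
  have hGg : ∀ s ∈ Set.Icc 0 T, G s = g s := fun s hs => by
    simp only [G, Set.IccExtend_of_mem hT _ hs]; rfl
  have h1 : HasDerivAt (fun t => f 0 + ∫ s in (0:ℝ)..t, G s) (G t) t :=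
    (intervalIntegral.integral_hasDerivAt_right (hG.intervalIntegrable _ _)
      hG.stronglyMeasurable.stronglyMeasurableAtFilter hG.continuousAt).const_add _
  rw [hGg t ht] at h1
  refine h1.hasDerivWithinAt.congr_of_mem (fun r hr => ?_) ht
  rw [h r hr]
  congr 1
  refine intervalIntegral.integral_congr fun s hs => (hGg s ?_).symm
  rw [Set.uIcc_of_le hr.1] at hs
  exact ⟨hs.1, hs.2.trans hr.2⟩

lemma integral_of_hasDerivWithinAt {f g : ℝ → ℂ} {T : ℝ} (hg : ContinuousOn g (Set.Icc 0 T))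
    (h : ∀ t ∈ Set.Icc 0 T, HasDerivWithinAt f (g t) (Set.Icc 0 T) t) :
    ∀ t ∈ Set.Icc 0 T, f t = f 0 + ∫ s in (0:ℝ)..t, g s := by
  intro t ht
  have hsub : Set.Icc 0 t ⊆ Set.Icc 0 T := Set.Icc_subset_Icc_right ht.2
  have := intervalIntegral.integral_eq_sub_of_hasDerivAt_of_le ht.1 (f := f) (f' := g)
    (fun s hs => ((h s (hsub hs)).mono hsub).continuousWithinAt)
    (fun s hs => (h s (hsub ⟨hs.1.le, hs.2.le⟩)).hasDerivAt
      (Icc_mem_nhds hs.1 (hs.2.trans_le ht.2)))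
    ((hg.mono hsub).intervalIntegrable_of_Icc ht.1)
  rw [this]; ring

lemma SolOn.continuousOn {σ ε T : ℝ} {a : ℝ → ℤ → ℂ} (h : SolOn σ ε T a Set.univ) (k : ℤ) :
    ContinuousOn (fun t => a t k) (Set.Icc 0 T) := fun t ht => (h k trivial t ht).continuousWithinAt

lemma tendsto_tr (a : ℤ → ℂ) (k : ℤ) : Tendsto (fun N => tr (win N) a k) atTop (nhds (a k)) := by
  refine tendsto_const_nhds.congr' ?_
  filter_upwards [eventually_ge_atTop k.natAbs] with N hN
  have : k ∈ win N := by rw [mem_win, Int.abs_eq_natAbs]; exact_mod_cast hN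
  simp [tr, this]

/-- A limit of solutions of larger and larger Galerkin systems solves the full equation. -/
lemma SolOn.of_tendsto {σ : ℝ} (hσ : 1 ≤ σ) {ε T M : ℝ} (hε : |ε| ≤ 1) (hT : 0 ≤ T) (hM : 0 ≤ M)
    {a : ℕ → ℝ → ℤ → ℂ} {b : ℝ → ℤ → ℂ} (ha : ∀ N, ∀ t ∈ Set.Icc 0 T, Bd M (a N t))
    (hb : ∀ t ∈ Set.Icc 0 T, Bd M (b t)) (hs : ∀ N, SolOn σ ε T (a N) (win N))
    (hc : ∀ N k, ContinuousOn (fun t => a N t k) (Set.Icc 0 T))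
    (hlim : ∀ t ∈ Set.Icc 0 T, ∀ k, Tendsto (fun N => a N t k) atTop (nhds (b t k))) :
    SolOn σ ε T b Set.univ := by
  obtain ⟨L, hL, hN⟩ := exists_Nc_bound hσ (2 * M) (by positivity)
  have hNb : ∀ c, Bd M c → ∀ k, ‖Nc σ c k‖ ≤ L := fun c hc k => by
    have := hN M c hM hc hc.toBh {k}
    rw [Finset.sum_singleton] at this
    exact (abs_le_of_sq_le_sq' this hL).2
  have hWb : ∀ c, Bd M c → ∀ k, ‖(ε:ℂ) * Wc σ c k‖ ≤ (k:ℝ) ^ 2 * M + L := fun c hc k => by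
    rw [norm_mul, Complex.norm_real]
    refine (mul_le_of_le_one_left (norm_nonneg _) hε).trans ((norm_sub_le _ _).trans
      (add_le_add ?_ (hNb c hc k)))
    have := hc.norm_le hM k
    simp only [norm_mul, norm_neg, Complex.norm_I, one_mul, norm_pow, Complex.norm_intCast, sq_abs]
    gcongr
  have hmem : ∀ k : ℤ, ∀ᶠ N in atTop, k ∈ win N := fun k => by
    filter_upwards [eventually_ge_atTop k.natAbs] with N hN
    rw [mem_win, Int.abs_eq_natAbs]; exact_mod_cast hN
  have hbc : ∀ k, ContinuousOn (fun t => b t k) (Set.Icc 0 T) := fun k => by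
    have hlip : LipschitzOnWith ⟨(k:ℝ) ^ 2 * M + L, by positivity⟩ (fun t => b t k)
        (Set.Icc 0 T) := by
      refine LipschitzOnWith.of_dist_le_mul fun p hp q hq => ?_
      rw [dist_eq_norm]
      refine le_of_tendsto ((hlim p hp k).sub (hlim q hq k)).norm ?_
      filter_upwards [hmem k] with N hN
      exact (convex_Icc 0 T).norm_image_sub_le_of_norm_hasDerivWithin_le
        (fun r hr => hs N k hN r hr) (fun r hr => hWb _ (ha N r hr) k) hq hp
    exact hlip.continuousOn
  have hWcN : ∀ N k, ContinuousOn (fun t => (ε:ℂ) * Wc σ (a N t) k) (Set.Icc 0 T) := fun N k =>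
    continuousOn_const.mul (continuousOn_Wc hσ hM (ha N) (hc N) k)
  intro k _
  have hWc := (continuousOn_Wc hσ hM hb hbc k)
  refine hasDerivWithinAt_of_integral hT (continuousOn_const.mul hWc) fun t ht => ?_
  have hsub : Set.Icc 0 t ⊆ Set.Icc 0 T := Set.Icc_subset_Icc_right ht.2
  have hsub' : Set.uIoc 0 t ⊆ Set.Icc 0 T := by
    rw [Set.uIoc_of_le ht.1]; exact Set.Ioc_subset_Icc_self.trans hsub
  have h_int : Tendsto (fun N => ∫ s in (0:ℝ)..t, (ε:ℂ) * Wc σ (a N s) k) atTop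
      (nhds (∫ s in (0:ℝ)..t, (ε:ℂ) * Wc σ (b s) k)) := by
    refine intervalIntegral.tendsto_integral_filter_of_dominated_convergence
      (fun _ => (k:ℝ) ^ 2 * M + L) ?_ ?_ intervalIntegrable_const ?_
    · exact .of_forall fun N => ((hWcN N k).mono hsub').aestronglyMeasurable measurableSet_uIoc
    · exact .of_forall fun N => .of_forall fun s hs => hWb _ (ha N s (hsub' hs)) k
    · refine .of_forall fun s hs => ?_
      have hs := hsub' hs
      exact (((hlim s hs k).const_mul _).sub (tendsto_Nc_apply hσ hM
        (.of_forall fun N => ha N s hs) (hb s hs) (hlim s hs) k)).const_mul _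
  refine tendsto_nhds_unique (hlim t ht k) (((hlim 0 ⟨le_rfl, hT⟩ k).add h_int).congr' ?_)
  filter_upwards [hmem k] with N hN
  exact (integral_of_hasDerivWithinAt (hWcN N k) (hs N k hN) t ht).symm

lemma exists_solution {σ : ℝ} (hσ : 1 ≤ σ) (R : ℝ) (hR : 0 ≤ R) : ∃ T M C : ℝ, 0 < T ∧ 0 ≤ M ∧
    0 ≤ C ∧ ∀ (ε : ℝ) (a₀ : ℤ → ℂ), |ε| = 1 → Bd R a₀ → ∃ a : ℝ → ℤ → ℂ, a 0 = a₀ ∧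
      (∀ t ∈ Set.Icc 0 T, Bd M (a t)) ∧ SolOn σ ε T a Set.univ ∧
      ∀ X, 0 ≤ X → (∀ F : Finset ℤ, ∑ k ∈ F, ‖Wc σ a₀ k‖ ^ 2 ≤ X ^ 2) →
        ∀ t ∈ Set.Icc 0 T, ∀ F : Finset ℤ, ∑ k ∈ F, ‖Wc σ (a t) k‖ ^ 2 ≤
          Real.exp (2 * C * t) * X ^ 2 := by
  obtain ⟨T, M, hT, hM, hap⟩ := exists_apriori hσ R hR
  obtain ⟨C, hC, hW⟩ := exists_deriv_bound hσ M hM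
  obtain ⟨C', L, hC', hL, hst⟩ := exists_stability hσ M hM
  refine ⟨T, M, C, hT, hM, hC, fun ε a₀ hε h₀ => ?_⟩
  choose a ha0 hoff hcont hder using fun N => exists_galerkin hσ hε.le hM hT.le (win N) a₀
  have hBd : ∀ N, ∀ t ∈ Set.Icc 0 T, Bd M (a N t) := fun N =>
    hap ε (win N) (a N) hε (by rw [ha0]; exact h₀.tr _) (hoff N) (hcont N) (hder N)
  have hsol : ∀ N, SolOn σ ε T (a N) (win N) := fun N k hk t ht =>
    hder N t ht (hBd N t ht |>.norm_le hM) k hk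
  set θ : ℕ → ℝ := fun K => 2 * (2 * (M + M)) / (1 + K)
  have hθ : Tendsto θ atTop (nhds 0) := tendsto_tail _
  have hg : ∀ t, Tendsto (fun K => Real.exp (2 * C' * t) *
      ((2 * C' * θ K ^ 2 + 4 * L * θ K) * t)) atTop (nhds 0) := fun t => by
    have := ((((hθ.pow 2).const_mul (2 * C')).add (hθ.const_mul (4 * L))).mul_const t).const_mul
      (Real.exp (2 * C' * t))
    simpa using this
  have hclose : ∀ t ∈ Set.Icc 0 T, ∀ K N N', K ≤ N → K ≤ N' →
      ∑ k ∈ win K, ‖a N t k - a N' t k‖ ^ 2 ≤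
        Real.exp (2 * C' * t) * ((2 * C' * θ K ^ 2 + 4 * L * θ K) * t) := by
    intro t ht K N N' hN hN'
    have := hst ε T (θ K) (win K) (a N) (a N') hε.le (by positivity) (hBd N) (hBd N')
      (fun k hk => hsol N k (win_mono hN hk)) (fun k hk => hsol N' k (win_mono hN' hk))
      (fun t ht G hG => (Bd.sub hM hM (hBd N t ht) (hBd N' t ht)).tail_le hG) t ht
    rwa [Finset.sum_eq_zero (s := win K) (f := fun k => ‖a N 0 k - a N' 0 k‖ ^ 2), zero_add] at this
    intro k hk
    simp [ha0, tr, win_mono hN hk, win_mono hN' hk]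
  have hex : ∀ t k, ∃ z, t ∈ Set.Icc 0 T → Tendsto (fun N => a N t k) atTop (nhds z) := by
    intro t k
    by_cases ht : t ∈ Set.Icc 0 T
    · have : CauchySeq fun N => a N t k := by
        rw [Metric.cauchySeq_iff']
        intro e he
        obtain ⟨K, hK⟩ := ((hg t).eventually_lt_const (show 0 < e ^ 2 by positivity)).and
          (eventually_ge_atTop k.natAbs) |>.exists
        have hk : k ∈ win K := by rw [mem_win, Int.abs_eq_natAbs]; exact_mod_cast hK.2
        refine ⟨K, fun N hN => ?_⟩
        rw [dist_eq_norm]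
        refine lt_of_pow_lt_pow_left₀ 2 he.le (lt_of_le_of_lt ?_ hK.1)
        exact (Finset.single_le_sum (f := fun k => ‖a N t k - a K t k‖ ^ 2)
          (fun _ _ => sq_nonneg _) hk).trans (hclose t ht K N K hN le_rfl)
      obtain ⟨z, hz⟩ := cauchySeq_tendsto_of_complete this
      exact ⟨z, fun _ => hz⟩
    · exact ⟨0, fun h => absurd h ht⟩
  choose b hb using hex
  have hlim : ∀ t ∈ Set.Icc 0 T, ∀ k, Tendsto (fun N => a N t k) atTop (nhds (b t k)) :=
    fun t ht k => hb t k ht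
  have hbBd : ∀ t ∈ Set.Icc 0 T, Bd M (b t) := fun t ht F =>
    le_of_tendsto (tendsto_finsetSum F fun k _ => ((hlim t ht k).norm.pow 2).const_mul _)
      (.of_forall fun N => hBd N t ht F)
  have hb0 : b 0 = a₀ := by
    ext k
    refine tendsto_nhds_unique (hlim 0 ⟨le_rfl, hT.le⟩ k) ?_
    simp only [ha0]
    exact tendsto_tr a₀ k
  refine ⟨b, hb0, hbBd, SolOn.of_tendsto hσ hε.le hT.le hM hBd hbBd hsol hcont hlim, ?_⟩
  intro X hX hXb t ht F
  obtain ⟨η, hη, hNη⟩ := tendsto_Nc hσ hR (l := atTop) (.of_forall fun N => h₀.tr (win N)) h₀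
    (tendsto_tr a₀)
  have hlimF : Tendsto (fun N => ∑ k ∈ F, ‖Wc σ (a N t) k‖ ^ 2) atTop
      (nhds (∑ k ∈ F, ‖Wc σ (b t) k‖ ^ 2)) :=
    tendsto_finsetSum F fun k _ => (((hlim t ht k).const_mul _).sub (tendsto_Nc_apply hσ hM
      (.of_forall fun N => hBd N t ht) (hbBd t ht) (hlim t ht) k)).norm.pow 2
  have hR : Tendsto (fun N => Real.exp (2 * C * t) * (X + η N) ^ 2) atTop
      (nhds (Real.exp (2 * C * t) * X ^ 2)) := by
    have := ((hη.const_add X).pow 2).const_mul (Real.exp (2 * C * t))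
    rwa [add_zero] at this
  obtain ⟨N₀, hN₀⟩ := exists_subset_win F
  refine le_of_tendsto_of_tendsto hlimF hR ?_
  filter_upwards [hNη, eventually_ge_atTop N₀] with N hN hNN
  refine (Finset.sum_le_sum_of_subset_of_nonneg (hN₀.trans (win_mono hNN))
    fun _ _ _ => sq_nonneg _).trans ((hW ε T (win N) (a N) hε (hBd N) (hsol N) (hoff N) t ht).trans ?_)
  refine mul_le_mul_of_nonneg_left ?_ (Real.exp_pos _).le
  have h1 : ∑ k ∈ win N, ‖-(Nc σ (tr (win N) a₀) k - Nc σ a₀ k)‖ ^ 2 ≤ η N ^ 2 := by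
    simp only [norm_neg]; exact hN.2 _
  refine le_trans (le_of_eq (Finset.sum_congr rfl fun k hk => ?_))
    (sum_norm_add_sq_le hX hN.1 (hXb (win N)) h1)
  rw [ha0]
  simp only [Wc, tr, hk, if_true]
  congr 2; ring

/-- Coordinatewise convergence together with an upper bound on the norms implies strong convergence
in `ℓ²`. -/
lemma eventually_sum_norm_sub_sq_le {ι : Type*} {l : Filter ι} {x : ι → ℤ → ℂ} {y : ℤ → ℂ}
    {r : ι → ℝ} (hy : Summable fun k => ‖y k‖ ^ 2)
    (hxy : ∀ k, Tendsto (fun i => x i k) l (nhds (y k)))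
    (hx : ∀ᶠ i in l, ∀ F : Finset ℤ, ∑ k ∈ F, ‖x i k‖ ^ 2 ≤ r i)
    (hr : Tendsto r l (nhds (∑' k, ‖y k‖ ^ 2))) {e : ℝ} (he : 0 < e) :
    ∀ᶠ i in l, ∀ F : Finset ℤ, ∑ k ∈ F, ‖x i k - y k‖ ^ 2 ≤ e := by
  set X := ∑' k, ‖y k‖ ^ 2
  obtain ⟨G, hG⟩ := (hy.hasSum.eventually_const_lt (show X - e / 16 < X by linarith)).exists
  have h1 : Tendsto (fun i => ∑ k ∈ G, ‖x i k - y k‖ ^ 2) l (nhds (∑ k ∈ G, ‖y k - y k‖ ^ 2)) :=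
    tendsto_finsetSum G fun k _ => ((hxy k).sub_const _).norm.pow 2
  have h2 : Tendsto (fun i => ∑ k ∈ G, ‖x i k‖ ^ 2) l (nhds (∑ k ∈ G, ‖y k‖ ^ 2)) :=
    tendsto_finsetSum G fun k _ => (hxy k).norm.pow 2
  have h3 : ∑ k ∈ G, ‖y k - y k‖ ^ 2 < e / 4 := by simp [he]
  filter_upwards [hx, hr.eventually_lt_const (show X < X + e / 16 by linarith),
    h1.eventually_lt_const h3, h2.eventually_const_lt hG] with i hi hri h4 h5 F
  have h6 : ∑ k ∈ F \ G, ‖x i k‖ ^ 2 ≤ e / 8 := by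
    have := hi (F ∪ G)
    rw [← Finset.sdiff_union_self_eq_union, Finset.sum_union Finset.sdiff_disjoint] at this
    linarith
  have h7 : ∑ k ∈ F \ G, ‖y k‖ ^ 2 ≤ e / 16 := by
    have := hy.sum_le_tsum (F ∪ G) fun k _ => sq_nonneg ‖y k‖
    rw [← Finset.sdiff_union_self_eq_union, Finset.sum_union Finset.sdiff_disjoint] at this
    linarith
  have h8 : ∑ k ∈ F \ G, ‖x i k - y k‖ ^ 2 ≤ 2 * (e / 8) + 2 * (e / 16) := by
    calc _ ≤ ∑ k ∈ F \ G, (2 * ‖x i k‖ ^ 2 + 2 * ‖y k‖ ^ 2) := by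
          refine Finset.sum_le_sum fun k _ => ?_
          have := norm_sub_le (x i k) (y k)
          nlinarith [sq_nonneg (‖x i k‖ - ‖y k‖), norm_nonneg (x i k - y k)]
      _ ≤ _ := by
          rw [Finset.sum_add_distrib, ← Finset.mul_sum, ← Finset.mul_sum]; gcongr
  have h9 : ∑ k ∈ F ∩ G, ‖x i k - y k‖ ^ 2 ≤ ∑ k ∈ G, ‖x i k - y k‖ ^ 2 :=
    Finset.sum_le_sum_of_subset_of_nonneg Finset.inter_subset_right fun _ _ _ => sq_nonneg _
  rw [← Finset.sum_inter_add_sum_sdiff F G]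
  linarith

lemma Bd.summable_Wc {σ M : ℝ} (hσ : 1 ≤ σ) (hM : 0 ≤ M) {a : ℤ → ℂ} (h : Bd M a) :
    Summable fun k => ‖Wc σ a k‖ ^ 2 := by
  obtain ⟨L, hL, hN⟩ := exists_Nc_bound hσ (2 * M) (by positivity)
  refine summable_of_sum_le (c := 2 * M ^ 2 + 2 * L ^ 2) (fun _ => sq_nonneg _) fun F => ?_
  refine (Finset.sum_le_sum fun k _ => norm_Wc_sq_le σ a k).trans ?_
  rw [Finset.sum_add_distrib, ← Finset.mul_sum, ← Finset.mul_sum]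
  linarith [h.sum_pow_four_le F, hN M a hM h h.toBh F]

lemma SolOn.reverse {σ ε T T' h : ℝ} {a : ℝ → ℤ → ℂ} {S : Set ℤ} (hs : SolOn σ ε T a S)
    (h0 : T' ≤ h) (hT : h ≤ T) : SolOn σ (-ε) T' (fun s => a (h - s)) S := fun k hk t ht => by
  have h1 := hs k hk (h - t) ⟨by linarith [ht.2], by linarith [ht.1]⟩
  have hm : Set.MapsTo (fun s => h - s) (Set.Icc 0 T') (Set.Icc 0 T) := fun s hs =>
    ⟨by linarith [hs.2], by linarith [hs.1]⟩
  have := HasDerivWithinAt.scomp t h1 ((hasDerivAt_id t).const_sub h).hasDerivWithinAt hm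
  rw [neg_smul, one_smul, ← neg_mul, ← Complex.ofReal_neg] at this
  exact this

/-- The `L²` norm of the time derivative varies slowly in time, in both directions. -/
lemma exists_Wc_growth {σ : ℝ} (hσ : 1 ≤ σ) {M : ℝ} (hM : 0 ≤ M) : ∃ τ C : ℝ, 0 < τ ∧
    ∀ (T : ℝ) (a : ℝ → ℤ → ℂ), (∀ t ∈ Set.Icc 0 T, Bd M (a t)) → SolOn σ 1 T a Set.univ →
      ∀ s ∈ Set.Icc 0 T, ∀ t ∈ Set.Icc 0 T, |t - s| ≤ τ → ∀ F : Finset ℤ,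
        ∑ k ∈ F, ‖Wc σ (a t) k‖ ^ 2 ≤
          Real.exp (2 * C * |t - s|) * ∑' k, ‖Wc σ (a s) k‖ ^ 2 := by
  obtain ⟨τ, M', C, hτ, hM', hC, hex⟩ := exists_solution hσ M hM
  refine ⟨τ, C, hτ, fun T a ha hsol s hs t ht hts F => ?_⟩
  have key : ∀ (ε r : ℝ) (b : ℝ → ℤ → ℂ), |ε| = 1 → 0 ≤ r → r ≤ τ → b 0 = a s →
      (∀ t ∈ Set.Icc 0 r, Bd M (b t)) → SolOn σ ε r b Set.univ →
      ∑ k ∈ F, ‖Wc σ (b r) k‖ ^ 2 ≤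
          Real.exp (2 * C * r) * ∑' k, ‖Wc σ (a s) k‖ ^ 2 := by
    intro ε r b hε hr hrτ hb0 hb hbs
    obtain ⟨v, hv0, hv, hvs, hvW⟩ := hex ε (a s) hε (ha s hs)
    have hX : 0 ≤ ∑' k, ‖Wc σ (a s) k‖ ^ 2 := tsum_nonneg fun _ => sq_nonneg _
    have e : b r = v r := solution_unique hσ (M := max M M') (hM.trans (le_max_left _ _)) hε.le
      (fun t ht => (hb t ht).mono hM (le_max_left _ _))
      (fun t ht => (hv t ⟨ht.1, ht.2.trans hrτ⟩).mono hM' (le_max_right _ _))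
      hbs (hvs.mono hrτ) (hb0.trans hv0.symm) r ⟨hr, le_rfl⟩
    rw [e]
    have := hvW (Real.sqrt (∑' k, ‖Wc σ (a s) k‖ ^ 2)) (Real.sqrt_nonneg _) (fun F => by
      rw [Real.sq_sqrt hX]
      exact ((ha s hs).summable_Wc hσ hM).sum_le_tsum F fun k _ => sq_nonneg _) r ⟨hr, hrτ⟩ F
    rwa [Real.sq_sqrt hX] at this
  rcases le_total s t with h | h
  · rw [abs_of_nonneg (sub_nonneg.2 h)] at hts ⊢
    have := key 1 (t - s) (fun r => a (r + s)) (by simp) (by linarith) hts (by simp)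
      (fun r hr => ha _ ⟨add_nonneg hr.1 hs.1, by linarith [hr.2, ht.2]⟩)
      (hsol.shift hs.1 (by linarith [ht.2]))
    simpa using this
  · rw [abs_of_nonpos (sub_nonpos.2 h), neg_sub] at *
    have := key (-1) (s - t) (fun r => a (s - r)) (by simp) (by linarith) hts (by simp)
      (fun r hr => ha _ ⟨by linarith [hr.2, ht.1], by linarith [hr.1, hs.2]⟩)
      (hsol.reverse (by linarith [ht.1]) hs.2)
    simpa using this

/-- Solutions are continuous in time with values in `H²`. -/
lemma SolOn.eventually_Bd_sub {σ M T : ℝ} (hσ : 1 ≤ σ) (hM : 0 ≤ M) {a : ℝ → ℤ → ℂ}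
    (ha : ∀ t ∈ Set.Icc 0 T, Bd M (a t)) (hsol : SolOn σ 1 T a Set.univ) {s : ℝ}
    (hs : s ∈ Set.Icc 0 T) {e : ℝ} (he : 0 < e) :
    ∀ᶠ t in nhdsWithin s (Set.Icc 0 T), Bd e (fun k => a t k - a s k) := by
  obtain ⟨τ, C, hτ, hgr⟩ := exists_Wc_growth hσ hM
  have hmem : ∀ᶠ t in nhdsWithin s (Set.Icc 0 T), t ∈ Set.Icc 0 T := self_mem_nhdsWithin
  have hBd : ∀ᶠ t in nhdsWithin s (Set.Icc 0 T), Bd M (a t) := hmem.mono ha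
  have hlim : ∀ k, Tendsto (fun t => a t k) (nhdsWithin s (Set.Icc 0 T)) (nhds (a s k)) :=
    fun k => hsol.continuousOn k s hs
  have hWlim : ∀ k, Tendsto (fun t => Wc σ (a t) k) (nhdsWithin s (Set.Icc 0 T))
      (nhds (Wc σ (a s) k)) := fun k => continuousOn_Wc hσ hM ha hsol.continuousOn k s hs
  have hr : Tendsto (fun t => Real.exp (2 * C * |t - s|) * ∑' k, ‖Wc σ (a s) k‖ ^ 2)
      (nhdsWithin s (Set.Icc 0 T)) (nhds (∑' k, ‖Wc σ (a s) k‖ ^ 2)) := by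
    have : Continuous fun t => Real.exp (2 * C * |t - s|) * ∑' k, ‖Wc σ (a s) k‖ ^ 2 := by
      fun_prop
    have := this.tendsto s
    simp only [sub_self, abs_zero, mul_zero, Real.exp_zero, one_mul] at this
    exact this.mono_left nhdsWithin_le_nhds
  have hgr' : ∀ᶠ t in nhdsWithin s (Set.Icc 0 T), ∀ F : Finset ℤ,
      ∑ k ∈ F, ‖Wc σ (a t) k‖ ^ 2 ≤ Real.exp (2 * C * |t - s|) * ∑' k, ‖Wc σ (a s) k‖ ^ 2 := by
    filter_upwards [hmem, nhdsWithin_le_nhds (Metric.closedBall_mem_nhds s hτ)] with t ht htτ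
    exact hgr T a ha hsol s hs t ht htτ
  have h1 := eventually_sum_norm_sub_sq_le ((ha s hs).summable_Wc hσ hM) hWlim hgr' hr
    (show 0 < e ^ 2 / 8 by positivity)
  obtain ⟨η, hη, hNη⟩ := tendsto_Nc hσ hM hBd (ha s hs) hlim
  obtain ⟨η', hη', hBη⟩ := Bh_tendsto hBd (ha s hs) hlim
  have hη2 : Tendsto (fun t => η t ^ 2) (nhdsWithin s (Set.Icc 0 T)) (nhds 0) := by
    simpa using hη.pow 2
  have hη'2 : Tendsto (fun t => η' t ^ 2) (nhdsWithin s (Set.Icc 0 T)) (nhds 0) := by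
    simpa using hη'.pow 2
  filter_upwards [h1, hNη, hBη, hη2.eventually_lt_const (show 0 < e ^ 2 / 8 by positivity),
    hη'2.eventually_lt_const (show 0 < e ^ 2 / 8 by positivity)] with t ht1 ht2 ht3 ht4 ht5 F
  have e1 : ∀ k : ℤ, (1 + (k:ℝ) ^ 4) * ‖a t k - a s k‖ ^ 2 ≤ (1 + (k:ℝ) ^ 2) * ‖a t k - a s k‖ ^ 2 +
      2 * ‖Wc σ (a t) k - Wc σ (a s) k‖ ^ 2 + 2 * ‖Nc σ (a t) k - Nc σ (a s) k‖ ^ 2 := by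
    intro k
    have h2 := norm_add_le (Wc σ (a t) k - Wc σ (a s) k) (Nc σ (a t) k - Nc σ (a s) k)
    have h3 : Wc σ (a t) k - Wc σ (a s) k + (Nc σ (a t) k - Nc σ (a s) k) =
        -(Complex.I) * (k:ℂ) ^ 2 * (a t k - a s k) := by simp only [Wc]; ring
    have h4 : ‖-(Complex.I) * (k:ℂ) ^ 2 * (a t k - a s k)‖ = (k:ℝ) ^ 2 * ‖a t k - a s k‖ := by simp
    rw [h3, h4] at h2
    have h5 := mul_self_le_mul_self (by positivity) h2
    nlinarith [sq_nonneg (‖Wc σ (a t) k - Wc σ (a s) k‖ - ‖Nc σ (a t) k - Nc σ (a s) k‖),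
      mul_nonneg (sq_nonneg (k:ℝ)) (sq_nonneg ‖a t k - a s k‖)]
  refine (Finset.sum_le_sum fun k _ => e1 k).trans ?_
  simp only [Finset.sum_add_distrib, ← Finset.mul_sum]
  linarith [ht1 F, ht2.2 F, ht3 F, sq_nonneg e]

lemma abs_rpow_two_mul_two (k : ℤ) : |(k:ℝ)| ^ ((2:ℝ) * 2) = (k:ℝ) ^ 4 := by
  have : ((2:ℝ) * 2) = ((4:ℕ):ℝ) := by norm_num
  rw [this, Real.rpow_natCast]
  exact (even_two_mul 2).pow_abs _

lemma Bd.memHs {M : ℝ} {a : ℤ → ℂ} (hM : 0 ≤ M) (h : Bd M a) : MemHs 2 (ev a) := by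
  refine ⟨ev_periodic a, (continuous_ev (h.summable hM)).intervalIntegrable _ _, ?_⟩
  simpa only [abs_rpow_two_mul_two, fc_ev (h.summable hM)] using h.summable_weight

lemma Bd.hsNorm_le {M : ℝ} {f : ℝ → ℂ} (hM : 0 ≤ M) (h : Bd M (fc f)) : HsNorm 2 f ≤ M := by
  refine Real.sqrt_le_iff.2 ⟨hM, ?_⟩
  simp only [HsNormSq, abs_rpow_two_mul_two]
  exact h.summable_weight.tsum_le_of_sum_le h

lemma MemHs.bd {f : ℝ → ℂ} (h : MemHs 2 f) : Bd (HsNorm 2 f) (fc f) := by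
  intro S
  have h3 := h.2.2
  rw [HsNorm, HsNormSq, Real.sq_sqrt (tsum_nonneg fun k => by positivity)]
  simp only [abs_rpow_two_mul_two] at h3 ⊢
  exact h3.sum_le_tsum S fun k _ => by positivity

lemma SolOn.contHs {σ M T : ℝ} {a : ℝ → ℤ → ℂ} (hσ : 1 ≤ σ) (hM : 0 ≤ M)
    (ha : ∀ t ∈ Set.Icc 0 T, Bd M (a t)) (hsol : SolOn σ 1 T a Set.univ) :
    ContHs 2 T (fun t => ev (a t)) := by
  refine ⟨fun t ht => (ha t ht).memHs hM, fun t ht => ?_⟩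
  rw [Metric.tendsto_nhds]
  intro e he
  filter_upwards [hsol.eventually_Bd_sub hσ hM ha ht (half_pos he), self_mem_nhdsWithin]
    with s hs hs'
  have h1 := (ha s hs').summable hM
  have h2 := (ha t ht).summable hM
  have h3 : fc (fun x => ev (a s) x - ev (a t) x) = fun k => a s k - a t k := by
    ext k; rw [fc_sub (continuous_ev h1) (continuous_ev h2), fc_ev h1, fc_ev h2]
  rw [← h3] at hs
  have := hs.hsNorm_le (half_pos he).le
  rw [Real.dist_eq, sub_zero, abs_of_nonneg (show 0 ≤ HsNorm 2 _ from Real.sqrt_nonneg _)]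
  linarith

/-- The multiplier of the Schrödinger semigroup. -/
def ph (t : ℝ) (k : ℤ) : ℂ := Complex.exp (-(Complex.I) * (k : ℂ) ^ 2 * (t : ℂ))

lemma norm_ph (t : ℝ) (k : ℤ) : ‖ph t k‖ = 1 := by
  have : -(Complex.I) * (k : ℂ) ^ 2 * (t : ℂ) = ((-(k ^ 2 * t) : ℝ) : ℂ) * Complex.I := by
    push_cast; ring
  rw [ph, this, Complex.norm_exp_ofReal_mul_I]

lemma continuous_ph (k : ℤ) : Continuous fun t => ph t k := by unfold ph; fun_prop

lemma ph_sub (t s : ℝ) (k : ℤ) : ph (t - s) k = ph t k * ph (-s) k := by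
  unfold ph; rw [← Complex.exp_add]; push_cast; ring_nf

lemma ph_zero (k : ℤ) : ph 0 k = 1 := by simp [ph]

lemma hasDerivAt_ph (k : ℤ) (t : ℝ) :
    HasDerivAt (fun t => ph t k) (-(Complex.I) * (k : ℂ) ^ 2 * ph t k) t := by
  have h : HasDerivAt (fun y : ℝ => -(Complex.I) * (k : ℂ) ^ 2 * (y : ℂ))
      (-(Complex.I) * (k : ℂ) ^ 2 * 1) t :=
    (Complex.ofRealCLM.hasDerivAt (x := t)).const_mul _
  refine h.cexp.congr_deriv ?_
  simp only [ph]; ring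

lemma Sg_eq_ev (t : ℝ) (f : ℝ → ℂ) : Sg t f = ev (fun k => ph t k * fc f k) := rfl

lemma Bd.ph_mul {M : ℝ} {a : ℤ → ℂ} (h : Bd M a) (t : ℝ) : Bd M (fun k => ph t k * a k) := by
  intro S; simpa [norm_ph] using h S

lemma Bh.ph_mul {M : ℝ} {a : ℤ → ℂ} (h : Bh M a) (t : ℝ) : Bh M (fun k => ph t k * a k) := by
  intro S; simpa [norm_ph] using h S

lemma NL_ev {σ M : ℝ} {a : ℤ → ℂ} (hM : 0 ≤ M) (h : Bd M a) : NL σ (ev a) = Nf σ a := by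
  ext x
  rw [NL, (h.hasDerivAt_ev hM x).deriv]; rfl

/-- Summation and time integration commute in the Duhamel term. -/
lemma duhamel {C t : ℝ} {n : ℝ → ℤ → ℂ} (hC : 0 ≤ C) (ht : 0 ≤ t)
    (hn : ∀ s ∈ Set.Icc 0 t, Bh C (n s))
    (hc : ∀ k, ContinuousOn (fun s => n s k) (Set.Icc 0 t)) (x : ℝ) :
    HasSum (fun k => (∫ s in (0:ℝ)..t, ph (t - s) k * n s k) * ex k x)
      (∫ s in (0:ℝ)..t, ev (fun k => ph (t - s) k * n s k) x) := by
  have hcont : ∀ k, ContinuousOn (fun s => ph (t - s) k * n s k * ex k x) (Set.Icc 0 t) := by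
    intro k
    refine (ContinuousOn.mul ?_ (hc k)).mul continuousOn_const
    exact ((continuous_ph k).comp (by fun_prop)).continuousOn
  have key := MeasureTheory.hasSum_integral_of_summable_integral_norm
    (μ := volume.restrict (Set.Ioc 0 t))
    (F := fun (k : ℤ) (s : ℝ) => ph (t - s) k * n s k * ex k x) ?_ ?_
  · simp only [intervalIntegral.integral_of_le ht]
    simp only [← integral_mul_const]
    exact key
  · intro k
    exact ((hcont k).integrableOn_Icc.mono_set Set.Ioc_subset_Icc_self)
  · have h_int : ∀ k, IntegrableOn (fun s => ‖n s k‖) (Set.Icc 0 t) :=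
      fun k => (hc k).norm.integrableOn_Icc
    refine summable_of_sum_le (c := ∫ s in Set.Icc 0 t, kap * C) (fun k => ?_) fun S => ?_
    · exact integral_nonneg fun _ => norm_nonneg _
    simp only [norm_mul, norm_ph, norm_ex, one_mul, mul_one]
    rw [← integral_finsetSum _ fun k _ => (h_int k).mono_set Set.Ioc_subset_Icc_self,
      ← integral_Icc_eq_integral_Ioc]
    refine setIntegral_mono_on (integrable_finsetSum _ fun k _ => h_int k)
      (by exact integrableOn_const (by simp)) measurableSet_Icc fun s hs => ?_
    exact (hn s hs).sum_norm_le hC S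

/-- Duhamel formula for the Fourier coefficients. -/
lemma SolOn.duhamel {σ T : ℝ} {a : ℝ → ℤ → ℂ} (h : SolOn σ 1 T a Set.univ)
    (hc : ∀ k, ContinuousOn (fun s => Nc σ (a s) k) (Set.Icc 0 T)) (k : ℤ) :
    ∀ t ∈ Set.Icc 0 T,
      a t k = ph t k * a 0 k - ∫ s in (0:ℝ)..t, ph (t - s) k * Nc σ (a s) k := by
  intro t ht
  have h1 : ∀ s ∈ Set.Icc 0 T, HasDerivWithinAt (fun s => ph (-s) k * a s k)
      (-(ph (-s) k * Nc σ (a s) k)) (Set.Icc 0 T) s := by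
    intro s hs
    have h2 := h k (Set.mem_univ _) s hs
    have h3 : HasDerivAt (fun s => ph (-s) k) (-(-(Complex.I) * (k : ℂ) ^ 2 * ph (-s) k)) s := by
      have := (hasDerivAt_ph k (-s)).scomp s (hasDerivAt_neg s)
      exact this.congr_deriv (by simp)
    refine (h3.hasDerivWithinAt.mul h2).congr_deriv ?_
    push_cast; ring
  have h4 := integral_of_hasDerivWithinAt (?_) h1 t ht
  · simp only [neg_zero, ph_zero, one_mul, intervalIntegral.integral_neg] at h4
    simp only [ph_sub, mul_assoc, intervalIntegral.integral_const_mul]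
    have h5 : ph t k * ph (-t) k = 1 := by rw [← ph_sub, sub_self, ph_zero]
    linear_combination (-a t k) * h5 + ph t k * h4
  · refine (ContinuousOn.mul ?_ (hc k)).neg
    exact ((continuous_ph k).comp continuous_neg).continuousOn

/-- The Duhamel formula for the Fourier coefficients implies the differential equation. -/
lemma SolOn.of_duhamel {σ T : ℝ} {a : ℝ → ℤ → ℂ} (hT : 0 ≤ T)
    (hc : ∀ k, ContinuousOn (fun s => Nc σ (a s) k) (Set.Icc 0 T))
    (h : ∀ k, ∀ t ∈ Set.Icc 0 T,
      a t k = ph t k * a 0 k - ∫ s in (0:ℝ)..t, ph (t - s) k * Nc σ (a s) k) :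
    SolOn σ 1 T a Set.univ := by
  intro k _ t ht
  have h1 := hasDerivWithinAt_of_integral hT (f := fun t => ph (-t) k * a t k)
    (g := fun s => -(ph (-s) k * Nc σ (a s) k)) ?_ ?_ t ht
  · have h2 := (hasDerivAt_ph k t).hasDerivWithinAt.mul h1
    have h6 : ∀ t, ph t k * ph (-t) k = 1 := fun t => by rw [← ph_sub, sub_self, ph_zero]
    have h3 : ∀ s, ph s k * (ph (-s) k * a s k) = a s k := fun s => by
      linear_combination (a s k) * h6 s
    refine (h2.congr_of_eventuallyEq ?_ ?_).congr_deriv ?_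
    · exact Eventually.of_forall fun s => (h3 s).symm
    · exact (h3 t).symm
    · push_cast
      linear_combination (-(Complex.I) * (k : ℂ) ^ 2 * a t k - Nc σ (a t) k) * h6 t
  · refine (ContinuousOn.mul ?_ (hc k)).neg
    exact ((continuous_ph k).comp continuous_neg).continuousOn
  · intro t ht
    have h6 : ph t k * ph (-t) k = 1 := by rw [← ph_sub, sub_self, ph_zero]
    have h4 := h k t ht
    simp only [ph_sub, mul_assoc, intervalIntegral.integral_const_mul] at h4
    simp only [neg_zero, ph_zero, one_mul, intervalIntegral.integral_neg]
    linear_combination ph (-t) k * h4 +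
      (a 0 k - ∫ s in (0:ℝ)..t, ph (-s) k * Nc σ (a s) k) * h6

lemma SolOn.isMildSolution {σ M T : ℝ} {a : ℝ → ℤ → ℂ} (hσ : 1 ≤ σ) (hM : 0 ≤ M)
    (ha : ∀ t ∈ Set.Icc 0 T, Bd M (a t)) (hsol : SolOn σ 1 T a Set.univ) {u₀ : ℝ → ℂ}
    (h0 : a 0 = fc u₀) : IsMildSolution σ T u₀ (fun t => ev (a t)) := by
  intro t ht x
  obtain ⟨C, hC, hN⟩ := exists_Bh_Nc hσ M hM
  have hT : (0:ℝ) ≤ T := ht.1.trans ht.2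
  have hsub : Set.Icc 0 t ⊆ Set.Icc 0 T := Set.Icc_subset_Icc_right ht.2
  have hc : ∀ k, ContinuousOn (fun s => Nc σ (a s) k) (Set.Icc 0 T) := fun k =>
    continuousOn_Nc hσ hM ha (fun k => hsol.continuousOn k) k
  have h1 := _root_.duhamel hC ht.1 (n := fun s => Nc σ (a s)) (fun s hs => hN _ (ha s (hsub hs)))
    (fun k => (hc k).mono hsub) x
  have h2 : ∫ s in (0:ℝ)..t, Sg (t - s) (NL σ (ev (a s))) x
      = ∫ s in (0:ℝ)..t, ev (fun k => ph (t - s) k * Nc σ (a s) k) x := by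
    refine intervalIntegral.integral_congr fun s hs => ?_
    rw [Set.uIcc_of_le ht.1] at hs
    simp only [Sg_eq_ev, NL_ev hM (ha s (hsub hs))]; rfl
  have h3 := (summable_ev (((ha 0 ⟨le_rfl, hT⟩).ph_mul t).summable hM) x).hasSum.sub h1
  rw [h2]
  simp only [Sg_eq_ev, ← h0]
  rw [ev, ev, ← h3.tsum_eq]
  refine tsum_congr fun k => ?_
  rw [hsol.duhamel hc k t ht]
  ring

lemma ae_uniqueDiffWithinAt (S : Set ℝ) : ∀ᵐ x, x ∈ S → UniqueDiffWithinAt ℝ S x := by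
  have h := (countable_setOfPred_isolated_right_within (s := S)).ae_notMem volume
  filter_upwards [h] with x hx hxS
  rw [uniqueDiffWithinAt_iff_accPt, accPt_principal_iff_nhdsWithin]
  have h1 : NeBot (nhdsWithin x (S ∩ Set.Ioi x)) := neBot_iff.2 fun h => hx ⟨hxS, h⟩
  exact h1.mono (nhdsWithin_mono _ fun y hy => ⟨hy.1, (ne_of_gt hy.2 : y ≠ x)⟩)

lemma HsNorm_nonneg (s : ℝ) (f : ℝ → ℂ) : 0 ≤ HsNorm s f := Real.sqrt_nonneg _

lemma fc_sub_of_intervalIntegrable {f g : ℝ → ℂ}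
    (hf : IntervalIntegrable f volume 0 (2 * Real.pi))
    (hg : IntervalIntegrable g volume 0 (2 * Real.pi)) (k : ℤ) :
    fc (fun x => f x - g x) k = fc f k - fc g k := by
  unfold fc
  rw [← mul_sub, ← intervalIntegral.integral_sub]
  · simp only [sub_mul]
  · exact hf.mul_continuousOn (by fun_prop)
  · exact hg.mul_continuousOn (by fun_prop)

lemma MemHs.bd_sub {f g : ℝ → ℂ} (hf : MemHs 2 f) (hg : MemHs 2 g) :
    Bd (HsNorm 2 fun x => f x - g x) (fun k => fc f k - fc g k) := by
  have h1 : fc (fun x => f x - g x) = fun k => fc f k - fc g k := by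
    ext k; exact fc_sub_of_intervalIntegrable hf.2.1 hg.2.1 k
  rw [← h1]
  refine MemHs.bd ⟨hf.1.sub hg.1, hf.2.1.sub hg.2.1, ?_⟩
  have h2 := (hf.bd.sub (HsNorm_nonneg _ _) (HsNorm_nonneg _ _) hg.bd).summable_weight
  simpa only [h1, abs_rpow_two_mul_two] using h2

lemma ContHs.exists_bd {T : ℝ} {v : ℝ → ℝ → ℂ} (hv : ContHs 2 T v) :
    ∃ M, 0 ≤ M ∧ ∀ t ∈ Set.Icc 0 T, Bd M (fc (v t)) := by
  refine isCompact_Icc.induction_on (p := fun s => ∃ M, 0 ≤ M ∧ ∀ t ∈ s, Bd M (fc (v t)))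
    ⟨0, le_rfl, by simp⟩ ?_ ?_ ?_
  · rintro s t hst ⟨M, hM, h⟩
    exact ⟨M, hM, fun r hr => h r (hst hr)⟩
  · rintro s t ⟨M, hM, h⟩ ⟨M', hM', h'⟩
    refine ⟨max M M', hM.trans (le_max_left _ _), ?_⟩
    rintro r (hr | hr)
    · exact (h r hr).mono hM (le_max_left _ _)
    · exact (h' r hr).mono hM' (le_max_right _ _)
  · intro t ht
    have h1 := hv.2 t ht
    rw [Metric.tendsto_nhds] at h1
    refine ⟨_, h1 1 one_pos |>.and self_mem_nhdsWithin, 2 * (1 + HsNorm 2 (v t)), ?_, ?_⟩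
    · have := HsNorm_nonneg 2 (v t); positivity
    · rintro s ⟨hs, hsI⟩
      rw [Real.dist_eq, sub_zero, abs_of_nonneg (HsNorm_nonneg _ _)] at hs
      have h2 := ((hv.1 s hsI).bd_sub (hv.1 t ht)).mono (HsNorm_nonneg _ _) hs.le
      have h3 : Bd (HsNorm 2 (v t)) (fun k => -fc (v t) k) := by
        intro S; simpa using (hv.1 t ht).bd S
      simpa using h2.sub zero_le_one (HsNorm_nonneg _ _) h3

lemma ContHs.continuousOn_fc {T : ℝ} {v : ℝ → ℝ → ℂ} (hv : ContHs 2 T v) (k : ℤ) :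
    ContinuousOn (fun t => fc (v t) k) (Set.Icc 0 T) := by
  intro t ht
  rw [ContinuousWithinAt, tendsto_iff_norm_sub_tendsto_zero]
  refine squeeze_zero' (Eventually.of_forall fun _ => norm_nonneg _) ?_ (hv.2 t ht)
  filter_upwards [self_mem_nhdsWithin] with s hs
  exact ((hv.1 s hs).bd_sub (hv.1 t ht)).norm_le (HsNorm_nonneg _ _) k

/-- An integrable function with vanishing Fourier coefficients vanishes almost everywhere. -/
lemma ae_eq_zero_of_fc {g : ℝ → ℂ} (hg : IntervalIntegrable g volume 0 (2 * Real.pi))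
    (h : ∀ k, fc g k = 0) : ∀ᵐ x, x ∈ Set.Ioo 0 (2 * Real.pi) → g x = 0 := by
  have : Fact (0 < 2 * Real.pi) := ⟨two_pi_pos'⟩
  have h_int : ∀ φ : C(AddCircle (2 * Real.pi), ℂ), IntervalIntegrable
      (fun x : ℝ => g x * φ (x : AddCircle (2 * Real.pi))) volume 0 (2 * Real.pi) := fun φ =>
    hg.mul_continuousOn (φ.continuous.comp (AddCircle.continuous_mk' _)).continuousOn
  let L : C(AddCircle (2 * Real.pi), ℂ) →ₗ[ℂ] ℂ :=
    { toFun := fun φ => ∫ x in (0:ℝ)..(2 * Real.pi), g x * φ (x : AddCircle (2 * Real.pi))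
      map_add' := fun φ ψ => by
        rw [← intervalIntegral.integral_add (h_int φ) (h_int ψ)]
        simp [mul_add]
      map_smul' := fun c φ => by
        simp only [RingHom.id_apply, smul_eq_mul, ← intervalIntegral.integral_const_mul]
        refine intervalIntegral.integral_congr fun x _ => ?_
        simp; ring }
  have hL : Continuous L := by
    refine (L.mkContinuous (∫ x in (0:ℝ)..(2 * Real.pi), ‖g x‖) fun φ => ?_).continuous
    refine (intervalIntegral.norm_integral_le_integral_norm two_pi_pos'.le).trans ?_
    rw [← intervalIntegral.integral_mul_const]
    refine intervalIntegral.integral_mono_on two_pi_pos'.le (h_int φ).norm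
      (hg.norm.mul_const _) fun x _ => ?_
    rw [norm_mul]
    gcongr
    exact φ.norm_coe_le_norm _
  have hker : (Submodule.span ℂ (Set.range (@fourier (2 * Real.pi)))).topologicalClosure
      ≤ LinearMap.ker L := by
    refine Submodule.topologicalClosure_minimal _ ?_ (isClosed_singleton.preimage hL)
    rw [Submodule.span_le]
    rintro _ ⟨n, rfl⟩
    have h1 := h (-n)
    rw [fc, mul_eq_zero] at h1
    rcases h1 with h1 | h1
    · exfalso
      have : (Real.pi : ℂ) ≠ 0 := by exact_mod_cast Real.pi_ne_zero
      simp [this] at h1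
    · refine Eq.trans ?_ h1
      refine intervalIntegral.integral_congr fun x _ => ?_
      have hpi : (Real.pi : ℂ) ≠ 0 := by exact_mod_cast Real.pi_ne_zero
      simp only [fourier_coe_apply]
      congr 2
      push_cast; field_simp
  rw [span_fourier_closure_eq_top] at hker
  refine isOpen_Ioo.ae_eq_zero_of_integral_contDiff_smul_eq_zero ?_ fun φ hφ _ hsupp => ?_
  · rw [intervalIntegrable_iff_integrableOn_Ioo_of_le two_pi_pos'.le] at hg
    exact hg.locallyIntegrableOn
  have hφ0 : ∀ x, x ∉ Set.Ioo 0 (2 * Real.pi) → φ x = 0 := fun x hx =>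
    image_eq_zero_of_notMem_tsupport fun hx' => hx (hsupp hx')
  have hc : Continuous (AddCircle.liftIco (2 * Real.pi) 0 fun x => (φ x : ℂ)) := by
    refine AddCircle.liftIco_zero_continuous ?_ ?_
    · rw [hφ0 0 (by simp), hφ0 (2 * Real.pi) (by simp)]
    · exact (Complex.continuous_ofReal.comp hφ.continuous).continuousOn
  let ψ : C(AddCircle (2 * Real.pi), ℂ) := ⟨_, hc⟩
  have h2 : L ψ = 0 := hker (Submodule.mem_top (x := ψ))
  rw [← h2]
  change _ = ∫ x in (0:ℝ)..(2 * Real.pi), _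
  rw [intervalIntegral.integral_of_le two_pi_pos'.le, integral_Ioc_eq_integral_Ioo,
    ← integral_indicator measurableSet_Ioo]
  congr 1
  ext x
  by_cases hx : x ∈ Set.Ioo 0 (2 * Real.pi)
  · rw [Set.indicator_of_mem hx]
    change _ = g x * AddCircle.liftIco (2 * Real.pi) 0 _ _
    rw [AddCircle.liftIco_zero_coe_apply ⟨hx.1.le, hx.2⟩, Complex.real_smul, mul_comm]
  · rw [Set.indicator_of_notMem hx, hφ0 x hx, zero_smul]

/-- A periodic property holds almost everywhere if it does on a period. -/
lemma ae_of_ae_Ioo {p : ℝ → Prop} (hp : ∀ x (n : ℤ), p (x + n * (2 * Real.pi)) → p x)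
    (h : ∀ᵐ x, x ∈ Set.Ioo 0 (2 * Real.pi) → p x) : ∀ᵐ x, p x := by
  have h1 : ∀ n : ℤ, ∀ᵐ x : ℝ, x + n * (2 * Real.pi) ∈ Set.Ioo 0 (2 * Real.pi) →
      p (x + n * (2 * Real.pi)) := fun n =>
    (measurePreserving_add_right volume ((n:ℝ) * (2 * Real.pi))).quasiMeasurePreserving.ae h
  have h2 : ∀ᵐ x : ℝ, x ∉ Set.range fun n : ℤ => (n:ℝ) * (2 * Real.pi) :=
    (Set.countable_range _).ae_notMem volume
  filter_upwards [ae_all_iff.2 h1, h2] with x hx hx2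
  have hpos := two_pi_pos'
  refine hp x (-⌊x / (2 * Real.pi)⌋) (hx _ ⟨?_, ?_⟩)
  · have h3 := Int.floor_le (x / (2 * Real.pi))
    rw [le_div_iff₀ hpos] at h3
    push_cast
    rcases h3.lt_or_eq with h4 | h4
    · linarith
    · exact absurd ⟨_, h4⟩ hx2
  · have h3 := Int.lt_floor_add_one (x / (2 * Real.pi))
    rw [div_lt_iff₀ hpos] at h3
    push_cast
    linarith

lemma ae_eq_ev_fc {f : ℝ → ℂ} (hp : Function.Periodic f (2 * Real.pi))
    (hf : IntervalIntegrable f volume 0 (2 * Real.pi)) (hs : Summable fun k => ‖fc f k‖) :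
    ∀ᵐ x, f x = ev (fc f) x := by
  have hc := (continuous_ev hs).intervalIntegrable (μ := volume) 0 (2 * Real.pi)
  refine ae_of_ae_Ioo (fun x n h => ?_) ?_
  · rwa [hp.int_mul n, (ev_periodic (fc f)).int_mul n] at h
  · have := ae_eq_zero_of_fc (hf.sub hc) fun k => by
      have := fc_sub_of_intervalIntegrable hf hc k
      rw [fc_ev hs, sub_self] at this
      exact this
    filter_upwards [this] with x hx hx'
    exact sub_eq_zero.1 (hx hx')

/-- If `f` agrees a.e. with a smooth function, its nonlinearity is the expected one at a.e. point of
differentiability. -/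
lemma ae_NL_eq {σ M : ℝ} {a : ℤ → ℂ} {f : ℝ → ℂ} (hM : 0 ≤ M) (ha : Bd M a)
    (hf : ∀ᵐ x, f x = ev a x) : ∀ᵐ x, DifferentiableAt ℝ f x → NL σ f x = Nf σ a x := by
  filter_upwards [hf, ae_uniqueDiffWithinAt {x | f x = ev a x}] with x hx hu hd
  have h1 := (ha.hasDerivAt_ev hM x).hasDerivWithinAt (s := {x | f x = ev a x})
  have h2 := hd.hasDerivAt.hasDerivWithinAt (s := {x | f x = ev a x})
  have h3 := h1.congr (f₁ := f) (fun y hy => hy) hx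
  rw [NL, (hu hx).eq_deriv _ h2 h3, hx]; rfl

lemma ae_NL_zero_or_eq {σ M : ℝ} {a : ℤ → ℂ} {f : ℝ → ℂ} (hM : 0 ≤ M) (ha : Bd M a)
    (hf : ∀ᵐ x, f x = ev a x) : ∀ᵐ x, NL σ f x = 0 ∨ NL σ f x = Nf σ a x := by
  filter_upwards [ae_NL_eq (σ := σ) hM ha hf] with x hx
  by_cases hd : DifferentiableAt ℝ f x
  · exact Or.inr (hx hd)
  · left; rw [NL, deriv_zero_of_not_differentiableAt hd, mul_zero]

lemma NL_periodic (σ : ℝ) {f : ℝ → ℂ} (hf : Function.Periodic f (2 * Real.pi)) :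
    Function.Periodic (NL σ f) (2 * Real.pi) := by
  intro x
  have h1 : deriv f (x + 2 * Real.pi) = deriv f x := by
    rw [← deriv_comp_add_const]
    congr 1
    ext y; exact hf y
  rw [NL, hf x, h1]; rfl

/-- The nonlinearity has uniformly bounded `H¹` norm as soon as its Fourier series converges
absolutely. -/
lemma exists_Bh_fc_NL {σ : ℝ} (hσ : 1 ≤ σ) (M : ℝ) (hM : 0 ≤ M) : ∃ C : ℝ, 0 ≤ C ∧
    ∀ a f, Bd M a → Function.Periodic f (2 * Real.pi) → (∀ᵐ x, f x = ev a x) →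
      Summable (fun k => ‖fc (NL σ f) k‖) → Bh C (fc (NL σ f)) := by
  obtain ⟨C, hC, h⟩ := exists_Bh_of_zero_or_eq hσ M hM
  refine ⟨C, hC, fun a f ha hp hf hs => ?_⟩
  have hNf := continuous_Nf hσ hM ha
  have hzero := ae_NL_zero_or_eq (σ := σ) hM ha hf
  have hmeas : AEStronglyMeasurable (NL σ f) volume := by
    have h1 : AEMeasurable f volume :=
      ((continuous_ev (ha.summable hM)).measurable.aemeasurable).congr
        (hf.mono fun x hx => hx.symm)
    have h2 : AEMeasurable (fun x => ‖f x‖ ^ (2 * σ)) volume := h1.norm.pow_const _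
    exact ((Complex.measurable_ofReal.comp_aemeasurable h2).mul
      (measurable_deriv f).aemeasurable).aestronglyMeasurable
  have h_int : IntervalIntegrable (NL σ f) volume 0 (2 * Real.pi) := by
    refine (hNf.norm.intervalIntegrable 0 (2 * Real.pi)).mono_fun' hmeas.restrict ?_
    refine ae_restrict_of_ae (hzero.mono fun x hx => ?_)
    rcases hx with hx | hx <;> simp [hx]
  have hae := ae_eq_ev_fc (NL_periodic σ hp) h_int hs
  have hcw := continuous_ev hs
  have hfc : fc (NL σ f) = fc (ev (fc (NL σ f))) := by ext k; rw [fc_ev hs]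
  rw [hfc]
  refine h a ha _ hcw (ev_periodic _) ?_
  have hdense : Dense {x | ev (fc (NL σ f)) x = 0 ∨ ev (fc (NL σ f)) x = Nf σ a x} := by
    refine Measure.dense_of_ae (μ := volume) ?_
    filter_upwards [hzero, hae] with x h1 h2
    rwa [← h2]
  have hclosed : IsClosed {x | ev (fc (NL σ f)) x = 0 ∨ ev (fc (NL σ f)) x = Nf σ a x} :=
    (isClosed_eq hcw continuous_const).union (isClosed_eq hcw hNf)
  intro x
  have := hclosed.closure_eq ▸ hdense x
  exact this

/-- The total variation of an `H¹` function over a period. -/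
lemma Bh.sum_norm_ev_sub_le {C : ℝ} {c : ℤ → ℂ} (hC : 0 ≤ C) (h : Bh C c) {n : ℕ} {p : ℕ → ℝ}
    (hp : Monotone p) (hp0 : ∀ i, p i ∈ Set.Icc 0 (2 * Real.pi)) :
    ∑ i ∈ Finset.range n, ‖ev c (p (i + 1)) - ev c (p i)‖ ≤ Real.pi * (C ^ 2 + 1) := by
  have htr : ∀ F : Finset ℤ, ∑ i ∈ Finset.range n,
      ‖(∑ k ∈ F, c k * ex k (p (i + 1))) - ∑ k ∈ F, c k * ex k (p i)‖ ≤ Real.pi * (C ^ 2 + 1) := by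
    intro F
    set g : ℝ → ℂ := fun x => ∑ k ∈ F, c k * ex k x with hg
    set g' : ℝ → ℂ := fun x => ∑ k ∈ F, c k * (Complex.I * k * ex k x) with hg'
    have hder : ∀ x, HasDerivAt g (g' x) x := fun x =>
      HasDerivAt.fun_sum fun k _ => (hasDerivAt_ex k x).const_mul (c k)
    have hcont : Continuous g' :=
      continuous_finsetSum _ fun k _ => by have := continuous_ex k; fun_prop
    have hii : ∀ x y, IntervalIntegrable (fun x => ‖g' x‖) volume x y := fun x y =>
      hcont.norm.intervalIntegrable x y
    have h1 : ∀ i, ‖g (p (i + 1)) - g (p i)‖ ≤ ∫ x in (p i)..(p (i + 1)), ‖g' x‖ := by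
      intro i
      rw [← intervalIntegral.integral_eq_sub_of_hasDerivAt (fun x _ => hder x)
        (hcont.intervalIntegrable _ _)]
      exact intervalIntegral.norm_integral_le_integral_norm (hp (Nat.le_succ i))
    have h2 : ∫ x in (p 0)..(p n), ‖g' x‖ ≤ ∫ x in (0:ℝ)..(2 * Real.pi), ‖g' x‖ :=
      intervalIntegral.integral_mono_interval (hp0 0).1 (hp (Nat.zero_le n)) (hp0 n).2
        (Eventually.of_forall fun _ => norm_nonneg _) (hii _ _)
    have h3 : g' = ev (fun k => if k ∈ F then Dc c k else 0) := by
      ext x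
      rw [ev, tsum_eq_sum (s := F) (fun k hk => by simp [hk])]
      refine Finset.sum_congr rfl fun k hk => ?_
      simp only [hk, if_true, Dc]; ring
    have h4 : Summable fun k => ‖(fun k => if k ∈ F then Dc c k else 0) k‖ :=
      summable_of_ne_finset_zero (s := F) fun k hk => by simp [hk]
    have h5 := parseval_ev h4
    rw [← h3] at h5
    have h6 : (2 * Real.pi)⁻¹ * ∫ x in (0:ℝ)..(2 * Real.pi), ‖g' x‖ ^ 2 ≤ C ^ 2 := by
      rw [← h5.tsum_eq, tsum_eq_sum (s := F) (fun k hk => by simp [hk])]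
      refine (Finset.sum_le_sum fun k hk => ?_).trans (h F)
      simp only [hk, if_true, norm_Dc, mul_pow, sq_abs]
      nlinarith [sq_nonneg ‖c k‖]
    have hsq : IntervalIntegrable (fun x => ‖g' x‖ ^ 2) volume 0 (2 * Real.pi) :=
      (hcont.norm.pow 2).intervalIntegrable _ _
    have h7 : ∫ x in (0:ℝ)..(2 * Real.pi), 2 * ‖g' x‖ ≤
        ∫ x in (0:ℝ)..(2 * Real.pi), (‖g' x‖ ^ 2 + 1) := by
      refine intervalIntegral.integral_mono_on two_pi_pos'.le ((hii _ _).const_mul _)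
        (hsq.add intervalIntegrable_const) fun x _ => ?_
      nlinarith [sq_nonneg (‖g' x‖ - 1)]
    rw [intervalIntegral.integral_const_mul, intervalIntegral.integral_add hsq
      intervalIntegrable_const, intervalIntegral.integral_const, smul_eq_mul, sub_zero] at h7
    rw [inv_mul_le_iff₀ two_pi_pos'] at h6
    have h9 : ∫ x in (0:ℝ)..(2 * Real.pi), ‖g' x‖ ≤ Real.pi * (C ^ 2 + 1) := by linarith
    refine (Finset.sum_le_sum fun i _ => h1 i).trans ?_
    rw [intervalIntegral.sum_integral_adjacent_intervals fun i _ => hii _ _]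
    exact h2.trans h9
  refine le_of_tendsto (f := fun F : Finset ℤ => ∑ i ∈ Finset.range n,
      ‖(∑ k ∈ F, c k * ex k (p (i + 1))) - ∑ k ∈ F, c k * ex k (p i)‖) (x := atTop) ?_
      (Eventually.of_forall htr)
  refine tendsto_finsetSum _ fun i _ => ?_
  have h1 : ∀ x, Tendsto (fun F : Finset ℤ => ∑ k ∈ F, c k * ex k x) atTop (nhds (ev c x)) :=
    fun x => by
      simpa only [ev, HasSum, SummationFilter.unconditional_filter] using
        (summable_ev (h.summable hC) x).hasSum
  exact ((h1 _).sub (h1 _)).norm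

/-- The points at which a family of continuous functions is measurable in the parameter form a
closed set. -/
lemma isClosed_setOf_aestronglyMeasurable {g : ℝ → ℝ → ℂ} {I : Set ℝ} (hI : MeasurableSet I)
    (hg : ∀ s ∈ I, Continuous (g s)) :
    IsClosed {x | AEStronglyMeasurable (fun s => g s x) (volume.restrict I)} := by
  refine isClosed_of_closure_subset fun x hx => ?_
  obtain ⟨y, hy, hyx⟩ := mem_closure_iff_seq_limit.1 hx
  refine aestronglyMeasurable_of_tendsto_ae atTop hy ?_
  filter_upwards [ae_restrict_mem hI] with s hs
  exact ((hg s hs).tendsto x).comp hyx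

/-- A superposition of functions bounded in `H¹` has bounded variation, on the set of points where
it is defined. -/
lemma boundedVariationOn_integral {C t : ℝ} {c : ℝ → ℤ → ℂ} (hC : 0 ≤ C) (ht : 0 ≤ t)
    (hc : ∀ s ∈ Set.Ioc 0 t, Bh C (c s)) :
    BoundedVariationOn (fun x => ∫ s in (0:ℝ)..t, ev (c s) x)
      ({x | AEStronglyMeasurable (fun s => ev (c s) x) (volume.restrict (Set.Ioc 0 t))} ∩
        Set.Icc 0 (2 * Real.pi)) := by
  set F := {x | AEStronglyMeasurable (fun s => ev (c s) x) (volume.restrict (Set.Ioc 0 t))}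
  have h_int : ∀ x ∈ F, Integrable (fun s => ev (c s) x) (volume.restrict (Set.Ioc 0 t)) := by
    intro x hx
    refine Integrable.of_bound hx (kap * C) ?_
    filter_upwards [ae_restrict_mem measurableSet_Ioc] with s hs
    exact (hc s hs).norm_ev_le hC x
  have hD : 0 ≤ t * (Real.pi * (C ^ 2 + 1)) := by positivity
  refine ne_top_of_le_ne_top (b := ENNReal.ofReal (t * (Real.pi * (C ^ 2 + 1))))
    ENNReal.ofReal_ne_top (iSup_le ?_)
  rintro ⟨n, p, hp, hpF⟩
  simp only [edist_dist, dist_eq_norm]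
  rw [← ENNReal.ofReal_sum_of_nonneg fun _ _ => norm_nonneg _]
  refine ENNReal.ofReal_le_ofReal ?_
  have h1 : ∀ i, ‖(∫ s in (0:ℝ)..t, ev (c s) (p (i + 1))) - ∫ s in (0:ℝ)..t, ev (c s) (p i)‖
      ≤ ∫ s in Set.Ioc 0 t, ‖ev (c s) (p (i + 1)) - ev (c s) (p i)‖ := by
    intro i
    rw [intervalIntegral.integral_of_le ht, intervalIntegral.integral_of_le ht,
      ← integral_sub (h_int _ (hpF _).1) (h_int _ (hpF _).1)]
    exact norm_integral_le_integral_norm _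
  have h2 : ∀ i, Integrable (fun s => ‖ev (c s) (p (i + 1)) - ev (c s) (p i)‖)
      (volume.restrict (Set.Ioc 0 t)) := fun i => ((h_int _ (hpF _).1).sub (h_int _ (hpF _).1)).norm
  refine (Finset.sum_le_sum fun i _ => h1 i).trans ?_
  rw [← integral_finsetSum _ fun i _ => h2 i]
  calc _ ≤ ∫ s in Set.Ioc 0 t, Real.pi * (C ^ 2 + 1) := by
        refine setIntegral_mono_on (integrable_finsetSum _ fun i _ => h2 i)
          (by exact integrableOn_const (by simp)) measurableSet_Ioc fun s hs => ?_
        exact (hc s hs).sum_norm_ev_sub_le hC hp fun i => (hpF i).2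
    _ = t * (Real.pi * (C ^ 2 + 1)) := by simp [ht]

/-- A Duhamel-type representation makes a function with smooth representative differentiable almost
everywhere, whatever the measurability of the integrand. -/
lemma ae_differentiableAt_of_duhamel {C M t : ℝ} {c : ℝ → ℤ → ℂ} {b : ℤ → ℂ} {w φ : ℝ → ℂ}
    (hC : 0 ≤ C) (hM : 0 ≤ M) (ht : 0 ≤ t) (hc : ∀ s ∈ Set.Ioc 0 t, Bh C (c s)) (hb : Bd M b)
    (hφ : Differentiable ℝ φ) (hw : ∀ x, w x = φ x - ∫ s in (0:ℝ)..t, ev (c s) x)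
    (hwb : ∀ᵐ x, w x = ev b x) :
    ∀ᵐ x, x ∈ Set.Ioo 0 (2 * Real.pi) → DifferentiableAt ℝ w x := by
  set F := {x | AEStronglyMeasurable (fun s => ev (c s) x) (volume.restrict (Set.Ioc 0 t))}
    with hF
  have hFc : IsClosed F := isClosed_setOf_aestronglyMeasurable measurableSet_Ioc fun s hs =>
    continuous_ev ((hc s hs).summable hC)
  have hevb := continuous_ev (hb.summable hM)
  have hwφ : ∀ x ∉ F, w x = φ x := by
    intro x hx
    rw [hw, intervalIntegral.integral_of_le ht, integral_non_aestronglyMeasurable hx, sub_zero]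
  have hwU : ∀ x ∉ F, w x = ev b x := by
    intro x hx
    have h1 := (Measure.dense_of_ae hwb).open_subset_closure_inter hFc.isOpen_compl hx
    have h2 : IsClosed {x | φ x = ev b x} := isClosed_eq hφ.continuous hevb
    rw [hwφ x hx]
    refine h2.closure_subset_iff.2 ?_ h1
    rintro y ⟨hy, hy'⟩
    exact (hwφ y hy).symm.trans hy'
  have hbv := (boundedVariationOn_integral hC ht hc).locallyBoundedVariationOn
    |>.ae_differentiableWithinAt_of_mem
  filter_upwards [hbv, hwb, ae_uniqueDiffWithinAt (F ∩ Set.Icc 0 (2 * Real.pi) ∩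
    {x | w x = ev b x})] with x h1 h2 h3 hx
  have hx' : x ∈ Set.Icc 0 (2 * Real.pi) := ⟨hx.1.le, hx.2.le⟩
  have hd := hb.hasDerivAt_ev hM x
  have hU : HasDerivWithinAt w (ev (Dc b) x) Fᶜ x :=
    hd.hasDerivWithinAt.congr (fun y hy => hwU y hy) h2
  by_cases hxF : x ∈ F
  · have h4 : DifferentiableWithinAt ℝ w (F ∩ Set.Icc 0 (2 * Real.pi)) x := by
      refine ((hφ x).differentiableWithinAt.sub (h1 ⟨hxF, hx'⟩)).congr (fun y _ => hw y) (hw x)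
    have h5 := h4.hasDerivWithinAt
    have h6 := h5.mono (t := F ∩ Set.Icc 0 (2 * Real.pi)) (s := F ∩ Set.Icc 0 (2 * Real.pi) ∩
      {x | w x = ev b x}) Set.inter_subset_left
    have h7 := hd.hasDerivWithinAt (s := F ∩ Set.Icc 0 (2 * Real.pi) ∩ {x | w x = ev b x})
      |>.congr (f₁ := w) (fun y hy => hy.2) h2
    rw [(h3 ⟨⟨hxF, hx'⟩, h2⟩).eq_deriv _ h6 h7] at h5
    refine ((h5.union hU).hasDerivAt ?_).differentiableAt
    filter_upwards [isOpen_Ioo.mem_nhds hx] with y hy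
    by_cases hyF : y ∈ F
    · exact Or.inl ⟨hyF, hy.1.le, hy.2.le⟩
    · exact Or.inr hyF
  · exact (hU.hasDerivAt (hFc.isOpen_compl.mem_nhds hxF)).differentiableAt

lemma summable_ev_iff {a : ℤ → ℂ} {x : ℝ} :
    (Summable fun k => a k * ex k x) ↔ Summable fun k => ‖a k‖ := by
  rw [← summable_norm_iff]
  simp only [norm_mul, norm_ex, mul_one]

lemma ev_zero (x : ℝ) : ev (fun _ => 0) x = 0 := by simp [ev]

/-- Junk values do not disturb the nonlinearity of a mild solution. -/
lemma IsMildSolution.fc_NL {σ T : ℝ} (hσ : 1 ≤ σ) {u₀ : ℝ → ℂ} (hu₀ : MemHs 2 u₀)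
    {v : ℝ → ℝ → ℂ} (hv : ContHs 2 T v) (h : IsMildSolution σ T u₀ v) :
    ∀ t ∈ Set.Icc 0 T, fc (NL σ (v t)) = Nc σ (fc (v t)) := by
  obtain ⟨M, hM, hb⟩ := hv.exists_bd
  obtain ⟨C, hC, hN⟩ := exists_Bh_fc_NL hσ M hM
  have hae : ∀ t ∈ Set.Icc 0 T, ∀ᵐ x, v t x = ev (fc (v t)) x := fun t ht =>
    ae_eq_ev_fc (hv.1 t ht).1 (hv.1 t ht).2.1 ((hb t ht).summable hM)
  have hSg : ∀ s ∈ Set.Icc 0 T, ∃ n : ℤ → ℂ, Bh C n ∧ ∀ r x,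
      Sg r (NL σ (v s)) x = ev (fun k => ph r k * n k) x := by
    intro s hs
    by_cases hsum : Summable fun k => ‖fc (NL σ (v s)) k‖
    · exact ⟨_, hN _ _ (hb s hs) (hv.1 s hs).1 (hae s hs) hsum, fun r x => rfl⟩
    · refine ⟨fun _ => 0, fun S => by simpa using sq_nonneg C, fun r x => ?_⟩
      simp only [mul_zero, ev_zero, Sg_eq_ev]
      refine tsum_eq_zero_of_not_summable ?_
      rw [summable_ev_iff]
      simpa only [norm_mul, norm_ph, one_mul] using hsum
  choose! n hn hSgn using hSg
  intro t ht
  have hsub : Set.Icc 0 t ⊆ Set.Icc 0 T := Set.Icc_subset_Icc_right ht.2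
  have hdiff := ae_differentiableAt_of_duhamel (t := t) (φ := Sg t u₀) (b := fc (v t)) (w := v t)
    (c := fun s k => ph (t - s) k * n s k) hC hM ht.1
    (fun s hs => (hn s (hsub ⟨hs.1.le, hs.2⟩)).ph_mul _) (hb t ht)
    (fun x => ((hu₀.bd.ph_mul t).hasDerivAt_ev (HsNorm_nonneg _ _) x).differentiableAt)
    (fun x => by
      rw [h t ht x]
      congr 1
      refine intervalIntegral.integral_congr fun s hs => ?_
      rw [Set.uIcc_of_le ht.1] at hs
      exact hSgn s (hsub hs) _ x) (hae t ht)
  ext k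
  rw [Nc, fc, fc]
  congr 1
  simp only [intervalIntegral.integral_of_le two_pi_pos'.le, integral_Ioc_eq_integral_Ioo]
  refine setIntegral_congr_ae measurableSet_Ioo ?_
  filter_upwards [hdiff, ae_NL_eq (σ := σ) hM (hb t ht) (hae t ht)] with x h1 h2 hx
  rw [h2 (h1 hx)]

lemma IsMildSolution.solOn {σ T : ℝ} (hσ : 1 ≤ σ) (hT : 0 ≤ T) {u₀ : ℝ → ℂ} (hu₀ : MemHs 2 u₀)
    {v : ℝ → ℝ → ℂ} (hv : ContHs 2 T v) (h : IsMildSolution σ T u₀ v) :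
    SolOn σ 1 T (fun t => fc (v t)) Set.univ ∧ fc (v 0) = fc u₀ ∧
      ∀ t ∈ Set.Icc 0 T, v t = ev (fc (v t)) := by
  obtain ⟨M, hM, hb⟩ := hv.exists_bd
  obtain ⟨C, hC, hN⟩ := exists_Bh_Nc hσ M hM
  have hc : ∀ k, ContinuousOn (fun s => Nc σ (fc (v s)) k) (Set.Icc 0 T) := fun k =>
    continuousOn_Nc hσ hM hb hv.continuousOn_fc k
  have key : ∀ t ∈ Set.Icc 0 T, v t = ev (fc (v t)) ∧ ∀ k, fc (v t) k =
      ph t k * fc u₀ k - ∫ s in (0:ℝ)..t, ph (t - s) k * Nc σ (fc (v s)) k := by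
    intro t ht
    have hsub : Set.Icc 0 t ⊆ Set.Icc 0 T := Set.Icc_subset_Icc_right ht.2
    have h1 : ∀ x, HasSum (fun k => (ph t k * fc u₀ k -
        ∫ s in (0:ℝ)..t, ph (t - s) k * Nc σ (fc (v s)) k) * ex k x) (v t x) := by
      intro x
      have h2 := duhamel hC ht.1 (n := fun s => Nc σ (fc (v s)))
        (fun s hs => hN _ (hb s (hsub hs))) (fun k => (hc k).mono hsub) x
      have h3 := (summable_ev ((hu₀.bd.ph_mul t).summable (HsNorm_nonneg _ _)) x).hasSum.sub h2
      simp only [← sub_mul] at h3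
      have h4 : ∫ s in (0:ℝ)..t, Sg (t - s) (NL σ (v s)) x
          = ∫ s in (0:ℝ)..t, ev (fun k => ph (t - s) k * Nc σ (fc (v s)) k) x := by
        refine intervalIntegral.integral_congr fun s hs => ?_
        rw [Set.uIcc_of_le ht.1] at hs
        simp only [Sg_eq_ev, h.fc_NL hσ hu₀ hv s (hsub hs)]
      rw [h t ht x, h4]
      exact h3
    have h4 := summable_ev_iff.1 (h1 0).summable
    have h5 : v t = ev _ := funext fun x => (h1 x).tsum_eq.symm
    have h6 := fc_ev h4
    rw [← h5] at h6
    exact ⟨by rw [funext h6]; exact h5, h6⟩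
  have h0 : fc (v 0) = fc u₀ := by
    ext k
    simpa [ph_zero] using (key 0 ⟨le_rfl, hT⟩).2 k
  refine ⟨SolOn.of_duhamel hT hc fun k t ht => ?_, h0, fun t ht => (key t ht).1⟩
  simp only [h0]
  exact (key t ht).2 k

/-- For real `σ ≥ 1` and `u₀ ∈ H²(𝕋)`, there exist `T > 0` and a unique
`u ∈ C([0,T];H²)` which is a mild solution of gDNLS with initial data `u₀`. -/
theorem statement1 (σ : ℝ) (hσ : 1 ≤ σ) (u₀ : ℝ → ℂ) (hu₀ : MemHs 2 u₀) :
    ∃ T : ℝ, 0 < T ∧ ∃ u : ℝ → ℝ → ℂ,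
      (ContHs 2 T u ∧ IsMildSolution σ T u₀ u) ∧
      ∀ v : ℝ → ℝ → ℂ, ContHs 2 T v → IsMildSolution σ T u₀ v →
        ∀ t ∈ Set.Icc (0:ℝ) T, v t = u t := by
  obtain ⟨T, M, C, hT, hM, -, hex⟩ := exists_solution hσ (HsNorm 2 u₀) (HsNorm_nonneg _ _)
  obtain ⟨a, ha0, ha, hsol, -⟩ := hex 1 (fc u₀) abs_one hu₀.bd
  refine ⟨T, hT, fun t => ev (a t), ⟨hsol.contHs hσ hM ha, hsol.isMildSolution hσ hM ha ha0⟩,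
    fun v hv hmild t ht => ?_⟩
  obtain ⟨hvs, hv0, hveq⟩ := hmild.solOn hσ hT.le hu₀ hv
  obtain ⟨M', hM', hb⟩ := hv.exists_bd
  have := solution_unique hσ (le_max_of_le_left hM) abs_one.le
    (fun t ht => (ha t ht).mono hM (le_max_left M M'))
    (fun t ht => (hb t ht).mono hM' (le_max_right M M')) hsol hvs (ha0.trans hv0.symm) t ht
  rw [hveq t ht, ← this]
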